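/- The number of isomorphism classes of connected distance-hereditary simple graphs on n vertices, for n = 1, 2, 3, ..., 18, is respectively 1, 1, 2, 6, 18, 73, 308, 1484, 7492, 40010, 220676, 1253940, 7282316, 43096792, 259019070, 1577653196, 9720170360, 60492629435. -/

import Mathlib

/-- A simple graph is distance-hereditary if in every connected induced subgraph,
distances agree with those in the ambient graph. -/
def DistanceHereditary {V : Type} (G : SimpleGraph V) : Prop :=
  ∀ S : Set V, (G.induce S).Connected →
    ∀ u v : S, (G.induce S).dist u v = G.dist u.val v.val

/-- The number of isomorphism classes of connected distance-hereditary simple graphs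
on `n` vertices. -/
noncomputable def numConnDH (n : ℕ) : ℕ :=
  Nat.card (Quot (fun (G G' : {G : SimpleGraph (Fin n) // G.Connected ∧ DistanceHereditary G}) =>
    Nonempty (G.val ≃g G'.val)))

namespace DHCount

/-- Terms describing marked graphs: a single marked vertex, the disjoint union (`op false`) or the
join along the marked vertices (`op true`) of two marked graphs, and the join in which only the
marks of the first graph are kept (`att`). -/
inductive Tm : Type
  | leaf : Tm
  | op (f : Bool) (a b : Tm) : Tm
  | att (a b : Tm) : Tm

/-- The number of leaves of a term. -/
def Tm.size : Tm → ℕ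
  | leaf => 1
  | op _ a b => a.size + b.size
  | att a b => a.size + b.size

/-- The congruence on terms generated by the laws satisfied by the operations on marked graphs. -/
inductive Tm.Eqv : Tm → Tm → Prop
  | refl (a : Tm) : Eqv a a
  | symm {a b : Tm} : Eqv a b → Eqv b a
  | trans {a b c : Tm} : Eqv a b → Eqv b c → Eqv a c
  | op_congr (f : Bool) {a a' b b' : Tm} : Eqv a a' → Eqv b b' → Eqv (op f a b) (op f a' b')
  | att_congr {a a' b b' : Tm} : Eqv a a' → Eqv b b' → Eqv (att a b) (att a' b')
  | comm (f : Bool) (a b : Tm) : Eqv (op f a b) (op f b a)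
  | assoc (f : Bool) (a b c : Tm) : Eqv (op f (op f a b) c) (op f a (op f b c))
  | att_att (a b c : Tm) : Eqv (att (att a b) c) (att a (op false b c))

instance tmSetoid : Setoid Tm where
  r := Tm.Eqv
  iseqv := ⟨Tm.Eqv.refl, Tm.Eqv.symm, Tm.Eqv.trans⟩

/-- Terms up to the laws of the operations. -/
def R : Type := Quotient tmSetoid

namespace R

def mk (t : Tm) : R := Quotient.mk _ t

theorem sound {s t : Tm} (h : Tm.Eqv s t) : mk s = mk t := Quotient.sound h

def leaf : R := mk .leaf

def op (f : Bool) : R → R → R :=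
  Quotient.map₂ (Tm.op f) fun _ _ h _ _ h' => Tm.Eqv.op_congr f h h'

def att : R → R → R :=
  Quotient.map₂ Tm.att fun _ _ h _ _ h' => Tm.Eqv.att_congr h h'

theorem mk_op (f : Bool) (a b : Tm) : mk (.op f a b) = op f (mk a) (mk b) := rfl

theorem mk_att (a b : Tm) : mk (.att a b) = att (mk a) (mk b) := rfl

theorem induction {p : R → Prop} (hl : p leaf) (ho : ∀ f a b, p a → p b → p (op f a b))
    (ha : ∀ a b, p a → p b → p (att a b)) (x : R) : p x := by
  induction x using Quotient.inductionOn with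
  | h t =>
    induction t with
    | leaf => exact hl
    | op f a b iha ihb => exact ho f _ _ iha ihb
    | att a b iha ihb => exact ha _ _ iha ihb

theorem op_comm (f : Bool) (a b : R) : op f a b = op f b a := by
  induction a, b using Quotient.inductionOn₂ with
  | h a b => exact sound (.comm f a b)

theorem op_assoc (f : Bool) (a b c : R) : op f (op f a b) c = op f a (op f b c) := by
  induction a, b, c using Quotient.inductionOn₃ with
  | h a b c => exact sound (.assoc f a b c)

theorem att_att (a b c : R) : att (att a b) c = att a (op false b c) := by
  induction a, b, c using Quotient.inductionOn₃ with
  | h a b c => exact sound (.att_att a b c)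

def size : R → ℕ := Quotient.lift Tm.size <| by
  intro a b h
  induction h with
  | refl => rfl
  | symm _ ih => exact ih.symm
  | trans _ _ ih ih' => exact ih.trans ih'
  | _ => simp only [Tm.size] at *; omega

@[simp] theorem size_mk (t : Tm) : size (mk t) = t.size := rfl

@[simp] theorem size_leaf : size leaf = 1 := rfl

@[simp] theorem size_op (f : Bool) (a b : R) : size (op f a b) = size a + size b := by
  induction a, b using Quotient.inductionOn₂ with
  | h a b => rfl

@[simp] theorem size_att (a b : R) : size (att a b) = size a + size b := by
  induction a, b using Quotient.inductionOn₂ with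
  | h a b => rfl

theorem size_pos (x : R) : 0 < size x := by
  induction x using induction with
  | hl => simp
  | ho f a b _ _ => simp; omega
  | ha a b _ _ => simp; omega

/-- The outermost operation of a term. -/
def kindT : Tm → Option (Option Bool)
  | .leaf => none
  | .op f _ _ => some (some f)
  | .att _ _ => some none

def kind : R → Option (Option Bool) := Quotient.lift kindT <| by
  intro a b h
  induction h with
  | symm _ ih => exact ih.symm
  | trans _ _ ih ih' => exact ih.trans ih'
  | _ => rfl

@[simp] theorem kind_leaf : kind leaf = none := rfl

@[simp] theorem kind_op (f : Bool) (a b : R) : kind (op f a b) = some (some f) := by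
  induction a, b using Quotient.inductionOn₂ with
  | h a b => rfl

@[simp] theorem kind_att (a b : R) : kind (att a b) = some none := by
  induction a, b using Quotient.inductionOn₂ with
  | h a b => rfl

/-- `x` is a disjoint union (`f = false`) or a join (`f = true`). -/
abbrev IsOp (f : Bool) (x : R) : Prop := kind x = some (some f)

/-- `x` is of the form `att a b`. -/
abbrev IsAtt (x : R) : Prop := kind x = some none

theorem IsOp.exists {f : Bool} {x : R} (h : IsOp f x) : ∃ a b, x = op f a b := by
  induction x using induction with
  | hl => simp [IsOp] at h
  | ho g a b _ _ =>
    simp [IsOp] at h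
    exact ⟨a, b, by rw [h]⟩
  | ha a b _ _ => simp [IsOp] at h

theorem IsAtt.exists {x : R} (h : IsAtt x) : ∃ a b, x = att a b := by
  induction x using induction with
  | hl => simp [IsAtt] at h
  | ho g a b _ _ => simp [IsAtt] at h
  | ha a b _ _ => exact ⟨a, b, rfl⟩

/-- The factors of a term with respect to the operation `op f`. -/
def facT (f : Bool) : Tm → Multiset R
  | .leaf => {leaf}
  | .op g a b => if g = f then facT f a + facT f b else {mk (.op g a b)}
  | .att a b => {mk (.att a b)}

def fac (f : Bool) : R → Multiset R := Quotient.lift (facT f) <| by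
  intro a b h
  induction h with
  | refl => rfl
  | symm _ ih => exact ih.symm
  | trans _ _ ih ih' => exact ih.trans ih'
  | op_congr g h h' ih ih' =>
    simp only [facT, ih, ih', mk_op, sound h, sound h']
  | att_congr h h' => simp only [facT, mk_att, sound h, sound h']
  | comm g a b => simp only [facT, add_comm, mk_op, op_comm]
  | assoc g a b c =>
    by_cases hg : g = f
    · simp [facT, hg, add_assoc]
    · simp [facT, hg, mk_op, op_assoc]
  | att_att a b c => simp [facT, mk_att, mk_op, R.att_att]

theorem fac_leaf (f : Bool) : fac f leaf = {leaf} := rfl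

theorem fac_op (f g : Bool) (a b : R) :
    fac f (op g a b) = if g = f then fac f a + fac f b else {op g a b} := by
  induction a, b using Quotient.inductionOn₂ with
  | h a b => rfl

@[simp] theorem fac_op_self (f : Bool) (a b : R) : fac f (op f a b) = fac f a + fac f b := by
  simp [fac_op]

theorem fac_att (f : Bool) (a b : R) : fac f (att a b) = {att a b} := by
  induction a, b using Quotient.inductionOn₂ with
  | h a b => rfl

theorem fac_of_not_isOp {f : Bool} {x : R} (h : ¬ IsOp f x) : fac f x = {x} := by
  induction x using induction with
  | hl => rfl
  | ho g a b _ _ =>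
    have : g ≠ f := by simpa [IsOp] using h
    simp [fac_op, this]
  | ha a b _ _ => exact fac_att f a b

theorem not_isOp_of_mem_fac {f : Bool} {x y : R} (h : y ∈ fac f x) : ¬ IsOp f y := by
  induction x using induction with
  | hl => simp [fac_leaf] at h; subst h; simp
  | ho g a b iha ihb =>
    rw [fac_op] at h
    split_ifs at h with hg
    · exact (Multiset.mem_add.1 h).elim iha ihb
    · rw [Multiset.mem_singleton] at h; subst h; simpa using hg
  | ha a b _ _ => rw [fac_att, Multiset.mem_singleton] at h; subst h; simp

theorem fac_ne_zero (f : Bool) (x : R) : fac f x ≠ 0 := by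
  induction x using induction with
  | hl => simp [fac_leaf]
  | ho g a b iha ihb => rw [fac_op]; split_ifs <;> simp [iha]
  | ha a b _ _ => simp [fac_att]

theorem sum_size_fac (f : Bool) (x : R) : ((fac f x).map size).sum = size x := by
  induction x using induction with
  | hl => simp [fac_leaf]
  | ho g a b iha ihb => rw [fac_op]; split_ifs <;> simp [iha, ihb]
  | ha a b _ _ => simp [fac_att]

theorem size_le_of_mem_fac {f : Bool} {x y : R} (h : y ∈ fac f x) : size y ≤ size x := by
  rw [← sum_size_fac f x]
  exact Multiset.single_le_sum (by simp) _ (Multiset.mem_map_of_mem _ h)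

theorem size_lt_of_mem_fac {f : Bool} {x y : R} (hx : IsOp f x) (h : y ∈ fac f x) :
    size y < size x := by
  obtain ⟨a, b, rfl⟩ := hx.exists
  rw [fac_op_self, Multiset.mem_add] at h
  have := size_pos a
  have := size_pos b
  rw [size_op]
  rcases h with h | h <;> have := size_le_of_mem_fac h <;> omega

theorem eq_or_exists_of_mem_fac {f : Bool} {x y : R} (h : y ∈ fac f x) :
    x = y ∨ ∃ z, x = op f y z := by
  induction x using induction with
  | hl => simp [fac_leaf] at h; exact .inl h.symm
  | ho g a b iha ihb =>
    rw [fac_op] at h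
    split_ifs at h with hg
    · subst hg
      rcases Multiset.mem_add.1 h with h | h
      · rcases iha h with rfl | ⟨z, rfl⟩
        · exact .inr ⟨b, rfl⟩
        · exact .inr ⟨op g z b, op_assoc ..⟩
      · rcases ihb h with rfl | ⟨z, rfl⟩
        · exact .inr ⟨a, op_comm ..⟩
        · exact .inr ⟨op g z a, by rw [op_comm, op_assoc]⟩
    · exact .inl (Multiset.mem_singleton.1 h).symm
  | ha a b _ _ =>
    rw [fac_att, Multiset.mem_singleton] at h
    exact .inl h.symm

theorem fac_injective (f : Bool) : Function.Injective (fac f) := by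
  intro x
  induction hn : size x using Nat.strong_induction_on generalizing x with
  | _ n ih =>
    intro y hxy
    obtain ⟨z, hz⟩ := Multiset.exists_mem_of_ne_zero (fac_ne_zero f x)
    have hzz := fac_of_not_isOp (not_isOp_of_mem_fac hz)
    have hz' := hz
    rw [hxy] at hz'
    rcases eq_or_exists_of_mem_fac hz with h1 | ⟨u, h1⟩ <;>
      rcases eq_or_exists_of_mem_fac hz' with h2 | ⟨v, h2⟩
    · rw [h1, h2]
    · rw [h1, h2, fac_op_self, hzz] at hxy
      simp [fac_ne_zero] at hxy
    · rw [h1, h2, fac_op_self, hzz, add_eq_left] at hxy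
      exact absurd hxy (fac_ne_zero f u)
    · rw [h1, h2, fac_op_self, fac_op_self] at hxy
      have hs : size u < n := by
        rw [← hn, h1, size_op]
        have := size_pos z
        omega
      rw [h1, h2, ih _ hs rfl (add_left_cancel hxy)]

theorem exists_fac_eq {f : Bool} {M : Multiset R} (h0 : M ≠ 0) (hM : ∀ y ∈ M, ¬ IsOp f y) :
    ∃ x, fac f x = M := by
  induction M using Multiset.induction with
  | empty => exact absurd rfl h0
  | cons a M ih =>
    have ha := fac_of_not_isOp (hM a (Multiset.mem_cons_self a M))
    by_cases hM0 : M = 0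
    · exact ⟨a, by simp [ha, hM0]⟩
    · obtain ⟨x, hx⟩ := ih hM0 fun y hy => hM y (Multiset.mem_cons_of_mem hy)
      exact ⟨op f a x, by simp [ha, hx]⟩

/-- The leftmost argument in an iterated `att`. -/
def hdT : Tm → R
  | .leaf => leaf
  | .op f a b => mk (.op f a b)
  | .att a _ => hdT a

def hd : R → R := Quotient.lift hdT <| by
  intro a b h
  induction h with
  | refl => rfl
  | symm _ ih => exact ih.symm
  | trans _ _ ih ih' => exact ih.trans ih'
  | op_congr g h h' => simp only [hdT, mk_op, sound h, sound h']
  | att_congr _ _ ih => simpa only [hdT] using ih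
  | comm g a b => simp only [hdT, mk_op, op_comm]
  | assoc g a b c => simp only [hdT, mk_op, op_assoc]
  | att_att a b c => rfl

/-- The parts attached to the leftmost argument in an iterated `att`. -/
def tlT : Tm → Multiset R
  | .att a b => tlT a + facT false b
  | _ => 0

def tl : R → Multiset R := Quotient.lift tlT <| by
  intro a b h
  induction h with
  | symm _ ih => exact ih.symm
  | trans _ _ ih ih' => exact ih.trans ih'
  | att_congr _ h ih =>
    simp only [tlT, ih]
    congr 1
    exact congrArg (fac false) (sound h)
  | att_att a b c => simp [tlT, facT, add_assoc]
  | _ => rfl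

@[simp] theorem hd_att (a b : R) : hd (att a b) = hd a := by
  induction a, b using Quotient.inductionOn₂ with
  | h a b => rfl

@[simp] theorem tl_att (a b : R) : tl (att a b) = tl a + fac false b := by
  induction a, b using Quotient.inductionOn₂ with
  | h a b => rfl

theorem hd_op (f : Bool) (a b : R) : hd (op f a b) = op f a b := by
  induction a, b using Quotient.inductionOn₂ with
  | h a b => rfl

theorem tl_op (f : Bool) (a b : R) : tl (op f a b) = 0 := by
  induction a, b using Quotient.inductionOn₂ with
  | h a b => rfl

theorem hd_of_not_isAtt {x : R} (h : ¬ IsAtt x) : hd x = x := by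
  induction x using induction with
  | hl => rfl
  | ho f a b _ _ => exact hd_op f a b
  | ha a b _ _ => simp at h

theorem tl_of_not_isAtt {x : R} (h : ¬ IsAtt x) : tl x = 0 := by
  induction x using induction with
  | hl => rfl
  | ho f a b _ _ => exact tl_op f a b
  | ha a b _ _ => simp at h

theorem not_isAtt_hd (x : R) : ¬ IsAtt (hd x) := by
  induction x using induction with
  | hl => exact fun h => by simp [IsAtt, show hd leaf = leaf from rfl] at h
  | ho f a b _ _ => simp [hd_op]
  | ha a b ih _ => simpa using ih

theorem not_isOp_of_mem_tl {x y : R} (h : y ∈ tl x) : ¬ IsOp false y := by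
  induction x using induction with
  | hl => simp [show tl leaf = 0 from rfl] at h
  | ho f a b _ _ => simp [tl_op] at h
  | ha a b ih _ =>
    rw [tl_att, Multiset.mem_add] at h
    exact h.elim ih not_isOp_of_mem_fac

theorem size_hd_add (x : R) : size (hd x) + ((tl x).map size).sum = size x := by
  induction x using induction with
  | hl => rfl
  | ho f a b _ _ => simp [hd_op, tl_op]
  | ha a b ih _ => simp [sum_size_fac, ← ih, add_assoc]

theorem IsAtt.exists_att_hd {x : R} (h : IsAtt x) :
    ∃ w, x = att (hd x) w ∧ fac false w = tl x := by
  induction x using induction with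
  | hl => simp [IsAtt] at h
  | ho f a b _ _ => simp [IsAtt] at h
  | ha a b ih _ =>
    by_cases ha : IsAtt a
    · obtain ⟨w, h1, h2⟩ := ih ha
      refine ⟨op false w b, ?_, by simp [h2]⟩
      rw [hd_att, ← att_att, ← h1]
    · exact ⟨b, by simp [hd_of_not_isAtt ha], by simp [tl_of_not_isAtt ha]⟩

theorem size_le_of_mem_tl {x y : R} (h : y ∈ tl x) : size y + size (hd x) ≤ size x := by
  have := size_hd_add x
  have := Multiset.single_le_sum (by simp) _ (Multiset.mem_map_of_mem size h)
  omega

theorem size_hd_lt {x : R} (h : IsAtt x) : size (hd x) < size x := by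
  obtain ⟨w, h1, -⟩ := h.exists_att_hd
  have h2 := congrArg size h1
  rw [size_att] at h2
  have := size_pos w
  omega

end R
open R

/-- Normal forms of unrooted graphs: the graph is cut at its centroid. -/
inductive NF : Type
  | edge (p : Sym2 R) : NF
  | clique (M : Multiset R) : NF
  | star (c : R) (M : Multiset R) : NF

namespace R

/-- The operation by which `b` is moved to `a` in a glueing of `a` and `op f b c`. -/
def jn : Bool → R → R → R
  | true, a, b => op true a b
  | false, a, b => att a b

@[simp] theorem size_jn (f : Bool) (a b : R) : size (jn f a b) = size a + size b := by
  cases f <;> simp [jn]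

/-- The centroid node between `a` and a graph of the form `op f b c`. -/
def node : Bool → R → R → NF
  | true, a, b => .clique (fac true a + fac true b)
  | false, a, b => .star (hd a) (tl a + fac false b)

open Classical in
/-- The normal form of a glueing of two graphs of the same size. -/
noncomputable def mid (a b : R) : NF :=
  if IsOp true a ∧ IsOp true b then node true a b
  else if IsOp false a ∧ IsAtt b then node false b a
  else if IsAtt a ∧ IsOp false b then node false a b
  else .edge s(a, b)

theorem mid_comm (a b : R) : mid a b = mid b a := by
  unfold mid
  rw [Sym2.eq_swap]
  split_ifs <;> simp_all [node, add_comm, IsOp, IsAtt]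

theorem mid_jn_op (f : Bool) (a b c d : R) :
    mid (jn f a b) (op f c d) = node f (jn f a b) (op f c d) := by
  cases f <;> simp [mid, jn, IsOp, IsAtt]

theorem mid_op_att (a b c d : R) :
    mid (op false a b) (att c d) = node false (att c d) (op false a b) := by
  simp [mid, IsOp, IsAtt]

theorem node_jn_op (f : Bool) (a b c d : R) :
    node f (jn f a b) (op f c d) = node f a (op f b (op f c d)) := by
  cases f <;> simp [node, jn, add_assoc]

/-- The normal form of a glueing of `a` and `b`, provided that `b` is at least as large as `a`. -/
noncomputable def descendT : Tm → R → NF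
  | .leaf, a => mid a leaf
  | .op f b c, a =>
    if size a = b.size + c.size then mid a (mk (.op f b c))
    else if size a + c.size ≤ b.size then descendT b (jn f a (mk c))
    else if size a + b.size ≤ c.size then descendT c (jn f a (mk b))
    else node f a (mk (.op f b c))
  | .att b c, a =>
    if size a = b.size + c.size then mid a (mk (.att b c))
    else if size a + c.size ≤ b.size then descendT b (op false a (mk c))
    else if size a + b.size ≤ c.size then descendT c (att (mk b) a)
    else node false (mk (.att b c)) a

theorem size_posT (t : Tm) : 0 < t.size := size_pos (mk t)

theorem sizeT_eq {s t : Tm} (h : Tm.Eqv s t) : s.size = t.size := congrArg size (sound h)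

theorem descendT_congr {s t : Tm} (h : Tm.Eqv s t) : ∀ a, descendT s a = descendT t a := by
  induction h with
  | refl => exact fun _ => rfl
  | symm _ ih => exact fun a => (ih a).symm
  | trans _ _ ih ih' => exact fun a => (ih a).trans (ih' a)
  | op_congr f h h' ih ih' =>
    intro a
    simp only [descendT, ih, ih', sizeT_eq h, sizeT_eq h', sound h, sound h', mk_op]
  | att_congr h h' ih ih' =>
    intro a
    simp only [descendT, ih, ih', sizeT_eq h, sizeT_eq h', sound h, sound h', mk_att]
  | comm f b c =>
    intro a
    have := size_pos a
    have := size_posT b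
    have := size_posT c
    simp only [descendT, mk_op, op_comm f (mk c), add_comm c.size]
    split_ifs <;> first | rfl | omega
  | assoc f b c d =>
    intro a
    have := size_pos a
    have := size_posT b
    have := size_posT c
    have := size_posT d
    simp only [descendT, mk_op, Tm.size, size_jn, size_mk]
    have e1 : jn f (jn f a (mk d)) (mk c) = jn f a (op f (mk c) (mk d)) := by
      cases f
      · simp only [jn, R.att_att]
        rw [op_comm]
      · simp only [jn, op_assoc]
        rw [op_comm true (mk d)]
    have e2 : jn f (jn f a (mk d)) (mk b) = jn f (jn f a (mk b)) (mk d) := by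
      cases f
      · simp only [jn, R.att_att]
        rw [op_comm]
      · simp only [jn, op_assoc]
        rw [op_comm true (mk d)]
    have e3 : jn f (jn f a (mk b)) (mk c) = jn f a (op f (mk b) (mk c)) := by
      cases f <;> simp [jn, R.att_att, op_assoc]
    have e4 : op f (mk d) (op f (mk b) (mk c)) = op f (op f (mk b) (mk c)) (mk d) := op_comm ..
    simp only [e1, e2, e3, mid_jn_op, node_jn_op, op_assoc, e4]
    split_ifs <;> first | rfl | omega
  | att_att b c d =>
    intro a
    have := size_pos a
    have := size_posT b
    have := size_posT c
    have := size_posT d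
    have s1 : (Tm.att b c).size = b.size + c.size := rfl
    have s2 : (Tm.op false c d).size = c.size + d.size := rfl
    have s3 := size_op false a (mk d)
    have s4 := size_att (mk b) a
    rw [size_mk] at s3 s4
    simp only [descendT, mk_op, mk_att]
    generalize mk b = b', mk c = c', mk d = d' at *
    have e1 : op false (op false a d') c' = op false a (op false c' d') := by
      rw [op_assoc, op_comm false c']
    have e2 : att b' (op false a d') = jn false (att b' a) d' := by
      simp [jn, R.att_att]
    have e3 : jn false (att b' a) c' = att (att b' c') a := by
      simp [jn, R.att_att, op_comm]
    have e4 : mid (op false a d') (att b' c') =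
        node false (att (att b' c') d') a := by
      rw [mid_op_att]
      simp [node, add_assoc, add_comm]
    have e5 : mid (att b' a) (op false c' d') =
        node false (att (att b' c') d') a := by
      have := mid_jn_op false b' a c' d'
      simp only [jn] at this
      rw [this]
      simp [node, add_assoc, add_comm, add_left_comm]
    have e6 : node false (att b' c') (op false a d') =
        node false (att (att b' c') d') a := by
      simp [node, add_assoc, add_comm]
    have e7 : node false (att b' a) (op false c' d') =
        node false (att (att b' c') d') a := by
      simp [node, add_assoc, add_comm, add_left_comm]
    rw [e1, e2, e3, e4, e5, e6, e7, ← R.att_att b' c' d']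
    clear e1 e2 e3 e4 e5 e6 e7
    by_cases h0 : a.size = (b.att c).size + d.size
    · have h0' : a.size = b.size + (Tm.op false c d).size := by omega
      rw [if_pos h0, if_pos h0']
    have h0' : ¬ a.size = b.size + (Tm.op false c d).size := by omega
    rw [if_neg h0, if_neg h0']
    have key : ¬ a.size + (Tm.op false c d).size ≤ b.size →
        ∀ x : NF, (a.size + b.size ≤ (Tm.op false c d).size →
          ¬ (att b' a).size = c.size + d.size → (att b' a).size + d.size ≤ c.size →
            x = descendT c (jn false (b'.att a) d')) →
        (a.size + b.size ≤ (Tm.op false c d).size →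
          ¬ (att b' a).size = c.size + d.size → (att b' a).size + c.size ≤ d.size →
            x = descendT d ((b'.att c').att a)) →
        (¬ (a.size + b.size + d.size ≤ c.size) → ¬ (a.size + b.size + c.size ≤ d.size) →
          x = node false ((b'.att c').att d') a) →
        x = if a.size + (Tm.op false c d).size ≤ b.size then
            descendT b (op false a (op false c' d'))
          else if a.size + b.size ≤ (Tm.op false c d).size then
            if (b'.att a).size = c.size + d.size then node false ((b'.att c').att d') a
            else if (b'.att a).size + d.size ≤ c.size then descendT c (jn false (b'.att a) d')
            else if (b'.att a).size + c.size ≤ d.size then descendT d ((b'.att c').att a)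
            else node false ((b'.att c').att d') a
          else node false ((b'.att c').att d') a := by
      intro h x hx1 hx2 hx3
      rw [if_neg h]
      by_cases h1 : a.size + b.size ≤ (Tm.op false c d).size
      · rw [if_pos h1]
        by_cases h2 : (att b' a).size = c.size + d.size
        · rw [if_pos h2]
          exact hx3 (by omega) (by omega)
        · rw [if_neg h2]
          by_cases h3 : (att b' a).size + d.size ≤ c.size
          · rw [if_pos h3]
            exact hx1 h1 h2 h3
          · rw [if_neg h3]
            by_cases h4 : (att b' a).size + c.size ≤ d.size
            · rw [if_pos h4]
              exact hx2 h1 h2 h4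
            · rw [if_neg h4]
              exact hx3 (by omega) (by omega)
      · rw [if_neg h1]
        exact hx3 (by omega) (by omega)
    by_cases h1 : a.size + d.size ≤ (b.att c).size
    · rw [if_pos h1]
      by_cases h2 : (op false a d').size = b.size + c.size
      · rw [if_pos h2]
        exact key (by omega) _ (fun _ _ _ => by omega) (fun _ _ _ => by omega) fun _ _ => rfl
      · rw [if_neg h2]
        by_cases h3 : (op false a d').size + c.size ≤ b.size
        · have h3' : a.size + (Tm.op false c d).size ≤ b.size := by omega
          rw [if_pos h3, if_pos h3']
        · rw [if_neg h3]
          by_cases h4 : (op false a d').size + b.size ≤ c.size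
          · rw [if_pos h4]
            exact key (by omega) _ (fun _ _ _ => rfl) (fun _ _ _ => by omega)
              fun _ _ => by omega
          · rw [if_neg h4]
            exact key (by omega) _ (fun _ _ _ => by omega) (fun _ _ _ => by omega)
              fun _ _ => rfl
    · rw [if_neg h1]
      by_cases h4 : a.size + (b.att c).size ≤ d.size
      · rw [if_pos h4]
        exact key (by omega) _ (fun _ _ _ => by omega) (fun _ _ _ => rfl)
          fun _ _ => by omega
      · rw [if_neg h4]
        exact key (by omega) _ (fun _ _ _ => by omega) (fun _ _ _ => by omega)
          fun _ _ => rfl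

noncomputable def descend : R → R → NF :=
  Quotient.lift descendT fun _ _ h => funext (descendT_congr h)

theorem descend_of_size_eq {a b : R} (h : size a = size b) : descend b a = mid a b := by
  induction b using Quotient.inductionOn with
  | h t =>
    cases t with
    | leaf => rfl
    | op f b c => exact if_pos h
    | att b c => exact if_pos h

theorem descend_op (f : Bool) (a b c : R) (h : size a ≠ size b + size c) :
    descend (op f b c) a =
      if size a + size c ≤ size b then descend b (jn f a c)
      else if size a + size b ≤ size c then descend c (jn f a b)
      else node f a (op f b c) := by
  induction b, c using Quotient.inductionOn₂ with
  | h b c => exact if_neg h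

theorem descend_att (a b c : R) (h : size a ≠ size b + size c) :
    descend (att b c) a =
      if size a + size c ≤ size b then descend b (op false a c)
      else if size a + size b ≤ size c then descend c (att b a)
      else node false (att b c) a := by
  induction b, c using Quotient.inductionOn₂ with
  | h b c => exact if_neg h

/-- The normal form of a glueing of `a` and `b`. -/
noncomputable def cen (a b : R) : NF := if size a ≤ size b then descend b a else descend a b

theorem cen_of_le {a b : R} (h : size a ≤ size b) : cen a b = descend b a := if_pos h

theorem cen_comm (a b : R) : cen a b = cen b a := by
  unfold cen
  rcases lt_trichotomy (size a) (size b) with h | h | h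
  · rw [if_pos h.le, if_neg h.not_ge]
  · rw [if_pos h.le, if_pos h.ge, descend_of_size_eq h, descend_of_size_eq h.symm, mid_comm]
  · rw [if_neg h.not_ge, if_pos h.le]

theorem cen_of_ge {a b : R} (h : size b ≤ size a) : cen a b = descend a b := by
  rw [cen_comm, cen_of_le h]

theorem cen_jn (f : Bool) (a b c : R) : cen (jn f a b) c = cen a (op f b c) := by
  have ha := size_pos a
  have hb := size_pos b
  have hc := size_pos c
  by_cases h1 : size a + size b ≤ size c
  · rw [cen_of_le (by simpa), cen_of_le (by simp; omega), descend_op _ _ _ _ (by omega),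
      if_neg (by omega), if_pos h1]
  by_cases h2 : size b + size c ≤ size a
  · rw [cen_of_ge (by simp; omega), cen_of_ge (by simp; omega)]
    cases f
    · rw [jn, descend_att _ _ _ (by omega), if_pos (by omega), op_comm]
    · rw [jn, descend_op _ _ _ _ (by omega), if_pos (by omega), jn, op_comm]
  by_cases h3 : size a + size c ≤ size b
  · rw [cen_of_ge (by simp; omega), cen_of_le (by simp; omega), descend_op _ _ _ _ (by omega),
      if_pos h3]
    cases f
    · rw [jn, descend_att _ _ _ (by omega), if_neg (by omega), if_pos (by omega), jn]
    · rw [jn, descend_op _ _ _ _ (by omega), if_neg (by omega), if_pos (by omega), jn, jn, op_comm]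
  · rw [cen_of_ge (by simp; omega), cen_of_le (by simp; omega), descend_op _ _ _ _ (by omega),
      if_neg (by omega), if_neg (by omega)]
    cases f
    · rw [jn, descend_att _ _ _ (by omega), if_neg (by omega), if_neg (by omega)]
      simp [node, add_assoc]
    · rw [jn, descend_op _ _ _ _ (by omega), if_neg (by omega), if_neg (by omega)]
      simp [node, add_assoc, add_comm]

/-- Two pairs are related if the glueings are obtained from each other by moving the cut. -/
inductive Rel : R × R → R × R → Prop
  | refl (p : R × R) : Rel p p
  | symm {p q : R × R} : Rel p q → Rel q p
  | trans {p q r : R × R} : Rel p q → Rel q r → Rel p r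
  | swap (a b : R) : Rel (a, b) (b, a)
  | jn (f : Bool) (a b c : R) : Rel (jn f a b, c) (a, op f b c)

theorem Rel.cen_eq {p q : R × R} (h : Rel p q) : cen p.1 p.2 = cen q.1 q.2 := by
  induction h with
  | refl => rfl
  | symm _ ih => exact ih.symm
  | trans _ _ ih ih' => exact ih.trans ih'
  | swap a b => exact cen_comm a b
  | jn f a b c => exact cen_jn f a b c

end R

/-- The normal forms of graphs with `n` vertices. -/
inductive NF.Valid (n : ℕ) : NF → Prop
  | edge (a b : R) (hn : size a + size b = n) (hab : size a = size b)
      (h1 : ¬ (IsOp true a ∧ IsOp true b)) (h2 : ¬ (IsOp false a ∧ IsAtt b))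
      (h3 : ¬ (IsAtt a ∧ IsOp false b)) : Valid n (.edge s(a, b))
  | clique (M : Multiset R) (hM : ∀ x ∈ M, ¬ IsOp true x ∧ 2 * size x < n)
      (hn : (M.map size).sum = n) : Valid n (.clique M)
  | star (c : R) (M : Multiset R) (hc : ¬ IsAtt c) (hc' : 2 * size c < n)
      (hM : ∀ x ∈ M, ¬ IsOp false x ∧ 2 * size x < n)
      (hn : size c + (M.map size).sum = n) : Valid n (.star c M)

namespace R

theorem valid_node_true {a b : R} {n : ℕ} (hn : size a + size b = n)
    (ha : ∀ x ∈ fac true a, 2 * size x < n) (hb : ∀ x ∈ fac true b, 2 * size x < n) :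
    (node true a b).Valid n := by
  refine .clique _ (fun x hx => ?_) (by simp [sum_size_fac, hn])
  rcases Multiset.mem_add.1 hx with h | h
  · exact ⟨not_isOp_of_mem_fac h, ha x h⟩
  · exact ⟨not_isOp_of_mem_fac h, hb x h⟩

theorem valid_node_false {a b : R} {n : ℕ} (hn : size a + size b = n) (hh : 2 * size (hd a) < n)
    (ha : ∀ x ∈ tl a, 2 * size x < n) (hb : ∀ x ∈ fac false b, 2 * size x < n) :
    (node false a b).Valid n := by
  refine .star _ _ (not_isAtt_hd a) hh (fun x hx => ?_) ?_
  · rcases Multiset.mem_add.1 hx with h | h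
    · exact ⟨not_isOp_of_mem_tl h, ha x h⟩
    · exact ⟨not_isOp_of_mem_fac h, hb x h⟩
  · have := size_hd_add a
    simp [sum_size_fac]
    omega

theorem valid_mid {a b : R} (h : size a = size b) : (mid a b).Valid (size a + size b) := by
  unfold mid
  split_ifs with h1 h2 h3
  · exact valid_node_true rfl (fun x hx => by have := size_lt_of_mem_fac h1.1 hx; omega)
      fun x hx => by have := size_lt_of_mem_fac h1.2 hx; omega
  · exact valid_node_false (add_comm _ _) (by have := size_hd_lt h2.2; omega)
      (fun x hx => by have := size_le_of_mem_tl hx; have := size_pos (hd b); omega)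
      fun x hx => by have := size_lt_of_mem_fac h2.1 hx; omega
  · exact valid_node_false rfl (by have := size_hd_lt h3.1; omega)
      (fun x hx => by have := size_le_of_mem_tl hx; have := size_pos (hd a); omega)
      fun x hx => by have := size_lt_of_mem_fac h3.2 hx; omega
  · exact .edge a b rfl h h1 h2 h3

theorem size_hd_le (x : R) : size (hd x) ≤ size x := by
  have := size_hd_add x
  omega

theorem valid_descend (b a : R) (h : size a ≤ size b) :
    (descend b a).Valid (size a + size b) := by
  have key : ∀ x y : R, size y ≤ size x → ∀ f, ∀ z ∈ fac f y, size z ≤ size x :=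
    fun x y hxy f z hz => (size_le_of_mem_fac hz).trans hxy
  induction b using induction generalizing a with
  | hl =>
    have := size_pos a
    rw [size_leaf] at h
    have h' : size a = size leaf := by simp; omega
    rw [descend_of_size_eq h']
    exact valid_mid h'
  | ho f b c ihb ihc =>
    by_cases h0 : size a = size b + size c
    · rw [descend_of_size_eq (by simpa)]
      exact valid_mid (by simpa)
    rw [size_op] at h
    rw [descend_op _ _ _ _ h0]
    split_ifs with h1 h2
    · have := ihb (jn f a c) (by simpa)
      rwa [size_jn, add_assoc, add_comm (size c), ← size_op f] at this
    · have := ihc (jn f a b) (by simpa)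
      rwa [size_jn, add_assoc, ← size_op f] at this
    · cases f
      · refine valid_node_false rfl ?_ (fun x hx => ?_) fun x hx => ?_
        · have := size_hd_le a
          simp; omega
        · have := size_le_of_mem_tl hx
          simp; omega
        · rw [fac_op_self, Multiset.mem_add] at hx
          rw [size_op]
          rcases hx with hx | hx <;> have := size_le_of_mem_fac hx <;> omega
      · refine valid_node_true rfl (fun x hx => ?_) fun x hx => ?_
        · have := size_le_of_mem_fac hx
          simp; omega
        · rw [fac_op_self, Multiset.mem_add] at hx
          rw [size_op]
          rcases hx with hx | hx <;> have := size_le_of_mem_fac hx <;> omega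
  | ha b c ihb ihc =>
    by_cases h0 : size a = size b + size c
    · rw [descend_of_size_eq (by simpa)]
      exact valid_mid (by simpa)
    rw [size_att] at h
    rw [descend_att _ _ _ h0]
    split_ifs with h1 h2
    · have := ihb (op false a c) (by simpa)
      rwa [size_op, add_assoc, add_comm (size c), ← size_att] at this
    · have := ihc (att b a) (by simp; omega)
      rwa [size_att, add_comm (size b), add_assoc, ← size_att] at this
    · refine valid_node_false (add_comm _ _) ?_ (fun x hx => ?_) fun x hx => ?_
      · have := size_hd_le b
        simp; omega
      · rw [tl_att, Multiset.mem_add] at hx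
        rw [size_att]
        rcases hx with hx | hx
        · have := size_le_of_mem_tl hx
          omega
        · have := size_le_of_mem_fac hx
          omega
      · have := size_le_of_mem_fac hx
        simp; omega

theorem valid_cen (a b : R) : (cen a b).Valid (size a + size b) := by
  rcases le_total (size a) (size b) with h | h
  · rw [cen_of_le h]
    exact valid_descend b a h
  · rw [cen_of_ge h, add_comm]
    exact valid_descend a b h

/-- `N` describes a node or an edge of the glueing of a pair related to `p`. -/
def _root_.DHCount.NF.Spec : NF → R × R → Prop
  | .edge q, p => ∃ x y, s(x, y) = q ∧ Rel p (x, y)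
  | .clique M, p => ∃ x y, fac true x + fac true y = M ∧ Rel p (x, y)
  | .star c M, p => ∃ x y, hd x = c ∧ tl x + fac false y = M ∧ Rel p (x, y)

theorem Rel.spec {p q : R × R} (h : Rel p q) {N : NF} (hN : N.Spec q) : N.Spec p := by
  cases N with
  | edge => obtain ⟨x, y, h1, h2⟩ := hN; exact ⟨x, y, h1, h.trans h2⟩
  | clique => obtain ⟨x, y, h1, h2⟩ := hN; exact ⟨x, y, h1, h.trans h2⟩
  | star => obtain ⟨x, y, h1, h2, h3⟩ := hN; exact ⟨x, y, h1, h2, h.trans h3⟩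

theorem spec_node (f : Bool) (a b : R) : (node f a b).Spec (a, b) := by
  cases f
  · exact ⟨a, b, rfl, rfl, .refl _⟩
  · exact ⟨a, b, rfl, .refl _⟩

theorem spec_mid (a b : R) : (mid a b).Spec (a, b) := by
  unfold mid
  split_ifs
  · exact spec_node ..
  · exact (Rel.swap a b).spec (spec_node ..)
  · exact spec_node ..
  · exact ⟨a, b, rfl, .refl _⟩

theorem rel_op_att (a b c : R) : Rel (a, att b c) (op false a c, b) := by
  rw [op_comm]
  exact ((Rel.swap _ _).trans (.jn false b c a)).trans (.swap _ _)

theorem rel_att_att (a b c : R) : Rel (a, att b c) (att b a, c) := by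
  refine (rel_op_att a b c).trans ((Rel.swap _ _).trans (.symm (.jn false b a c)))

theorem spec_descend (b a : R) : (descend b a).Spec (a, b) := by
  induction b using induction generalizing a with
  | hl => exact spec_mid a leaf
  | ho f b c ihb ihc =>
    by_cases h0 : size a = size b + size c
    · rw [descend_of_size_eq (by simpa)]
      exact spec_mid ..
    rw [descend_op _ _ _ _ h0]
    split_ifs with h1 h2
    · rw [op_comm]
      exact (Rel.symm (.jn f a c b)).spec (ihb _)
    · exact (Rel.symm (.jn f a b c)).spec (ihc _)
    · exact spec_node ..
  | ha b c ihb ihc =>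
    by_cases h0 : size a = size b + size c
    · rw [descend_of_size_eq (by simpa)]
      exact spec_mid ..
    rw [descend_att _ _ _ h0]
    split_ifs with h1 h2
    · exact (rel_op_att a b c).spec (ihb _)
    · exact (rel_att_att a b c).spec (ihc _)
    · exact (Rel.swap _ _).spec (spec_node ..)

theorem spec_cen (a b : R) : (cen a b).Spec (a, b) := by
  unfold cen
  split_ifs
  · exact spec_descend ..
  · exact (Rel.swap _ _).spec (spec_descend ..)

theorem exists_rel_of_mem {x y z : R} (h : z ∈ fac true x + fac true y) :
    ∃ w, z ::ₘ fac true w = fac true x + fac true y ∧ Rel (x, y) (z, w) := by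
  have key : ∀ x y : R, z ∈ fac true x →
      ∃ w, z ::ₘ fac true w = fac true x + fac true y ∧ Rel (x, y) (z, w) := by
    intro x y h
    have hz := fac_of_not_isOp (not_isOp_of_mem_fac h)
    rcases eq_or_exists_of_mem_fac h with rfl | ⟨v, rfl⟩
    · exact ⟨y, by simp [hz], .refl _⟩
    · exact ⟨op true v y, by simp [hz], .jn true z v y⟩
  rcases Multiset.mem_add.1 h with h | h
  · exact key x y h
  · obtain ⟨w, h1, h2⟩ := key y x h
    exact ⟨w, by rw [h1, add_comm], (Rel.swap _ _).trans h2⟩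

theorem exists_rel_hd (x y : R) :
    ∃ w, fac false w = tl x + fac false y ∧ Rel (x, y) (hd x, w) := by
  by_cases h : IsAtt x
  · obtain ⟨w, h1, h2⟩ := h.exists_att_hd
    refine ⟨op false w y, by simp [h2], ?_⟩
    have := Rel.jn false (hd x) w y
    rwa [jn, ← h1] at this
  · exact ⟨y, by simp [tl_of_not_isAtt h], by rw [hd_of_not_isAtt h]; exact .refl _⟩

theorem rel_of_spec {N : NF} {p q : R × R} (hp : N.Spec p) (hq : N.Spec q) : Rel p q := by
  cases N with
  | edge e =>
    obtain ⟨x, y, h1, h2⟩ := hp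
    obtain ⟨x', y', h1', h2'⟩ := hq
    rw [← h1', Sym2.eq_iff] at h1
    rcases h1 with ⟨rfl, rfl⟩ | ⟨rfl, rfl⟩
    · exact h2.trans h2'.symm
    · exact (h2.trans (.swap _ _)).trans h2'.symm
  | clique M =>
    obtain ⟨x, y, h1, h2⟩ := hp
    obtain ⟨x', y', h1', h2'⟩ := hq
    obtain ⟨z, hz⟩ := Multiset.exists_mem_of_ne_zero (fac_ne_zero true x)
    have hz : z ∈ M := h1 ▸ Multiset.mem_add.2 (.inl hz)
    obtain ⟨w, h3, h4⟩ := exists_rel_of_mem (h1 ▸ hz)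
    obtain ⟨w', h3', h4'⟩ := exists_rel_of_mem (h1' ▸ hz)
    rw [h1, ← h1', ← h3', Multiset.cons_inj_right] at h3
    rw [fac_injective _ h3] at h4
    exact (h2.trans h4).trans (h2'.trans h4').symm
  | star c M =>
    obtain ⟨x, y, h1, h1b, h2⟩ := hp
    obtain ⟨x', y', h1', h1b', h2'⟩ := hq
    obtain ⟨w, h3, h4⟩ := exists_rel_hd x y
    obtain ⟨w', h3', h4'⟩ := exists_rel_hd x' y'
    rw [h1b, ← h1b', ← h3'] at h3
    rw [fac_injective _ h3, h1, ← h1'] at h4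
    exact (h2.trans h4).trans (h2'.trans h4').symm

theorem rel_of_cen_eq {a b a' b' : R} (h : cen a b = cen a' b') : Rel (a, b) (a', b') :=
  rel_of_spec (spec_cen a b) (h ▸ spec_cen a' b')

theorem node_jn (f : Bool) (a b c : R) : node f (jn f a b) c = node f a (op f b c) := by
  cases f <;> simp [node, jn, add_assoc]

theorem descend_eq_node (f : Bool) (b a : R) (h : size a ≤ size b)
    (ha : size a = size b → ∃ u v, a = jn f u v)
    (hb : ∀ x ∈ fac f b, 2 * size x < size a + size b) : descend b a = node f a b := by
  induction b using induction generalizing a with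
  | hl =>
    have := hb leaf (by simp [fac_leaf])
    simp at this h
    omega
  | ho g b c ihb ihc =>
    by_cases hg : g = f
    · subst hg
      by_cases h0 : size a = size b + size c
      · obtain ⟨u, v, rfl⟩ := ha (by simpa)
        rw [descend_of_size_eq (by simpa using h0), mid_jn_op]
      simp only [fac_op_self, Multiset.mem_add, size_op] at hb h
      rw [descend_op _ _ _ _ h0]
      split_ifs with h1 h2
      · rw [ihb _ (by simpa) (fun _ => ⟨_, _, rfl⟩), node_jn, op_comm]
        intro x hx
        have := hb x (.inl hx)
        simp; omega
      · rw [ihc _ (by simpa) (fun _ => ⟨_, _, rfl⟩), node_jn]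
        intro x hx
        have := hb x (.inr hx)
        simp; omega
      · rfl
    · have := hb (op g b c) (by simp [fac_op, hg])
      omega
  | ha b c ihb ihc =>
    have := hb (att b c) (by simp [fac_att])
    omega

theorem exists_cen_eq {n : ℕ} (hn : 2 ≤ n) {N : NF} (hN : N.Valid n) :
    ∃ a b, size a + size b = n ∧ cen a b = N := by
  cases hN with
  | edge a b hn hab h1 h2 h3 =>
    refine ⟨a, b, hn, ?_⟩
    rw [cen_of_le hab.le, descend_of_size_eq hab, mid, if_neg h1, if_neg h2, if_neg h3]
  | clique M hM hs =>
    have h0 : M ≠ 0 := by rintro rfl; simp at hs; omega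
    obtain ⟨z, h0⟩ := Multiset.exists_mem_of_ne_zero h0
    obtain ⟨M, rfl⟩ := Multiset.exists_cons_of_mem h0
    simp only [Multiset.map_cons, Multiset.sum_cons] at hs
    have hz := hM z (Multiset.mem_cons_self ..)
    have h1 : M ≠ 0 := by rintro rfl; simp at hs; omega
    obtain ⟨w, rfl⟩ := exists_fac_eq h1 fun y hy => (hM y (Multiset.mem_cons_of_mem hy)).1
    rw [sum_size_fac] at hs
    refine ⟨z, w, hs, ?_⟩
    rw [cen_of_le (by omega), descend_eq_node true _ _ (by omega) (fun _ => by omega)]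
    · simp [node, fac_of_not_isOp hz.1]
    · rw [hs]
      exact fun x hx => (hM x (Multiset.mem_cons_of_mem hx)).2
  | star c M hc hc' hM hs =>
    have h1 : M ≠ 0 := by rintro rfl; simp at hs; omega
    obtain ⟨w, rfl⟩ := exists_fac_eq h1 fun y hy => (hM y hy).1
    rw [sum_size_fac] at hs
    refine ⟨c, w, hs, ?_⟩
    rw [cen_of_le (by omega), descend_eq_node false _ _ (by omega) (fun _ => by omega)]
    · simp [node, hd_of_not_isAtt hc, tl_of_not_isAtt hc]
    · rw [hs]
      exact fun x hx => (hM x hx).2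

end R

variable {V W : Type} {G : SimpleGraph V} {H : SimpleGraph W}

/-- The edges between `S₁` and `S₂` are all the pairs in `A₁ × A₂` if `f = true`, and there are
none if `f = false`. -/
def Cross (G : SimpleGraph V) (f : Bool) (S₁ A₁ S₂ A₂ : Set V) : Prop :=
  ∀ u ∈ S₁, ∀ v ∈ S₂, G.Adj u v ↔ f = true ∧ u ∈ A₁ ∧ v ∈ A₂

theorem Cross.symm {f : Bool} {S₁ A₁ S₂ A₂ : Set V} (h : Cross G f S₁ A₁ S₂ A₂) :
    Cross G f S₂ A₂ S₁ A₁ := fun u hu v hv => by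
  rw [G.adj_comm, h v hv u hu, and_comm (a := v ∈ A₁)]

/-- The subgraph of `G` induced on `S`, with marked vertices `A`, is described by a term. -/
def RealT (G : SimpleGraph V) : Tm → Set V → Set V → Prop
  | .leaf, S, A => ∃ v, S = {v} ∧ A = {v}
  | .op f a b, S, A => ∃ S₁ A₁ S₂ A₂, S = S₁ ∪ S₂ ∧ A = A₁ ∪ A₂ ∧ Disjoint S₁ S₂ ∧
      Cross G f S₁ A₁ S₂ A₂ ∧ RealT G a S₁ A₁ ∧ RealT G b S₂ A₂
  | .att a b, S, A => ∃ S₁ S₂ B, S = S₁ ∪ S₂ ∧ Disjoint S₁ S₂ ∧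
      Cross G true S₁ A S₂ B ∧ RealT G a S₁ A ∧ RealT G b S₂ B

theorem RealT.subset {t : Tm} {S A : Set V} (h : RealT G t S A) : A ⊆ S := by
  induction t generalizing S A with
  | leaf => obtain ⟨v, rfl, rfl⟩ := h; rfl
  | op f a b iha ihb =>
    obtain ⟨S₁, A₁, S₂, A₂, rfl, rfl, -, -, h1, h2⟩ := h
    exact Set.union_subset_union (iha h1) (ihb h2)
  | att a b iha ihb =>
    obtain ⟨S₁, S₂, B, rfl, -, -, h1, h2⟩ := h
    exact (iha h1).trans Set.subset_union_left

theorem RealT.comm {f : Bool} {a b : Tm} {S A : Set V} (h : RealT G (.op f a b) S A) :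
    RealT G (.op f b a) S A := by
  obtain ⟨S₁, A₁, S₂, A₂, rfl, rfl, h3, h4, h1, h2⟩ := h
  exact ⟨S₂, A₂, S₁, A₁, Set.union_comm .., Set.union_comm .., h3.symm, h4.symm, h2, h1⟩

theorem RealT.assoc {f : Bool} {a b c : Tm} {S A : Set V}
    (h : RealT G (.op f (.op f a b) c) S A) : RealT G (.op f a (.op f b c)) S A := by
  obtain ⟨S₁, A₁, S₂, A₂, rfl, rfl, h3, h4, ⟨T₁, B₁, T₂, B₂, rfl, rfl, k3, k4, k1, k2⟩, h2⟩ := h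
  have e1 := k1.subset
  have e2 := k2.subset
  have e3 := h2.subset
  rw [Set.disjoint_union_left] at h3
  refine ⟨T₁, B₁, T₂ ∪ S₂, B₂ ∪ A₂, Set.union_assoc .., Set.union_assoc .., ?_, ?_, k1,
    T₂, B₂, S₂, A₂, rfl, rfl, h3.2, ?_, k2, h2⟩
  · rw [Set.disjoint_union_right]; exact ⟨k3, h3.1⟩
  · rintro u hu v (hv | hv)
    · have := Set.disjoint_left.1 h3.2 hv
      have e := k4 u hu v hv
      grind
    · have := Set.disjoint_right.1 h3.2 hv
      have := Set.disjoint_left.1 k3 hu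
      have e := h4 u (.inl hu) v hv
      grind
  · intro u hu v hv
    have := Set.disjoint_right.1 k3 hu
    have e := h4 u (.inr hu) v hv
    grind

theorem realT_congr {s t : Tm} (h : Tm.Eqv s t) (S A : Set V) : RealT G s S A ↔ RealT G t S A := by
  induction h generalizing S A with
  | refl => rfl
  | symm _ ih => exact (ih S A).symm
  | trans _ _ ih ih' => exact (ih S A).trans (ih' S A)
  | op_congr f _ _ ih ih' => simp only [RealT, ih, ih']
  | att_congr _ _ ih ih' => simp only [RealT, ih, ih']
  | comm f a b => exact ⟨RealT.comm, RealT.comm⟩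
  | assoc f a b c =>
    exact ⟨RealT.assoc, fun h => (h.comm.assoc.comm.assoc).comm⟩
  | att_att a b c =>
    constructor
    · rintro ⟨S₁, S₂, B, rfl, h1, h2, ⟨T₁, T₂, C, rfl, k1, k2, k3, k4⟩, h4⟩
      have e1 := k3.subset
      have e2 := k4.subset
      have e3 := h4.subset
      rw [Set.disjoint_union_left] at h1
      refine ⟨T₁, T₂ ∪ S₂, C ∪ B, Set.union_assoc .., ?_, ?_, k3, T₂, C, S₂, B, rfl, rfl, h1.2,
        ?_, k4, h4⟩
      · rw [Set.disjoint_union_right]; exact ⟨k1, h1.1⟩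
      · rintro u hu v (hv | hv)
        · have := Set.disjoint_left.1 h1.2 hv
          have e := k2 u hu v hv
          grind
        · have := Set.disjoint_right.1 h1.2 hv
          have e := h2 u (.inl hu) v hv
          grind
      · intro u hu v hv
        have := Set.disjoint_right.1 k1 hu
        have e := h2 u (.inr hu) v hv
        grind
    · rintro ⟨T₁, S₂, B, rfl, h1, h2, k3, T₂, C, S₃, D, rfl, rfl, k1, k2, k4, h4⟩
      have e1 := k3.subset
      have e2 := k4.subset
      have e3 := h4.subset
      rw [Set.disjoint_union_right] at h1
      refine ⟨T₁ ∪ T₂, S₃, D, (Set.union_assoc ..).symm, ?_, ?_, ⟨T₁, T₂, C, rfl, h1.1, ?_, k3,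
        k4⟩, h4⟩
      · rw [Set.disjoint_union_left]; exact ⟨h1.2, k1⟩
      · rintro u (hu | hu) v hv
        · have := Set.disjoint_right.1 k1 hv
          have e := h2 u hu v (.inr hv)
          grind
        · have := Set.disjoint_right.1 h1.1 hu
          have e := k2 u hu v hv
          grind
      · intro u hu v hv
        have := Set.disjoint_left.1 k1 hv
        have e := h2 u hu v (.inl hv)
        grind

/-- The subgraph of `G` induced on `S`, with marked vertices `A`, is described by an element of
`R`. -/
def Real (G : SimpleGraph V) (x : R) (S A : Set V) : Prop :=
  Quotient.lift (fun t => RealT G t S A) (fun _ _ h => propext (realT_congr h S A)) x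

theorem real_op {f : Bool} {a b : R} {S A : Set V} : Real G (op f a b) S A ↔
    ∃ S₁ A₁ S₂ A₂, S = S₁ ∪ S₂ ∧ A = A₁ ∪ A₂ ∧ Disjoint S₁ S₂ ∧
      Cross G f S₁ A₁ S₂ A₂ ∧ Real G a S₁ A₁ ∧ Real G b S₂ A₂ := by
  induction a, b using Quotient.inductionOn₂ with
  | h a b => exact Iff.rfl

theorem real_att {a b : R} {S A : Set V} : Real G (att a b) S A ↔
    ∃ S₁ S₂ B, S = S₁ ∪ S₂ ∧ Disjoint S₁ S₂ ∧
      Cross G true S₁ A S₂ B ∧ Real G a S₁ A ∧ Real G b S₂ B := by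
  induction a, b using Quotient.inductionOn₂ with
  | h a b => exact Iff.rfl

/-- `op f`, extended by a neutral element. -/
def opo (f : Bool) : Option R → Option R → Option R
  | none, y => y
  | some x, none => some x
  | some x, some y => some (op f x y)

theorem opo_comm (f : Bool) (o p : Option R) : opo f o p = opo f p o := by
  rcases o with _ | o <;> rcases p with _ | p <;> simp only [opo]
  rw [op_comm]

theorem opo_assoc (f : Bool) (o p q : Option R) :
    opo f (opo f o p) q = opo f o (opo f p q) := by
  rcases o with _ | o <;> rcases p with _ | p <;> rcases q with _ | q <;> simp [opo, op_assoc]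

theorem opo_opo (f : Bool) (o p q r : Option R) :
    opo f (opo f o p) (opo f q r) = opo f (opo f o q) (opo f p r) := by
  rw [opo_assoc, opo_assoc, ← opo_assoc f p, ← opo_assoc f q, opo_comm f p]

/-- `Real`, extended to the empty graph. -/
def RealO (G : SimpleGraph V) : Option R → Set V → Set V → Prop
  | none, S, A => S = ∅ ∧ A = ∅
  | some x, S, A => Real G x S A

theorem RealO.append {f : Bool} {o p : Option R} {S₁ A₁ S₂ A₂ : Set V}
    (h1 : RealO G o S₁ A₁) (h2 : RealO G p S₂ A₂) (hd : Disjoint S₁ S₂)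
    (hx : Cross G f S₁ A₁ S₂ A₂) : RealO G (opo f o p) (S₁ ∪ S₂) (A₁ ∪ A₂) := by
  rcases o with _ | o
  · obtain ⟨rfl, rfl⟩ := h1
    simpa [opo] using h2
  rcases p with _ | p
  · obtain ⟨rfl, rfl⟩ := h2
    simpa [opo] using h1
  exact real_op.2 ⟨_, _, _, _, rfl, rfl, hd, hx, h1, h2⟩

namespace Real

theorem subset {x : R} {S A : Set V} (h : Real G x S A) : A ⊆ S := by
  induction x using Quotient.inductionOn with
  | h t => exact RealT.subset h

theorem nonempty {x : R} {S A : Set V} (h : Real G x S A) : A.Nonempty := by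
  induction x using induction generalizing S A with
  | hl => obtain ⟨v, rfl, rfl⟩ := h; simp
  | ho f a b iha ihb =>
    obtain ⟨S₁, A₁, S₂, A₂, rfl, rfl, -, -, h1, h2⟩ := real_op.1 h
    exact (iha h1).inl
  | ha a b iha ihb =>
    obtain ⟨S₁, S₂, B, rfl, -, -, h1, h2⟩ := real_att.1 h
    exact iha h1

theorem finite {x : R} {S A : Set V} (h : Real G x S A) : S.Finite := by
  induction x using induction generalizing S A with
  | hl => obtain ⟨v, rfl, rfl⟩ := h; simp
  | ho f a b iha ihb =>
    obtain ⟨S₁, A₁, S₂, A₂, rfl, rfl, -, -, h1, h2⟩ := real_op.1 h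
    exact (iha h1).union (ihb h2)
  | ha a b iha ihb =>
    obtain ⟨S₁, S₂, B, rfl, -, -, h1, h2⟩ := real_att.1 h
    exact (iha h1).union (ihb h2)

theorem ncard {x : R} {S A : Set V} (h : Real G x S A) : S.ncard = size x := by
  induction x using induction generalizing S A with
  | hl => obtain ⟨v, rfl, rfl⟩ := h; simp
  | ho f a b iha ihb =>
    obtain ⟨S₁, A₁, S₂, A₂, rfl, rfl, hd, -, h1, h2⟩ := real_op.1 h
    rw [Set.ncard_union_eq hd h1.finite h2.finite, iha h1, ihb h2, size_op]
  | ha a b iha ihb =>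
    obtain ⟨S₁, S₂, B, rfl, hd, -, h1, h2⟩ := real_att.1 h
    rw [Set.ncard_union_eq hd h1.finite h2.finite, iha h1, ihb h2, size_att]

/-- Every connected component of a described graph has a marked vertex. -/
theorem exists_mem {x : R} {S A : Set V} (h : Real G x S A) {C : Set V} (hC : C ⊆ S)
    (h0 : C.Nonempty) (hcl : ∀ u ∈ C, ∀ v ∈ S, G.Adj u v → v ∈ C) : ∃ v ∈ C, v ∈ A := by
  have restr : ∀ {T : Set V}, T ⊆ S →
      ∀ u ∈ C ∩ T, ∀ v ∈ T, G.Adj u v → v ∈ C ∩ T := by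
    intro T hT u hu v hv e
    exact ⟨hcl u hu.1 v (hT hv) e, hv⟩
  induction x using induction generalizing S A C with
  | hl =>
    obtain ⟨v, rfl, rfl⟩ := h
    obtain ⟨u, hu⟩ := h0
    exact ⟨u, hu, hC hu⟩
  | ho f a b iha ihb =>
    obtain ⟨S₁, A₁, S₂, A₂, rfl, rfl, hd, hx, h1, h2⟩ := real_op.1 h
    obtain ⟨u, hu⟩ := h0
    rcases hC hu with hu' | hu'
    · obtain ⟨v, hv, hv'⟩ := iha h1 (C := C ∩ S₁) Set.inter_subset_right ⟨u, hu, hu'⟩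
        (restr Set.subset_union_left) (fun {T} hT w hw z hz e =>
          ⟨restr Set.subset_union_left w hw.1 z (hT hz) e, hz⟩)
      exact ⟨v, hv.1, .inl hv'⟩
    · obtain ⟨v, hv, hv'⟩ := ihb h2 (C := C ∩ S₂) Set.inter_subset_right ⟨u, hu, hu'⟩
        (restr Set.subset_union_right) (fun {T} hT w hw z hz e =>
          ⟨restr Set.subset_union_right w hw.1 z (hT hz) e, hz⟩)
      exact ⟨v, hv.1, .inr hv'⟩
  | ha a b iha ihb =>
    obtain ⟨S₁, S₂, B, rfl, hd, hx, h1, h2⟩ := real_att.1 h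
    have key : (C ∩ S₁).Nonempty := by
      obtain ⟨u, hu⟩ := h0
      rcases hC hu with hu' | hu'
      · exact ⟨u, hu, hu'⟩
      · obtain ⟨v, hv, hv'⟩ := ihb h2 (C := C ∩ S₂) Set.inter_subset_right ⟨u, hu, hu'⟩
          (restr Set.subset_union_right) (fun {T} hT w hw z hz e =>
            ⟨restr Set.subset_union_right w hw.1 z (hT hz) e, hz⟩)
        obtain ⟨w, hw⟩ := h1.nonempty
        have hwS := h1.subset hw
        exact ⟨w, hcl v hv.1 w (.inl hwS) ((hx w hwS v hv.2).2 ⟨rfl, hw, hv'⟩).symm, hwS⟩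
    obtain ⟨v, hv, hv'⟩ := iha h1 (C := C ∩ S₁) Set.inter_subset_right key
      (restr Set.subset_union_left) (fun {T} hT w hw z hz e =>
          ⟨restr Set.subset_union_left w hw.1 z (hT hz) e, hz⟩)
    exact ⟨v, hv.1, hv'⟩

/-- If all the marked vertices are on one side of a splitting, then so is everything. -/
theorem eq_empty_of_cross {x : R} {S' S'' A : Set V} (h : Real G x (S' ∪ S'') A) {f : Bool}
    (hx : Cross G f S' (A ∩ S') S'' (A ∩ S'')) (hA : ∀ v ∈ S'', v ∉ A) : S'' = ∅ := by
  by_contra h0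
  obtain ⟨v, hv, hv'⟩ := h.exists_mem Set.subset_union_right (Set.nonempty_iff_ne_empty.2 h0) (by
    rintro u hu v (hv | hv) e
    · exact (hA u hu ((hx v hv u hu).1 e.symm).2.2.1).elim
    · exact hv)
  exact hA v hv hv'

theorem exists_opo_of_side {x : R} {S' S'' A : Set V} (h : Real G x (S' ∪ S'') A) {f : Bool}
    (hx : Cross G f S' (A ∩ S') S'' (A ∩ S''))
    (hA : (∀ v ∈ S', v ∉ A) ∨ (∀ v ∈ S'', v ∉ A)) :
    ∃ o p, some x = opo f o p ∧ RealO G o S' (A ∩ S') ∧ RealO G p S'' (A ∩ S'') := by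
  rcases hA with hA | hA
  · rw [Set.union_comm] at h
    have := h.eq_empty_of_cross hx.symm hA
    subst this
    refine ⟨none, some x, rfl, by simp [RealO], ?_⟩
    have := Set.inter_eq_self_of_subset_left h.subset
    simp only [Set.union_empty] at this h
    rwa [this]
  · have := h.eq_empty_of_cross hx hA
    subst this
    refine ⟨some x, none, rfl, ?_, by simp [RealO]⟩
    have := Set.inter_eq_self_of_subset_left h.subset
    simp only [Set.union_empty] at this h
    rwa [this]

theorem exists_opo {x : R} {S S' S'' A : Set V} (h : Real G x S A) (hS : ∀ u, u ∈ S ↔ u ∈ S' ∨ u ∈ S'')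
    {f : Bool} (hd' : ∀ u ∈ S', u ∉ S'') (hx : Cross G f S' (A ∩ S') S'' (A ∩ S'')) :
    ∃ o p, some x = opo f o p ∧ RealO G o S' (A ∩ S') ∧ RealO G p S'' (A ∩ S'') := by
  have side : (∀ v ∈ S', v ∉ A) ∨ (∀ v ∈ S'', v ∉ A) →
      ∃ o p, some x = opo f o p ∧ RealO G o S' (A ∩ S') ∧ RealO G p S'' (A ∩ S'') := by
    obtain rfl : S = S' ∪ S'' := Set.ext hS
    exact h.exists_opo_of_side hx
  induction x using induction generalizing S S' S'' A with
  | hl =>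
    obtain ⟨v, rfl, rfl⟩ := h
    apply side
    grind
  | ho g a b iha ihb =>
    obtain ⟨S₁, A₁, S₂, A₂, rfl, rfl, hd, hc, h1, h2⟩ := real_op.1 h
    have s1 := h1.subset
    have s2 := h2.subset
    have hdd := fun u (h : u ∈ S₁) => Set.disjoint_left.1 hd h
    by_cases hg : g = f
    · subst hg
      have c1 : Cross G g (S' ∩ S₁) (A₁ ∩ (S' ∩ S₁)) (S'' ∩ S₁) (A₁ ∩ (S'' ∩ S₁)) := by
        clear iha ihb side h h1 h2
        intro u hu v hv
        have := hx u hu.1 v hv.1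
        grind
      have c2 : Cross G g (S' ∩ S₂) (A₂ ∩ (S' ∩ S₂)) (S'' ∩ S₂) (A₂ ∩ (S'' ∩ S₂)) := by
        clear iha ihb side h h1 h2
        intro u hu v hv
        have := hx u hu.1 v hv.1
        grind
      have e1 : ∀ u, u ∈ S₁ ↔ u ∈ S' ∩ S₁ ∨ u ∈ S'' ∩ S₁ := by clear iha ihb side h h1 h2; grind
      have e2 : ∀ u, u ∈ S₂ ↔ u ∈ S' ∩ S₂ ∨ u ∈ S'' ∩ S₂ := by clear iha ihb side h h1 h2; grind
      obtain ⟨o1, p1, q1, q2, q3⟩ := iha h1 e1 (fun u hu hu' => hd' u hu.1 hu'.1) c1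
        (by obtain e : S₁ = _ := Set.ext e1
            rw [e] at h1
            exact h1.exists_opo_of_side c1)
      obtain ⟨o2, p2, q1', q2', q3'⟩ := ihb h2 e2 (fun u hu hu' => hd' u hu.1 hu'.1) c2
        (by obtain e : S₂ = _ := Set.ext e2
            rw [e] at h2
            exact h2.exists_opo_of_side c2)
      clear iha ihb side h h1 h2
      refine ⟨opo g o1 o2, opo g p1 p2, ?_, ?_, ?_⟩
      · rw [opo_opo, ← q1, ← q1']; rfl
      · have := q2.append (f := g) q2' (hd.mono Set.inter_subset_right Set.inter_subset_right) (by
          intro u hu v hv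
          have := hc u hu.2 v hv.2
          clear q2 q2' q3 q3'
          grind)
        convert this using 1 <;> clear q2 q2' q3 q3' this <;> grind
      · have := q3.append (f := g) q3' (hd.mono Set.inter_subset_right Set.inter_subset_right) (by
          intro u hu v hv
          have := hc u hu.2 v hv.2
          clear q2 q2' q3 q3'
          grind)
        convert this using 1 <;> clear q2 q2' q3 q3' this <;> grind
    · apply side
      obtain ⟨u, hu⟩ := h1.nonempty
      obtain ⟨v, hv⟩ := h2.nonempty
      clear iha ihb side h h1 h2
      have key : ∀ u ∈ A₁, ∀ v ∈ A₂, (u ∈ S' ↔ v ∈ S') := by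
        intro u hu v hv
        have k1 := hc u (s1 hu) v (s2 hv)
        have k2 := hx u
        have k3 := hx v
        have := G.adj_comm u v
        grind
      grind
  | ha a b iha ihb =>
    obtain ⟨S₁, S₂, B, rfl, hd, hc, h1, h2⟩ := real_att.1 h
    have s1 := h1.subset
    have s2 := h2.subset
    have hdd := fun u (h : u ∈ S₁) => Set.disjoint_left.1 hd h
    apply side
    obtain ⟨u, hu⟩ := h1.nonempty
    obtain ⟨v, hv⟩ := h2.nonempty
    clear iha ihb side h h1 h2
    have key : ∀ u ∈ A, ∀ v ∈ B, (u ∈ S' ↔ v ∈ S') := by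
      intro u hu v hv
      have k1 := hc u (s1 hu) v (s2 hv)
      have k2 := hx u
      have k3 := hx v
      have := G.adj_comm u v
      grind
    grind

theorem exists_op {x : R} {S' S'' A : Set V} (h : Real G x (S' ∪ S'') A) {f : Bool}
    (hd' : Disjoint S' S'') (h' : S'.Nonempty) (h'' : S''.Nonempty)
    (hx : Cross G f S' (A ∩ S') S'' (A ∩ S'')) :
    ∃ a b, x = op f a b ∧ Real G a S' (A ∩ S') ∧ Real G b S'' (A ∩ S'') := by
  obtain ⟨o, p, h1, h2, h3⟩ := h.exists_opo (fun _ => Iff.rfl) (fun _ hu => Set.disjoint_left.1 hd' hu) hx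
  rcases o with _ | o
  · simp [h2.1] at h'
  rcases p with _ | p
  · simp [h3.1] at h''
  exact ⟨o, p, Option.some.inj h1, h2, h3⟩

theorem not_forall_adj {x : R} {S A : Set V} (h : Real G x S A) (hx : ¬ IsAtt x) {v : V}
    (hv : v ∈ S) (hv' : v ∉ A) : ∃ u ∈ A, ¬ G.Adj v u := by
  induction x using induction with
  | hl =>
    obtain ⟨w, rfl, rfl⟩ := h
    exact (hv' hv).elim
  | ho f a b _ _ =>
    obtain ⟨S₁, A₁, S₂, A₂, rfl, rfl, hd, hc, h1, h2⟩ := real_op.1 h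
    rcases hv with hv | hv
    · obtain ⟨u, hu⟩ := h2.nonempty
      exact ⟨u, .inr hu, fun e => hv' (.inl ((hc v hv u (h2.subset hu)).1 e).2.1)⟩
    · obtain ⟨u, hu⟩ := h1.nonempty
      exact ⟨u, .inl hu, fun e => hv' (.inr ((hc u (h1.subset hu) v hv).1 e.symm).2.2)⟩
  | ha a b _ _ => exact (hx (by simp [IsAtt])).elim

theorem disjoint_of_att {a b b' : R} {S₁ S₂ S₁' S₂' A B : Set V}
    (hS : ∀ u, u ∈ S₂ → u ∈ S₁' ∨ u ∈ S₂') (hd : Disjoint S₁ S₂) (hx' : Cross G true S₁' A S₂' B)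
    (h1 : Real G a S₁ A) (h2 : Real G b S₂ B) (h2' : Real G b' S₂' B)
    (hd' : Disjoint S₁' S₂') : S₂ ∩ S₁' = ∅ := by
  by_contra h0
  obtain ⟨v, hv, hv'⟩ := h2.exists_mem (C := S₂ ∩ S₁') Set.inter_subset_left
    (Set.nonempty_iff_ne_empty.2 h0) (by
      intro u hu v hv e
      refine ⟨hv, (hS v hv).resolve_right fun hv' => ?_⟩
      exact Set.disjoint_left.1 hd (h1.subset ((hx' u hu.2 v hv').1 e).2.1) hu.1)
  exact Set.disjoint_left.1 hd' hv.2 (h2'.subset hv')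

theorem att_frontier {a b : R} {S₁ S₂ A B : Set V} (ha : ¬ IsAtt a) (hd : Disjoint S₁ S₂)
    (hx : Cross G true S₁ A S₂ B) (h1 : Real G a S₁ A) (h2 : Real G b S₂ B) :
    B = {v | v ∈ S₁ ∪ S₂ ∧ v ∉ A ∧ ∀ u ∈ A, G.Adj v u} := by
  ext v
  constructor
  · intro hv
    have hv' := h2.subset hv
    exact ⟨.inr hv', fun hA => Set.disjoint_left.1 hd (h1.subset hA) hv',
      fun u hu => ((hx u (h1.subset hu) v hv').2 ⟨rfl, hu, hv⟩).symm⟩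
  · rintro ⟨hv | hv, hA, hv'⟩
    · obtain ⟨u, hu, hu'⟩ := h1.not_forall_adj ha hv hA
      exact (hu' (hv' u hu)).elim
    · obtain ⟨u, hu⟩ := h1.nonempty
      exact ((hx u (h1.subset hu) v hv).1 (hv' u hu).symm).2.2

/-- A marked graph is described by at most one element of `R`. -/
theorem unique {x y : R} {S A : Set V} (hx : Real G x S A) (hy : Real G y S A) : x = y := by
  have hsz : size x = size y := hx.ncard.symm.trans hy.ncard
  induction hn : size x using Nat.strong_induction_on generalizing x y S A with
  | _ n ih =>
  wlog hxa : IsAtt x ∨ ¬ IsAtt y generalizing x y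
  · exact (this hy hx hsz.symm (hsz ▸ hn) (by tauto)).symm
  by_cases hx' : IsAtt x
  · obtain ⟨w, hw, -⟩ := hx'.exists_att_hd
    rw [hw] at hx
    obtain ⟨S₁, S₂, B, rfl, hd, hc, h1, h2⟩ := real_att.1 hx
    have hB := att_frontier (not_isAtt_hd x) hd hc h1 h2
    have hy' : IsAtt y := by
      by_contra hy'
      obtain ⟨v, hv⟩ := h2.nonempty
      rw [hB] at hv
      obtain ⟨u, hu, hu'⟩ := hy.not_forall_adj hy' hv.1 hv.2.1
      exact hu' (hv.2.2 u hu)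
    obtain ⟨w', hw', -⟩ := hy'.exists_att_hd
    rw [hw'] at hy
    obtain ⟨S₁', S₂', B', e, hd', hc', h1', h2'⟩ := real_att.1 hy
    have hB' := att_frontier (not_isAtt_hd y) hd' hc' h1' h2'
    rw [← e, ← hB] at hB'
    subst hB'
    have k1 := disjoint_of_att (fun u hu => by have := e ▸ Set.mem_union_right S₁ hu; exact this)
      hd hc' h1 h2 h2' hd'
    have k2 := disjoint_of_att (fun u hu => by have := e ▸ Set.mem_union_right S₁' hu; exact this)
      hd' hc h1' h2' h2 hd
    rw [← Set.disjoint_iff_inter_eq_empty] at k1 k2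
    have hd := fun u (h : u ∈ S₁) => Set.disjoint_left.1 hd h
    have hd' := fun u (h : u ∈ S₁') => Set.disjoint_left.1 hd' h
    have k1 := fun u (h : u ∈ S₂) => Set.disjoint_left.1 k1 h
    have k2 := fun u (h : u ∈ S₂') => Set.disjoint_left.1 k2 h
    have e : ∀ u, u ∈ S₁ ∨ u ∈ S₂ ↔ u ∈ S₁' ∨ u ∈ S₂' := fun u => Set.ext_iff.1 e u
    obtain rfl : S₁ = S₁' := by ext u; specialize e u; grind
    obtain rfl : S₂ = S₂' := by ext u; specialize e u; grind
    have s1 : size x = _ := congrArg size hw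
    rw [size_att] at s1
    have := size_pos w
    have := size_pos (R.hd x)
    rw [hw, hw', ih _ (by omega) h1 h1' (h1.ncard.symm.trans h1'.ncard) rfl,
      ih _ (by omega) h2 h2' (h2.ncard.symm.trans h2'.ncard) rfl]
  · have hy' : ¬ IsAtt y := by tauto
    induction x using induction with
    | hl =>
      induction y using induction with
      | hl => rfl
      | ho f a b _ _ =>
        have := size_pos a
        have := size_pos b
        simp at hsz
        omega
      | ha a b _ _ => exact (hy' (by simp [IsAtt])).elim
    | ho f a b _ _ =>
      obtain ⟨S₁, A₁, S₂, A₂, rfl, rfl, hd, hc, h1, h2⟩ := real_op.1 hx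
      have hdd := fun u (h : u ∈ S₁) => Set.disjoint_left.1 hd h
      have s1 := h1.subset
      have s2 := h2.subset
      have e1 : (A₁ ∪ A₂) ∩ S₁ = A₁ := by clear ih hy hx h1 h2; grind
      have e2 : (A₁ ∪ A₂) ∩ S₂ = A₂ := by clear ih hy hx h1 h2; grind
      obtain ⟨a', b', rfl, h1', h2'⟩ := hy.exists_op hd (h1.nonempty.mono s1)
        (h2.nonempty.mono s2) (by rwa [e1, e2])
      rw [e1] at h1'
      rw [e2] at h2'
      rw [size_op] at hn
      have := size_pos a
      have := size_pos b
      rw [ih _ (by omega) h1 h1' (h1.ncard.symm.trans h1'.ncard) rfl,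
        ih _ (by omega) h2 h2' (h2.ncard.symm.trans h2'.ncard) rfl]
    | ha a b _ _ => exact (hx' (by simp [IsAtt])).elim

end Real

/-- `f` is an isomorphism between the marked graphs `(S, A)` and `(S', A')`. -/
structure MIso (G : SimpleGraph V) (H : SimpleGraph W) (f : V → W) (S A : Set V)
    (S' A' : Set W) : Prop where
  bij : Set.BijOn f S S'
  adj : ∀ u ∈ S, ∀ v ∈ S, H.Adj (f u) (f v) ↔ G.Adj u v
  mem : ∀ u ∈ S, f u ∈ A' ↔ u ∈ A

open Classical in
theorem MIso.glue {f g : V → W} {S₁ A₁ S₂ A₂ : Set V} {S₁' A₁' S₂' A₂' : Set W} {k : Bool}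
    (hf : MIso G H f S₁ A₁ S₁' A₁') (hg : MIso G H g S₂ A₂ S₂' A₂')
    (hd : Disjoint S₁ S₂) (hd' : Disjoint S₁' S₂') (hx : Cross G k S₁ A₁ S₂ A₂)
    (hx' : Cross H k S₁' A₁' S₂' A₂') (h1 : A₁ ⊆ S₁) (h2 : A₂ ⊆ S₂) (h1' : A₁' ⊆ S₁')
    (h2' : A₂' ⊆ S₂') :
    ∃ h : V → W, MIso G H h (S₁ ∪ S₂) (A₁ ∪ A₂) (S₁' ∪ S₂') (A₁' ∪ A₂') ∧
      MIso G H h (S₁ ∪ S₂) A₁ (S₁' ∪ S₂') A₁' := by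
  have e1 : ∀ u ∈ S₁, (fun u => if u ∈ S₁ then f u else g u) u = f u := fun u hu => if_pos hu
  have e2 : ∀ u ∈ S₂, (fun u => if u ∈ S₁ then f u else g u) u = g u := fun u hu =>
    if_neg (Set.disjoint_right.1 hd hu)
  refine ⟨fun u => if u ∈ S₁ then f u else g u, ?_⟩
  generalize (fun u => if u ∈ S₁ then f u else g u) = h at e1 e2
  have b1 := hf.bij.congr fun u hu => (e1 u hu).symm
  have b2 := hg.bij.congr fun u hu => (e2 u hu).symm
  have bij : Set.BijOn h (S₁ ∪ S₂) (S₁' ∪ S₂') := by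
    refine b1.union b2 ?_
    rintro u (hu | hu) v (hv | hv) e
    · exact b1.injOn hu hv e
    · exact (Set.disjoint_left.1 hd' (b1.mapsTo hu) (e ▸ b2.mapsTo hv)).elim
    · exact (Set.disjoint_left.1 hd' (b1.mapsTo hv) (e ▸ b2.mapsTo hu)).elim
    · exact b2.injOn hu hv e
  have cr : ∀ u ∈ S₁, ∀ v ∈ S₂, H.Adj (h u) (h v) ↔ G.Adj u v := by
    intro u hu v hv
    rw [hx u hu v hv, e1 u hu, e2 v hv, hx' _ (hf.bij.mapsTo hu) _ (hg.bij.mapsTo hv),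
      hf.mem u hu, hg.mem v hv]
  have adj : ∀ u ∈ S₁ ∪ S₂, ∀ v ∈ S₁ ∪ S₂, H.Adj (h u) (h v) ↔ G.Adj u v := by
    rintro u (hu | hu) v (hv | hv)
    · rw [e1 u hu, e1 v hv, hf.adj u hu v hv]
    · exact cr u hu v hv
    · rw [H.adj_comm, G.adj_comm, cr v hv u hu]
    · rw [e2 u hu, e2 v hv, hg.adj u hu v hv]
  have m1 : ∀ u ∈ S₁, (h u ∈ A₁' ↔ u ∈ A₁) ∧ h u ∉ A₂' ∧ u ∉ A₂ := fun u hu =>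
    ⟨by rw [e1 u hu, hf.mem u hu], fun h => Set.disjoint_left.1 hd' (b1.mapsTo hu) (h2' h),
      fun h => Set.disjoint_left.1 hd hu (h2 h)⟩
  have m2 : ∀ u ∈ S₂, (h u ∈ A₂' ↔ u ∈ A₂) ∧ h u ∉ A₁' ∧ u ∉ A₁ := fun u hu =>
    ⟨by rw [e2 u hu, hg.mem u hu], fun h => Set.disjoint_right.1 hd' (b2.mapsTo hu) (h1' h),
      fun h => Set.disjoint_right.1 hd hu (h1 h)⟩
  refine ⟨⟨bij, adj, ?_⟩, ⟨bij, adj, ?_⟩⟩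
  · rintro u (hu | hu)
    · have := m1 u hu
      simp only [Set.mem_union]
      tauto
    · have := m2 u hu
      simp only [Set.mem_union]
      tauto
  · rintro u (hu | hu)
    · exact (m1 u hu).1
    · have := m2 u hu
      tauto

/-- Marked graphs described by the same element of `R` are isomorphic. -/
theorem Real.exists_mIso {x : R} {S A : Set V} {S' A' : Set W} (h : Real G x S A)
    (h' : Real H x S' A') : ∃ f, MIso G H f S A S' A' := by
  induction x using induction generalizing S A S' A' with
  | hl =>
    obtain ⟨v, rfl, rfl⟩ := h
    obtain ⟨w, rfl, rfl⟩ := h'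
    refine ⟨fun _ => w, ?_, ?_, ?_⟩ <;> simp
  | ho f a b iha ihb =>
    obtain ⟨S₁, A₁, S₂, A₂, rfl, rfl, hd, hc, h1, h2⟩ := real_op.1 h
    obtain ⟨S₁', A₁', S₂', A₂', rfl, rfl, hd', hc', h1', h2'⟩ := real_op.1 h'
    obtain ⟨f, hf⟩ := iha h1 h1'
    obtain ⟨g, hg⟩ := ihb h2 h2'
    obtain ⟨h, hh, -⟩ := hf.glue hg hd hd' hc hc' h1.subset h2.subset h1'.subset h2'.subset
    exact ⟨h, hh⟩
  | ha a b iha ihb =>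
    obtain ⟨S₁, S₂, A₂, rfl, hd, hc, h1, h2⟩ := real_att.1 h
    obtain ⟨S₁', S₂', A₂', rfl, hd', hc', h1', h2'⟩ := real_att.1 h'
    obtain ⟨f, hf⟩ := iha h1 h1'
    obtain ⟨g, hg⟩ := ihb h2 h2'
    obtain ⟨h, -, hh⟩ := hf.glue hg hd hd' hc hc' h1.subset h2.subset h1'.subset h2'.subset
    exact ⟨h, hh⟩

/-- Descriptions are transported along isomorphisms. -/
theorem Real.map {x : R} {S A : Set V} (h : Real G x S A) {f : V → W} {A' : Set W}
    (hf : Set.InjOn f S) (hadj : ∀ u ∈ S, ∀ v ∈ S, H.Adj (f u) (f v) ↔ G.Adj u v)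
    (hA : A' = f '' A) : Real H x (f '' S) A' := by
  subst hA
  have cross : ∀ {k : Bool} {S₁ A₁ S₂ A₂ : Set V}, A₁ ⊆ S₁ → A₂ ⊆ S₂ → S₁ ⊆ S → S₂ ⊆ S →
      Cross G k S₁ A₁ S₂ A₂ → Cross H k (f '' S₁) (f '' A₁) (f '' S₂) (f '' A₂) := by
    rintro k S₁ A₁ S₂ A₂ a1 a2 s1 s2 hc _ ⟨u, hu, rfl⟩ _ ⟨v, hv, rfl⟩
    rw [hadj u (s1 hu) v (s2 hv), hc u hu v hv, hf.mem_image_iff (a1.trans s1) (s1 hu),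
      hf.mem_image_iff (a2.trans s2) (s2 hv)]
  induction x using induction generalizing S A with
  | hl =>
    obtain ⟨v, rfl, rfl⟩ := h
    exact ⟨f v, by simp, by simp⟩
  | ho g a b iha ihb =>
    obtain ⟨S₁, A₁, S₂, A₂, rfl, rfl, hd, hc, h1, h2⟩ := real_op.1 h
    have s1 : S₁ ⊆ S₁ ∪ S₂ := Set.subset_union_left
    have s2 : S₂ ⊆ S₁ ∪ S₂ := Set.subset_union_right
    refine real_op.2 ⟨f '' S₁, f '' A₁, f '' S₂, f '' A₂, Set.image_union .., Set.image_union ..,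
      ?_, cross h1.subset h2.subset s1 s2 hc, ?_, ?_⟩
    · rw [Set.disjoint_iff_inter_eq_empty, ← hf.image_inter s1 s2,
        Set.disjoint_iff_inter_eq_empty.1 hd, Set.image_empty]
    · exact iha h1 (hf.mono s1) (fun u hu v hv => hadj u (s1 hu) v (s1 hv))
        (fun a1 a2 t1 t2 => cross a1 a2 (t1.trans s1) (t2.trans s1))
    · exact ihb h2 (hf.mono s2) (fun u hu v hv => hadj u (s2 hu) v (s2 hv))
        (fun a1 a2 t1 t2 => cross a1 a2 (t1.trans s2) (t2.trans s2))
  | ha a b iha ihb =>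
    obtain ⟨S₁, S₂, A₂, rfl, hd, hc, h1, h2⟩ := real_att.1 h
    have s1 : S₁ ⊆ S₁ ∪ S₂ := Set.subset_union_left
    have s2 : S₂ ⊆ S₁ ∪ S₂ := Set.subset_union_right
    refine real_att.2 ⟨f '' S₁, f '' S₂, f '' A₂, Set.image_union ..,
      ?_, cross h1.subset h2.subset s1 s2 hc, ?_, ?_⟩
    · rw [Set.disjoint_iff_inter_eq_empty, ← hf.image_inter s1 s2,
        Set.disjoint_iff_inter_eq_empty.1 hd, Set.image_empty]
    · exact iha h1 (hf.mono s1) (fun u hu v hv => hadj u (s1 hu) v (s1 hv))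
        (fun a1 a2 t1 t2 => cross a1 a2 (t1.trans s1) (t2.trans s1))
    · exact ihb h2 (hf.mono s2) (fun u hu v hv => hadj u (s2 hu) v (s2 hv))
        (fun a1 a2 t1 t2 => cross a1 a2 (t1.trans s2) (t2.trans s2))

/-- The graph obtained from `G` and `H` by joining the marked vertices. -/
def glueG (k : Bool) (G : SimpleGraph V) (H : SimpleGraph W) (A : Set V) (B : Set W) :
    SimpleGraph (V ⊕ W) where
  Adj
    | .inl u, .inl v => G.Adj u v
    | .inr u, .inr v => H.Adj u v
    | .inl u, .inr v => k = true ∧ u ∈ A ∧ v ∈ B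
    | .inr v, .inl u => k = true ∧ u ∈ A ∧ v ∈ B
  symm := ⟨by
    rintro (u | u) (v | v) h
    · exact G.adj_symm h
    · exact h
    · exact h
    · exact H.adj_symm h⟩
  loopless := ⟨by
    rintro (u | u) h
    · exact G.loopless.irrefl _ h
    · exact H.loopless.irrefl _ h⟩

theorem cross_glueG (k : Bool) (G : SimpleGraph V) (H : SimpleGraph W) (A : Set V) (B : Set W) :
    Cross (glueG k G H A B) k (Sum.inl '' Set.univ) (Sum.inl '' A) (Sum.inr '' Set.univ)
      (Sum.inr '' B) := by
  rintro _ ⟨u, -, rfl⟩ _ ⟨v, -, rfl⟩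
  simp [glueG]

theorem Real.inl {x : R} {A : Set V} (h : Real G x Set.univ A) (k : Bool) (B : Set W) :
    Real (glueG k G H A B) x (Sum.inl '' Set.univ) (Sum.inl '' A) :=
  h.map Sum.inl_injective.injOn (fun _ _ _ _ => Iff.rfl) rfl

theorem Real.inr {x : R} {B : Set W} (h : Real H x Set.univ B) (k : Bool) (A : Set V) :
    Real (glueG k G H A B) x (Sum.inr '' Set.univ) (Sum.inr '' B) :=
  h.map Sum.inr_injective.injOn (fun _ _ _ _ => Iff.rfl) rfl

theorem univ_sum : (Set.univ : Set (V ⊕ W)) = Sum.inl '' Set.univ ∪ Sum.inr '' Set.univ := by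
  simp

theorem disjoint_inl_inr {S : Set V} {T : Set W} :
    Disjoint (Sum.inl '' S : Set (V ⊕ W)) (Sum.inr '' T) := by
  simp [Set.disjoint_left]

/-- Every element of `R` describes a marked graph. -/
theorem exists_real (x : R) : ∃ (V : Type) (G : SimpleGraph V) (A : Set V),
    Real G x Set.univ A := by
  induction x using induction with
  | hl => exact ⟨Unit, ⊥, {()}, (), by ext; simp, rfl⟩
  | ho f a b iha ihb =>
    obtain ⟨V, G, A, h1⟩ := iha
    obtain ⟨W, H, B, h2⟩ := ihb
    exact ⟨V ⊕ W, glueG f G H A B, Sum.inl '' A ∪ Sum.inr '' B, real_op.2 ⟨_, _, _, _, univ_sum,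
      rfl, disjoint_inl_inr, cross_glueG _ _ _ _ _, h1.inl f B, h2.inr f A⟩⟩
  | ha a b iha ihb =>
    obtain ⟨V, G, A, h1⟩ := iha
    obtain ⟨W, H, B, h2⟩ := ihb
    exact ⟨V ⊕ W, glueG true G H A B, Sum.inl '' A, real_att.2 ⟨_, _, _, univ_sum,
      disjoint_inl_inr, cross_glueG _ _ _ _ _, h1.inl true B, h2.inr true A⟩⟩

variable {V : Type} {G : SimpleGraph V}

/-- Gluing two described marked graphs along their marks and changing the root to `v`. -/
theorem exists_real_root {a b : R} {S₁ A S₂ B : Set V} (h1 : Real G a S₁ A) (h2 : Real G b S₂ B)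
    (hd : Disjoint S₁ S₂) (hc : Cross G true S₁ A S₂ B) {v : V} (hv : v ∈ S₂) :
    ∃ y, Real G y ((S₁ ∪ S₂) \ {v}) {u | u ∈ S₁ ∪ S₂ ∧ G.Adj v u} ∧ Rel (a, b) (leaf, y) := by
  induction b using induction generalizing a S₁ A S₂ B with
  | hl =>
    obtain ⟨w, rfl, rfl⟩ := h2
    obtain rfl : v = w := hv
    refine ⟨a, ?_, .swap _ _⟩
    have s1 := h1.subset
    have hv' : v ∉ S₁ := fun h => Set.disjoint_left.1 hd h rfl
    have hc := fun u hu => hc u hu v rfl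
    convert h1 using 1
    · clear h1; grind
    · ext u
      have := G.adj_comm u v
      have := G.loopless.irrefl v
      clear h1
      grind
  | ho f b c ihb ihc =>
    have key : ∀ {b c : R}, (∀ {a : R} {S₁ A S₂ B : Set V}, Real G a S₁ A → Real G b S₂ B →
        Disjoint S₁ S₂ → Cross G true S₁ A S₂ B → v ∈ S₂ → ∃ y, Real G y ((S₁ ∪ S₂) \ {v})
          {u | u ∈ S₁ ∪ S₂ ∧ G.Adj v u} ∧ Rel (a, b) (leaf, y)) →
        ∀ {T₁ B₁ T₂ B₂ : Set V}, Real G b T₁ B₁ → Real G c T₂ B₂ → Disjoint T₁ T₂ →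
        Cross G f T₁ B₁ T₂ B₂ → Disjoint S₁ (T₁ ∪ T₂) → Cross G true S₁ A (T₁ ∪ T₂) (B₁ ∪ B₂) →
        v ∈ T₁ → ∃ y, Real G y ((S₁ ∪ (T₁ ∪ T₂)) \ {v}) {u | u ∈ S₁ ∪ (T₁ ∪ T₂) ∧ G.Adj v u} ∧
          Rel (a, op f b c) (leaf, y) := by
      clear ihb ihc h2 hd hc hv
      intro b c ih T₁ B₁ T₂ B₂ k1 k2 kd kc hd hc hv
      have s1 := h1.subset
      have t1 := k1.subset
      have t2 := k2.subset
      rw [Set.disjoint_union_right] at hd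
      have d1 := fun u (h : u ∈ S₁) => Set.disjoint_left.1 hd.1 h
      have d2 := fun u (h : u ∈ S₁) => Set.disjoint_left.1 hd.2 h
      have d3 := fun u (h : u ∈ T₁) => Set.disjoint_left.1 kd h
      have c1 : Cross G true S₁ A T₂ B₂ := by
        intro u hu v hv
        have := hc u hu v (.inr hv)
        clear ih h1 k1 k2
        grind
      obtain ⟨y, hy, hr⟩ := ih (a := jn f a c) (S₁ := S₁ ∪ T₂)
        (A := if f then A ∪ B₂ else A) (S₂ := T₁) (B := B₁) (by
          cases f
          · exact real_att.2 ⟨_, _, _, rfl, hd.2, c1, h1, k2⟩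
          · exact real_op.2 ⟨_, _, _, _, rfl, rfl, hd.2, c1, h1, k2⟩) k1
        (by rw [Set.disjoint_union_left]; exact ⟨hd.1, kd.symm⟩) (by
          rintro u (hu | hu) v hv
          · have := hc u hu v (.inl hv)
            clear ih h1 k1 k2
            grind
          · have := kc.symm u hu v hv
            clear ih h1 k1 k2
            grind) hv
      rw [Set.union_right_comm, Set.union_assoc] at hy
      exact ⟨y, hy, (op_comm f b c ▸ (Rel.jn f a c b).symm).trans hr⟩
    obtain ⟨T₁, B₁, T₂, B₂, rfl, rfl, kd, kc, k1, k2⟩ := real_op.1 h2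
    rcases hv with hv | hv
    · exact key ihb k1 k2 kd kc hd hc hv
    · rw [op_comm, Set.union_comm T₁]
      exact key ihc k2 k1 kd.symm kc.symm (by rwa [Set.union_comm T₂])
        (by rwa [Set.union_comm T₂, Set.union_comm B₂]) hv
  | ha b c ihb ihc =>
    obtain ⟨T₁, T₂, C, rfl, kd, kc, k1, k2⟩ := real_att.1 h2
    have s1 := h1.subset
    have t1 := k1.subset
    have t2 := k2.subset
    rw [Set.disjoint_union_right] at hd
    have d1 := fun u (h : u ∈ S₁) => Set.disjoint_left.1 hd.1 h
    have d2 := fun u (h : u ∈ S₁) => Set.disjoint_left.1 hd.2 h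
    have d3 := fun u (h : u ∈ T₁) => Set.disjoint_left.1 kd h
    have c1 : Cross G true T₁ B S₁ A := by
      intro u hu v hv
      have := hc v hv u (.inl hu)
      rw [G.adj_comm, this]
      tauto
    have c2 : Cross G false S₁ A T₂ C := by
      intro u hu v hv
      have := hc u hu v (.inr hv)
      clear ihb ihc h1 k1 k2 h2
      grind
    rcases hv with hv | hv
    · obtain ⟨y, hy, hr⟩ := ihb (real_op.2 ⟨_, _, _, _, rfl, rfl, hd.2, c2, h1, k2⟩) k1
        (by rw [Set.disjoint_union_left]; exact ⟨hd.1, kd.symm⟩) (by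
          rintro u (hu | hu) v hv
          · have := c1.symm u hu v hv
            clear ihb ihc h1 k1 k2 h2
            grind
          · have := kc.symm u hu v hv
            clear ihb ihc h1 k1 k2 h2
            grind) hv
      rw [Set.union_right_comm, Set.union_assoc] at hy
      refine ⟨y, hy, .trans (.trans (.swap _ _) ?_) hr⟩
      have := (Rel.jn false b c a).trans (.swap _ _)
      rwa [op_comm] at this
    · obtain ⟨y, hy, hr⟩ := ihc (real_att.2 ⟨_, _, _, rfl, hd.1.symm, c1, k1, h1⟩) k2
        (by rw [Set.disjoint_union_left]; exact ⟨kd, hd.2⟩) (by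
          rintro u (hu | hu) v hv
          · exact kc u hu v hv
          · have := c2 u hu v hv
            clear ihb ihc h1 k1 k2 h2
            grind) hv
      rw [Set.union_comm T₁, Set.union_assoc] at hy
      refine ⟨y, hy, .trans (.trans (.swap _ _) ?_) hr⟩
      have := (Rel.jn false b c a).trans (.symm (op_comm false c a ▸ Rel.jn false b a c))
      exact this

/-- A vertex of a described graph can be replaced by a described marked graph. -/
theorem exists_real_subst {y d : R} {S A D B : Set V} (hy : Real G y S A) (hd : Real G d D B)
    {β : V} (hβ : β ∈ S) (hD : ∀ u ∈ D, u ∈ S → u = β)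
    (hc : ∀ u ∈ D, ∀ v ∈ S, v ≠ β → (G.Adj u v ↔ u ∈ B ∧ G.Adj β v)) :
    ∃ z, Real G z (S \ {β} ∪ D) {v | v ∈ A ∧ v ≠ β ∨ β ∈ A ∧ v ∈ B} := by
  have hB := hd.subset
  induction y using induction generalizing S A with
  | hl =>
    obtain ⟨w, rfl, rfl⟩ := hy
    obtain rfl : β = w := hβ
    refine ⟨d, ?_⟩
    convert hd using 1
    · simp
    · ext; simp
  | ho f a b iha ihb =>
    have key : ∀ {a b : R} {S₁ A₁ S₂ A₂ : Set V}, Real G a S₁ A₁ → Real G b S₂ A₂ →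
        Disjoint S₁ S₂ → Cross G f S₁ A₁ S₂ A₂ → β ∈ S₁ →
        (∀ u ∈ D, u ∈ S₁ ∪ S₂ → u = β) →
        (∀ u ∈ D, ∀ v ∈ S₁ ∪ S₂, v ≠ β → (G.Adj u v ↔ u ∈ B ∧ G.Adj β v)) →
        (∃ z, Real G z (S₁ \ {β} ∪ D) {v | v ∈ A₁ ∧ v ≠ β ∨ β ∈ A₁ ∧ v ∈ B}) →
        ∃ z, Real G z ((S₁ ∪ S₂) \ {β} ∪ D)
          {v | v ∈ A₁ ∪ A₂ ∧ v ≠ β ∨ β ∈ A₁ ∪ A₂ ∧ v ∈ B} := by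
      clear iha ihb hy hc hD hβ
      rintro a b S₁ A₁ S₂ A₂ h1 h2 hd hc hβ hD hcc ⟨z, hz⟩
      have d1 := fun u (h : u ∈ S₁) => Set.disjoint_left.1 hd h
      have s1 := h1.subset
      have s2 := h2.subset
      refine ⟨op f z b, real_op.2 ⟨_, _, _, _, ?_, ?_, ?_, ?_, hz, h2⟩⟩
      · clear h1 h2 hz; grind
      · clear h1 h2 hz; grind
      · rw [Set.disjoint_left]; clear h1 h2 hz; grind
      · intro u hu v hv
        have c1 := hc u
        have c2 := hc β hβ v hv
        have c3 := hcc u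
        clear h1 h2 hz hc hcc
        grind
    obtain ⟨S₁, A₁, S₂, A₂, rfl, rfl, hd, hx, h1, h2⟩ := real_op.1 hy
    rcases hβ with hβ | hβ
    · exact key h1 h2 hd hx hβ hD hc (iha h1 hβ (fun u hu hu' => hD u hu (.inl hu'))
        (fun u hu v hv => hc u hu v (.inl hv)))
    · rw [Set.union_comm S₁, Set.union_comm A₁]
      rw [Set.union_comm S₁] at hD hc
      exact key h2 h1 hd.symm hx.symm hβ hD hc (ihb h2 hβ (fun u hu hu' => hD u hu (.inl hu'))
        (fun u hu v hv => hc u hu v (.inl hv)))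
  | ha a b iha ihb =>
    obtain ⟨S₁, S₂, A₂, rfl, hd, hx, h1, h2⟩ := real_att.1 hy
    have d1 := fun u (h : u ∈ S₁) => Set.disjoint_left.1 hd h
    have s1 := h1.subset
    have s2 := h2.subset
    rcases hβ with hβ | hβ
    · obtain ⟨z, hz⟩ := iha h1 hβ (fun u hu hu' => hD u hu (.inl hu'))
        (fun u hu v hv => hc u hu v (.inl hv))
      clear iha ihb
      refine ⟨att z b, real_att.2 ⟨_, _, _, ?_, ?_, ?_, hz, h2⟩⟩
      · clear h1 h2 hz hy hd; grind
      · rw [Set.disjoint_left]; clear h1 h2 hz hy hd; grind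
      · intro u hu v hv
        have c1 := hx u
        have c2 := hx β hβ v hv
        have c3 := hc u
        clear h1 h2 hz hc hx hd hy
        grind
    · obtain ⟨z, hz⟩ := ihb h2 hβ (fun u hu hu' => hD u hu (.inr hu'))
        (fun u hu v hv => hc u hu v (.inr hv))
      clear iha ihb
      have e : {v | v ∈ A ∧ v ≠ β ∨ β ∈ A ∧ v ∈ B} = A := by
        clear h1 h2 hz hy hd; grind
      rw [e]
      refine ⟨att a z, real_att.2 ⟨_, _, _, ?_, ?_, ?_, h1, hz⟩⟩
      · clear h1 h2 hz hy hd; grind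
      · rw [Set.disjoint_left]; clear h1 h2 hz hy hd; grind
      · intro u hu v hv
        have c1 := hx u hu v
        have c2 := hx u hu β hβ
        have c3 := hc v
        have c4 := G.adj_comm u v
        have c5 := G.adj_comm u β
        clear h1 h2 hz hc hx hd hy
        grind

variable {V : Type} {G : SimpleGraph V}

/-- The subgraph induced on `W` has at most one connected component. -/
def Conn (G : SimpleGraph V) (W : Set V) : Prop :=
  ∀ C ⊆ W, C.Nonempty → (∀ u ∈ C, ∀ v ∈ W, G.Adj u v → v ∈ C) → C = W

theorem Conn.retract {S₁ A S₂ B W : Set V} (h : Conn G W) (hW : W ⊆ S₁ ∪ S₂)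
    (hd : Disjoint S₁ S₂) (hc : Cross G true S₁ A S₂ B) {b : V} (hb : b ∈ B) (hb' : b ∈ S₂)
    (hbW : b ∈ W) : Conn G (W ∩ S₁ ∪ {b}) := by
  intro C hC ⟨c, hcC⟩ hcl
  have d := fun u (h : u ∈ S₁) => Set.disjoint_left.1 hd h
  have key := h (C ∩ S₁ ∪ {v | v ∈ W ∧ v ∈ S₂ ∧ b ∈ C}) (by
    clear h; intro u hu; have := @hC u; grind) (by
    by_cases hcS : c ∈ S₁
    · exact ⟨c, .inl ⟨hcC, hcS⟩⟩
    · have := hC hcC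
      have : c = b := by clear h; grind
      subst this
      exact ⟨c, .inr ⟨hbW, hb', hcC⟩⟩) (by
    clear h
    rintro u (⟨hu, hu'⟩ | ⟨hu, hu', hbC⟩) v hv huv
    · rcases hW hv with hv' | hv'
      · exact .inl ⟨hcl u hu v (.inl ⟨hv, hv'⟩) huv, hv'⟩
      · refine .inr ⟨hv, hv', hcl u hu b (.inr rfl) ?_⟩
        have := (hc u hu' v hv').1 huv
        exact (hc u hu' b hb').2 ⟨rfl, this.2.1, hb⟩
    · rcases hW hv with hv' | hv'
      · refine .inl ⟨hcl b hbC v (.inl ⟨hv, hv'⟩) (G.adj_symm ?_), hv'⟩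
        have := (hc v hv' u hu').1 (G.adj_symm huv)
        exact (hc v hv' b hb').2 ⟨rfl, this.2.1, hb⟩
      · exact .inr ⟨hv, hv', hbC⟩)
  refine hC.antisymm ?_
  rintro u (⟨hu, hu'⟩ | rfl)
  · rw [← key] at hu
    clear h key; grind
  · have := key ▸ hbW
    clear h key; grind

theorem Conn.singleton (v : V) : Conn G {v} := by
  rintro C hC hne -
  exact (Set.subset_singleton_iff_eq.1 hC).resolve_left hne.ne_empty

theorem Conn.insert {W : Set V} (h : Conn G W) {w u : V} (hu : u ∈ W) (hw : G.Adj u w) :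
    Conn G (insert w W) := by
  intro C hC hne hcl
  by_cases hwW : w ∈ W
  · rw [Set.insert_eq_of_mem hwW] at hC hcl ⊢
    exact h C hC hne hcl
  have key : (C ∩ W).Nonempty → C ∩ W = W := fun hne => h _ Set.inter_subset_right hne (by
    rintro a ⟨ha, -⟩ b hb hab
    exact ⟨hcl a ha b (.inr hb) hab, hb⟩)
  have huC : u ∈ C := by
    obtain ⟨c, hc⟩ := hne
    rcases hC hc with rfl | hc'
    · exact hcl c hc u (.inr hu) (G.adj_symm hw)
    · have := key ⟨c, hc, hc'⟩
      exact ((Set.ext_iff.1 this u).2 hu).1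
  have e := key ⟨u, huC, hu⟩
  refine hC.antisymm ?_
  rintro v (rfl | hv)
  · exact hcl u huC v (.inl rfl) hw
  · exact ((Set.ext_iff.1 e v).2 hv).1

/-- If two nonadjacent vertices of a connected set `W` have a common neighbour in `U`, they have
one in `W`. -/
def PP (G : SimpleGraph V) (U : Set V) : Prop :=
  ∀ W ⊆ U, Conn G W → ∀ p ∈ W, ∀ q ∈ W, p ≠ q → ¬ G.Adj p q → ∀ w ∈ U, G.Adj p w → G.Adj q w →
    ∃ z ∈ W, G.Adj p z ∧ G.Adj q z

theorem PP.mono {U U' : Set V} (h : PP G U) (hU : U' ⊆ U) : PP G U' :=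
  fun W hW hC p hp q hq hpq hn w hw => h W (hW.trans hU) hC p hp q hq hpq hn w (hU hw)

theorem pp_triple (a b c : V) : PP G {a, b, c} := by
  intro W hW hC p hp q hq hpq hn w hw hpw hqw
  by_cases hwW : w ∈ W
  · exact ⟨w, hwW, hpw, hqw⟩
  have h1 := G.loopless.irrefl p
  have h2 := G.loopless.irrefl q
  have := hC {p} (by simpa using hp) ⟨p, rfl⟩ (by
    rintro u rfl v hv huv
    have e1 := hW hp
    have e2 := hW hq
    have e3 := hW hv
    clear hC hW
    simp only [Set.mem_insert_iff, Set.mem_singleton_iff] at e1 e2 e3 hw ⊢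
    grind)
  rw [← this] at hq
  exact absurd hq.symm hpq

theorem PP.glue_aux {S₁ A S₂ B : Set V} (hd : Disjoint S₁ S₂) (hc : Cross G true S₁ A S₂ B)
    (hB : B ⊆ S₂) (h1 : ∀ β ∈ B, PP G (S₁ ∪ {β})) {W : Set V} (hW : W ⊆ S₁ ∪ S₂)
    (hC : Conn G W) {p q : V} (hp : p ∈ W) (hq : q ∈ W) (hpq : p ≠ q) (hn : ¬ G.Adj p q) {w : V}
    (hpw : G.Adj p w) (hqw : G.Adj q w) {β : V} (hβ : β ∈ B) (hβW : β ∈ W)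
    (hp1 : p ∈ S₁) (hw1 : w ∈ S₁) : ∃ z ∈ W, G.Adj p z ∧ G.Adj q z := by
  have key : ∀ b ∈ B, b ∈ W → q ∈ W ∩ S₁ ∪ {b} → ∃ z ∈ W, G.Adj p z ∧ G.Adj q z := by
    intro b hb hbW hq'
    obtain ⟨z, hz, hz'⟩ := h1 b hb _ (Set.union_subset_union_left _ Set.inter_subset_right)
      (hC.retract hW hd hc hb (hB hb) hbW) p (.inl ⟨hp, hp1⟩) q hq' hpq hn w (.inl hw1) hpw hqw
    refine ⟨z, ?_, hz'⟩
    rcases hz with hz | rfl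
    · exact hz.1
    · exact hbW
  rcases hW hq with hq1 | hq2
  · exact key β hβ hβW (.inl ⟨hq, hq1⟩)
  · exact key q ((hc w hw1 q hq2).1 (G.adj_symm hqw)).2.2 hq (.inr rfl)

theorem PP.glue_aux₂ {S₁ A S₂ B : Set V} (hd : Disjoint S₁ S₂) (hc : Cross G true S₁ A S₂ B)
    (hA : A ⊆ S₁) (hB : B ⊆ S₂) (h1 : ∀ β ∈ B, PP G (S₁ ∪ {β})) (h2 : ∀ α ∈ A, PP G (S₂ ∪ {α}))
    {W : Set V} (hW : W ⊆ S₁ ∪ S₂)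
    (hC : Conn G W) {p q : V} (hp : p ∈ W) (hq : q ∈ W) (hpq : p ≠ q) (hn : ¬ G.Adj p q) {w : V}
    (hw : w ∈ S₁ ∪ S₂) (hpw : G.Adj p w) (hqw : G.Adj q w) (hAW : ∃ α ∈ A, α ∈ W)
    (hBW : ∃ β ∈ B, β ∈ W) (hp1 : p ∈ S₁) : ∃ z ∈ W, G.Adj p z ∧ G.Adj q z := by
  obtain ⟨α, hα, hαW⟩ := hAW
  obtain ⟨β, hβ, hβW⟩ := hBW
  rcases hw with hw | hw
  · exact PP.glue_aux hd hc hB h1 hW hC hp hq hpq hn hpw hqw hβ hβW hp1 hw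
  rcases hW hq with hq1 | hq1
  · refine ⟨β, hβW, (hc p hp1 β (hB hβ)).2 ⟨rfl, ?_, hβ⟩, (hc q hq1 β (hB hβ)).2 ⟨rfl, ?_, hβ⟩⟩
    · exact ((hc p hp1 w hw).1 hpw).2.1
    · exact ((hc q hq1 w hw).1 hqw).2.1
  · obtain ⟨z, hz, hz'⟩ := PP.glue_aux hd.symm hc.symm hA h2 (Set.union_comm S₁ S₂ ▸ hW) hC hq hp
      hpq.symm (fun h => hn (G.adj_symm h)) hqw hpw hα hαW hq1 hw
    exact ⟨z, hz, hz'.symm⟩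

theorem PP.glue {S₁ A S₂ B : Set V} (hd : Disjoint S₁ S₂) (hc : Cross G true S₁ A S₂ B)
    (hA : A ⊆ S₁) (hB : B ⊆ S₂) (h1 : ∀ β ∈ B, PP G (S₁ ∪ {β})) (h2 : ∀ α ∈ A, PP G (S₂ ∪ {α}))
    (hA' : A.Nonempty) (hB' : B.Nonempty) : PP G (S₁ ∪ S₂) := by
  intro W hW hC p hp q hq hpq hn w hw hpw hqw
  have side : ∀ {S₁ A S₂ B : Set V}, Cross G true S₁ A S₂ B → (∀ β ∈ B, PP G (S₁ ∪ {β})) →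
      B.Nonempty → w ∈ S₁ ∪ S₂ → W ⊆ S₁ → ∃ z ∈ W, G.Adj p z ∧ G.Adj q z := by
    intro S₁ A S₂ B hc h1 ⟨β, hβ⟩ hw hW
    rcases hw with hw | hw
    · exact h1 β hβ W (hW.trans Set.subset_union_left) hC p hp q hq hpq hn w (.inl hw) hpw hqw
    · exact h1 w ((hc p (hW hp) w hw).1 hpw).2.2 W (hW.trans Set.subset_union_left) hC p hp q hq
        hpq hn w (.inr rfl) hpw hqw
  by_cases hW1 : W ⊆ S₁
  · exact side hc h1 hB' hw hW1
  by_cases hW2 : W ⊆ S₂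
  · exact side hc.symm h2 hA' hw.symm hW2
  obtain ⟨a, b, ha, hb, haW, hbW⟩ : ∃ a b, a ∈ A ∧ b ∈ B ∧ a ∈ W ∧ b ∈ W := by
    by_contra! hcon
    refine hW1 ?_
    have := hC (W ∩ S₁) Set.inter_subset_left (by
      obtain ⟨v, hv, hv'⟩ := Set.not_subset.1 hW2
      exact ⟨v, hv, (hW hv).resolve_right hv'⟩) (by
      rintro u ⟨hu, hu'⟩ v hv huv
      refine ⟨hv, (hW hv).resolve_right fun hv' => ?_⟩
      obtain ⟨-, e1, e2⟩ := (hc u hu' v hv').1 huv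
      exact hcon u v e1 e2 hu hv)
    rw [← this]
    exact Set.inter_subset_right
  rcases hW hp with hp1 | hp1
  · exact PP.glue_aux₂ hd hc hA hB h1 h2 hW hC hp hq hpq hn hw hpw hqw ⟨a, ha, haW⟩ ⟨b, hb, hbW⟩
      hp1
  · exact PP.glue_aux₂ hd.symm hc.symm hB hA h2 h1 (Set.union_comm S₁ S₂ ▸ hW) hC hp hq hpq hn
      hw.symm hpw hqw ⟨b, hb, hbW⟩ ⟨a, ha, haW⟩ hp1

/-- Two marked sets joined to each other, with a root attached to at least one of them. -/
theorem PP.glue_root {S₁ A₁ S₂ A₂ : Set V} {f g : Bool} (hfg : f = true ∨ g = true)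
    (hd : Disjoint S₁ S₂) (hc : Cross G f S₁ A₁ S₂ A₂) (hA₁ : A₁ ⊆ S₁) (hA₂ : A₂ ⊆ S₂)
    (hn₁ : A₁.Nonempty) (hn₂ : A₂.Nonempty)
    (h1 : ∀ r ∉ S₁, (∀ u ∈ S₁, G.Adj r u ↔ u ∈ A₁) → PP G (S₁ ∪ {r}))
    (h2 : ∀ r ∉ S₂, (∀ u ∈ S₂, G.Adj r u ↔ u ∈ A₂) → PP G (S₂ ∪ {r})) {r : V}
    (hr₁ : r ∉ S₁) (hr₂ : r ∉ S₂) (ha₁ : ∀ u ∈ S₁, G.Adj r u ↔ u ∈ A₁)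
    (ha₂ : ∀ u ∈ S₂, G.Adj r u ↔ g = true ∧ u ∈ A₂) : PP G (S₁ ∪ (S₂ ∪ {r})) := by
  have d := fun u (h : u ∈ S₁) => Set.disjoint_left.1 hd h
  refine PP.glue (A := A₁) (B := {r} ∪ {u | f = true ∧ u ∈ A₂}) ?_ ?_ hA₁ ?_ ?_ ?_ hn₁
    ⟨r, .inl rfl⟩
  · rw [Set.disjoint_union_right]; exact ⟨hd, by simpa using hr₁⟩
  · rintro u hu v (hv | rfl)
    · have := hc u hu v hv
      clear h1 h2 hc ha₁ ha₂; grind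
    · have := ha₁ u hu
      rw [G.adj_comm]
      clear h1 h2 hc ha₁ ha₂; grind
  · rintro u (hu | hu)
    · exact .inr hu
    · exact .inl (hA₂ hu.2)
  · rintro β (rfl | ⟨hf, hβ⟩)
    · exact h1 _ hr₁ ha₁
    · refine h1 _ (fun h => d β h (hA₂ hβ)) fun u hu => ?_
      rw [G.adj_comm, hc u hu β (hA₂ hβ)]
      simp [hf, hβ]
  · intro α hα
    have hα₁ := hA₁ hα
    rw [Set.union_assoc]
    have hr : ∀ u ∈ S₂, G.Adj α u ↔ f = true ∧ u ∈ A₂ := fun u hu => by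
      rw [hc α hα₁ u hu]; simp [hα]
    have key : Cross G true S₂ A₂ ({r} ∪ {α}) {u | u = r ∧ g = true ∨ u = α ∧ f = true} := by
      rintro u hu v hv
      have e1 := hr u hu
      have e2 := ha₂ u hu
      have : r ≠ α := by rintro rfl; exact hr₁ hα₁
      rw [G.adj_comm]
      clear h1 h2 hc ha₁ ha₂ hr
      rcases hv with rfl | rfl <;> grind
    refine PP.glue ?_ key hA₂ (by grind) ?_ ?_ hn₂ ?_
    · rw [Set.disjoint_left]
      rintro u hu (rfl | rfl)
      · exact hr₂ hu
      · exact d _ hα₁ hu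
    · rintro β (⟨rfl, h⟩ | ⟨rfl, h⟩)
      · exact h2 _ hr₂ (by simpa [h] using ha₂)
      · exact h2 _ (d _ hα₁) (by simpa [h] using hr)
    · intro γ _
      refine (pp_triple r α γ).mono ?_
      rintro u ((rfl | rfl) | rfl) <;> simp
    · rcases hfg with h | h
      · exact ⟨α, .inr ⟨rfl, h⟩⟩
      · exact ⟨r, .inl ⟨rfl, h⟩⟩

theorem Real.pp {x : R} {S A : Set V} (h : Real G x S A) {r : V} (hr : r ∉ S)
    (ha : ∀ u ∈ S, G.Adj r u ↔ u ∈ A) : PP G (S ∪ {r}) := by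
  induction x using induction generalizing S A r with
  | hl =>
    obtain ⟨v, rfl, rfl⟩ := h
    exact (pp_triple v r r).mono (by rintro u (rfl | rfl) <;> simp)
  | ho f a b iha ihb =>
    obtain ⟨S₁, A₁, S₂, A₂, rfl, rfl, hd, hc, h1, h2⟩ := real_op.1 h
    have s1 := h1.subset
    have s2 := h2.subset
    have d := fun u (h : u ∈ S₁) => Set.disjoint_left.1 hd h
    rw [Set.union_assoc]
    refine PP.glue_root (f := f) (g := true) (.inr rfl) hd hc s1 s2 h1.nonempty h2.nonempty
      (fun r hr h => iha h1 hr h) (fun r hr h => ihb h2 hr h) (fun h => hr (.inl h))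
      (fun h => hr (.inr h)) ?_ ?_
    · intro u hu
      have := ha u (.inl hu)
      have := @s2 u
      clear iha ihb h h1 h2 hc ha
      grind
    · intro u hu
      have := ha u (.inr hu)
      have := @s1 u
      clear iha ihb h h1 h2 hc ha
      grind
  | ha a b iha ihb =>
    obtain ⟨S₁, S₂, B, rfl, hd, hc, h1, h2⟩ := real_att.1 h
    have s1 := h1.subset
    have s2 := h2.subset
    have d := fun u (h : u ∈ S₁) => Set.disjoint_left.1 hd h
    rw [Set.union_assoc]
    refine PP.glue_root (f := true) (g := false) (.inl rfl) hd hc s1 s2 h1.nonempty h2.nonempty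
      (fun r hr h => iha h1 hr h) (fun r hr h => ihb h2 hr h) (fun h => hr (.inl h))
      (fun h => hr (.inr h)) ?_ ?_
    · intro u hu
      exact ha u (.inl hu)
    · intro u hu
      have := ha u (.inr hu)
      have := @s1 u
      clear iha ihb h h1 h2 hc ha
      grind

theorem Real.conn {x : R} {S A : Set V} (h : Real G x S A) {r : V}
    (ha : ∀ u ∈ S, G.Adj r u ↔ u ∈ A) : Conn G (S ∪ {r}) := by
  intro C hC hne hcl
  have hrC : r ∈ C := by
    by_contra hrC
    have hCS : C ⊆ S := fun u hu => (hC hu).resolve_right fun e => hrC (e ▸ hu)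
    obtain ⟨v, hv, hvA⟩ := h.exists_mem hCS hne fun u hu v hv e => hcl u hu v (.inl hv) e
    exact hrC (hcl v hv r (.inr rfl) (G.adj_symm ((ha v (hCS hv)).2 hvA)))
  refine hC.antisymm ?_
  by_contra hcon
  have hDS : (S ∪ {r}) \ C ⊆ S := fun u hu => hu.1.resolve_right fun e => hu.2 (e ▸ hrC)
  obtain ⟨v, hv, hvA⟩ := h.exists_mem hDS (Set.nonempty_of_not_subset hcon)
    fun u hu v hv e => ⟨.inl hv, fun hvC => hu.2 (hcl v hvC u hu.1 (G.adj_symm e))⟩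
  exact hv.2 (hcl r hrC v hv.1 ((ha v (hDS hv)).2 hvA))

variable {V : Type} {G : SimpleGraph V}

theorem Conn.remove {U : Set V} (h : Conn G U) {β r : V} (hr : r ∈ U) (hβ : β ∈ U) (hne : r ≠ β)
    (hN : ∀ u ∈ U, u ≠ r → G.Adj β u → G.Adj r u) : Conn G (U \ {β}) := by
  intro C hC ⟨c, hc⟩ hcl
  have hl := G.loopless.irrefl β
  have key := h (C ∪ {v | v = β ∧ r ∈ C}) (by clear h; grind) ⟨c, .inl hc⟩ (by
    rintro u (hu | ⟨rfl, hu⟩) v hv huv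
    · have hu' := hC hu
      by_cases hvβ : v = β
      · subst hvβ
        refine .inr ⟨rfl, ?_⟩
        by_cases hur : u = r
        · exact hur ▸ hu
        · exact hcl u hu r ⟨hr, hne⟩ (G.adj_symm (hN u hu'.1 hur (G.adj_symm huv)))
      · exact .inl (hcl u hu v ⟨hv, hvβ⟩ huv)
    · left
      by_cases hvr : v = r
      · exact hvr ▸ hu
      · exact hcl r hu v ⟨hv, by rintro rfl; exact hl huv⟩ (hN v hv hvr huv))
  refine hC.antisymm fun u hu => ?_
  have := (Set.ext_iff.1 key u).2 hu.1
  exact this.resolve_right fun e => hu.2 e.1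

theorem Conn.exists_adj {U : Set V} (h : Conn G U) {C : Set V} (hC : C ⊆ U) (hne : C.Nonempty)
    {r : V} (hr : r ∈ U) (hrC : r ∉ C) : ∃ u ∈ C, ∃ v ∈ U, v ∉ C ∧ G.Adj u v := by
  by_contra! hcon
  refine hrC ?_
  rw [h C hC hne fun u hu v hv huv => by_contra fun hvC => hcon u hu v hv hvC huv]
  exact hr

/-- For each root of `U`, the rest of `U` is described by a term. -/
def Good (G : SimpleGraph V) (U : Set V) : Prop :=
  ∀ r ∈ U, (U \ {r}).Nonempty → ∃ x, Real G x (U \ {r}) {u | u ∈ U ∧ G.Adj r u}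

theorem exists_real_of_split {U : Set V} (hU : Conn G U) (ih : ∀ U' ⊂ U, Conn G U' → Good G U')
    {r : V} {D B F : Set V} (hDU : D ⊆ U) (hr : r ∈ U) (hrD : r ∉ D)
    {β δ : V} (hβ : β ∈ B) (hBD : B ⊆ D) (hδ : δ ∈ D) (hβδ : δ ≠ β)
    {x y : V} (hx : x ∈ F) (hF : F ⊆ U \ D) (hy : y ∈ U) (hyD : y ∉ D) (hxy : y ≠ x)
    (hc : Cross G true D B (U \ D) F) :
    ∃ x, Real G x (U \ {r}) {u | u ∈ U ∧ G.Adj r u} := by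
  have hUD : U ⊆ D ∪ U \ D := by rw [Set.union_sdiff_cancel hDU]
  have hx' := hF hx
  have hβ' := hBD hβ
  have c1 := hU.retract hUD Set.disjoint_sdiff_right hc hx hx' hx'.1
  have c2 := hU.retract (Set.union_comm _ _ ▸ hUD) Set.disjoint_sdiff_right.symm hc.symm hβ hβ'
    (hDU hβ')
  rw [Set.inter_eq_right.2 hDU] at c1
  rw [Set.inter_eq_right.2 Set.sdiff_subset] at c2
  obtain ⟨d, hd⟩ := ih _ (by
    refine (Set.ssubset_iff_of_subset ?_).2 ⟨y, hy, ?_⟩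
    · rintro u (hu | rfl)
      · exact hDU hu
      · exact hx'.1
    · rintro (h | h)
      · exact hyD h
      · exact hxy h) c1 x (.inr rfl) ⟨β, .inl hβ', by rintro rfl; exact hx'.2 hβ'⟩
  obtain ⟨z, hz⟩ := ih _ (by
    refine (Set.ssubset_iff_of_subset ?_).2 ⟨δ, hDU hδ, ?_⟩
    · rintro u (hu | rfl)
      · exact hu.1
      · exact hDU hβ'
    · rintro (h | h)
      · exact h.2 hδ
      · exact hβδ h) c2 r (.inl ⟨hr, hrD⟩) ⟨β, .inr rfl, by rintro rfl; exact hrD hβ'⟩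
  have e1 : (D ∪ {x}) \ {x} = D := by
    have := hx'.2
    clear hd hz ih hc c1 c2; grind
  have e2 : {u | u ∈ D ∪ {x} ∧ G.Adj x u} = B := by
    ext u
    constructor
    · rintro ⟨hu | rfl, hu'⟩
      · exact ((hc u hu x hx').1 (G.adj_symm hu')).2.1
      · exact absurd hu' (G.loopless.irrefl _)
    · exact fun hu => ⟨.inl (hBD hu), G.adj_symm ((hc u (hBD hu) x hx').2 ⟨rfl, hu, hx⟩)⟩
  rw [e1, e2] at hd
  obtain ⟨w, hw⟩ := exists_real_subst hz hd (β := β) ⟨.inr rfl, by rintro rfl; exact hrD hβ'⟩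
    (by
      rintro u hu ⟨hu' | hu', -⟩
      · exact absurd hu hu'.2
      · exact hu') (by
      rintro u hu v ⟨hv | hv, -⟩ hvβ
      · rw [hc u hu v hv, hc β hβ' v hv]
        simp [hβ]
      · exact absurd hv hvβ)
  refine ⟨w, ?_⟩
  convert hw using 1
  · ext u
    have := @hDU u
    have := hDU hβ'
    clear hd hz ih hc c1 c2 hw e1 e2 hUD
    grind
  · ext u
    have h1 := fun hu : u ∈ D => hc u hu r ⟨hr, hrD⟩
    have h2 := hc β hβ' r ⟨hr, hrD⟩
    have h3 := G.adj_comm u r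
    have h4 := G.adj_comm β r
    have := @hDU u
    have := @hBD u
    have := hDU hβ'
    clear hd hz ih hc c1 c2 hw e1 e2 hUD
    grind

/-- The part of a set `I` reachable from `β` inside `I`. -/
def comp (G : SimpleGraph V) (I : Set V) (β : V) : Set V :=
  {v | ∀ C ⊆ I, β ∈ C → (∀ u ∈ C, ∀ v ∈ I, G.Adj u v → v ∈ C) → v ∈ C}

theorem self_mem_comp (I : Set V) (β : V) : β ∈ comp G I β := fun _ _ h _ => h

theorem comp_subset {I : Set V} {β : V} (h : β ∈ I) : comp G I β ⊆ I := fun _ hu =>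
  hu I subset_rfl h fun _ _ _ hv _ => hv

theorem comp_closed {I : Set V} {β u v : V} (hu : u ∈ comp G I β) (hv : v ∈ I) (huv : G.Adj u v) :
    v ∈ comp G I β := fun C hC hβ hcl => hcl u (hu C hC hβ hcl) v hv huv

theorem conn_comp {I : Set V} {β : V} (hβ : β ∈ I) : Conn G (comp G I β) := by
  intro C hC ⟨c, hc⟩ hcl
  refine hC.antisymm ?_
  by_cases hβC : β ∈ C
  · exact fun u hu => hu C (hC.trans (comp_subset hβ)) hβC fun u hu v hv huv =>
      hcl u hu v (comp_closed (hC hu) hv huv) huv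
  · refine absurd hc (hC hc (comp G I β \ C) (Set.sdiff_subset.trans (comp_subset hβ))
      ⟨self_mem_comp I β, hβC⟩ fun u hu v hv huv => ⟨comp_closed hu.1 hv huv, fun hvC => ?_⟩).2
    exact hu.2 (hcl v hvC u hu.1 (G.adj_symm huv))

theorem exists_real_of_adj {U : Set V} (hP : PP G U) (hU : Conn G U)
    (ih : ∀ U' ⊂ U, Conn G U' → Good G U') {r β γ : V} (hr : r ∈ U) (hβ : β ∈ U) (hβr : β ≠ r)
    (hrβ : ¬ G.Adj r β) (hγ : γ ∈ U) (hγr : γ ≠ r) (hrγ : ¬ G.Adj r γ) (hβγ : G.Adj β γ) :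
    ∃ x, Real G x (U \ {r}) {u | u ∈ U ∧ G.Adj r u} := by
  set I : Set V := {u | u ∈ U ∧ u ≠ r ∧ ¬ G.Adj r u} with hI
  have hβI : β ∈ I := ⟨hβ, hβr, hrβ⟩
  have hDI := comp_subset (G := G) hβI
  have hconn := conn_comp (G := G) hβI
  have hβD := self_mem_comp (G := G) I β
  have hγD := comp_closed hβD (v := γ) ⟨hγ, hγr, hrγ⟩ hβγ
  have hclD : ∀ u ∈ comp G I β, ∀ v ∈ U, G.Adj u v → v ∉ comp G I β → G.Adj r v := by
    intro u hu v hv huv hvD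
    by_contra hcon
    refine hvD (comp_closed hu ⟨hv, ?_, hcon⟩ huv)
    rintro rfl
    exact (hDI hu).2.2 (G.adj_symm huv)
  generalize comp G I β = D at *
  have hrD : r ∉ D := fun h => (hDI h).2.1 rfl
  have hDU : D ⊆ U := fun u hu => (hDI hu).1
  obtain ⟨u, hu, x, hx, hxD, hux⟩ := hU.exists_adj hDU ⟨β, hβD⟩ hr hrD
  have hrx := hclD u hu x hx hux hxD
  obtain ⟨δ, hδ, hδu⟩ : ∃ δ ∈ D, δ ≠ u := by
    by_cases h : β = u
    · exact ⟨γ, hγD, by rintro rfl; exact G.loopless.irrefl _ (h ▸ hβγ)⟩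
    · exact ⟨β, hβD, h⟩
  refine exists_real_of_split (D := D) (B := {v | v ∈ D ∧ ∃ y ∈ U, G.Adj r y ∧ G.Adj v y})
    (F := {y | y ∈ U ∧ G.Adj r y ∧ ∃ v ∈ D, G.Adj v y}) (x := x) (y := r) (β := u) (δ := δ)
    hU ih hDU hr hrD ⟨hu, x, hx, hrx, hux⟩ (fun _ h => h.1) hδ hδu ⟨hx, hrx, u, hu, hux⟩ ?_ hr hrD
    ?_ ?_
  · exact fun y hy => ⟨hy.1, fun h => (hDI h).2.2 hy.2.1⟩
  · rintro rfl
    exact G.loopless.irrefl _ hrx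
  · intro p hp y hy
    constructor
    · intro hpy
      have := hclD p hp y hy.1 hpy hy.2
      exact ⟨rfl, ⟨hp, y, hy.1, this, hpy⟩, hy.1, this, p, hp, hpy⟩
    · rintro ⟨-, ⟨-, w, hw, hrw, hpw⟩, -, hry, q, hq, hqy⟩
      have hW : Conn G (insert r (insert y D)) :=
        (hconn.insert hq hqy).insert (.inl rfl) (G.adj_symm hry)
      obtain ⟨z, hz, hpz, hrz⟩ := hP _ (by
        rintro v (rfl | rfl | hv)
        · exact hr
        · exact hy.1
        · exact hDU hv) hW p (.inr (.inr hp)) r (.inl rfl) (hDI hp).2.1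
        (fun h => (hDI hp).2.2 (G.adj_symm h)) w hw hpw hrw
      rcases hz with rfl | rfl | hz
      · exact absurd hrz (G.loopless.irrefl _)
      · exact hpz
      · exact absurd hrz (hDI hz).2.2

theorem exists_real_of_not_adj {U : Set V} (hfin : U.Finite) (hP : PP G U) (hU : Conn G U)
    (ih : ∀ U' ⊂ U, Conn G U' → Good G U') {r v₀ : V} (hr : r ∈ U) (hv : v₀ ∈ U) (hvr : v₀ ≠ r)
    (hrv : ¬ G.Adj r v₀) : ∃ x, Real G x (U \ {r}) {u | u ∈ U ∧ G.Adj r u} := by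
  by_cases hind : ∃ β ∈ U, β ≠ r ∧ ¬ G.Adj r β ∧ ∃ γ ∈ U, γ ≠ r ∧ ¬ G.Adj r γ ∧ G.Adj β γ
  · obtain ⟨β, hβ, hβr, hrβ, γ, hγ, hγr, hrγ, h⟩ := hind
    exact exists_real_of_adj hP hU ih hr hβ hβr hrβ hγ hγr hrγ h
  set I : Set V := {u | u ∈ U ∧ u ≠ r ∧ ¬ G.Adj r u} with hI
  set F : V → Set V := fun β => {y | y ∈ U ∧ G.Adj β y} with hF
  have hFA : ∀ β ∈ I, ∀ y ∈ F β, G.Adj r y := by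
    intro β hβ y hy
    by_contra hcon
    refine hind ⟨β, hβ.1, hβ.2.1, hβ.2.2, y, hy.1, ?_, hcon, hy.2⟩
    rintro rfl
    exact hβ.2.2 (G.adj_symm hy.2)
  have hFne : ∀ β ∈ I, (F β).Nonempty := by
    intro β hβ
    obtain ⟨u, rfl, y, hy, -, huy⟩ := hU.exists_adj (C := {β}) (by simpa using hβ.1) ⟨β, rfl⟩ hr
      hβ.2.1.symm
    exact ⟨y, hy, huy⟩
  have hFfin : ∀ β, (F β).Finite := fun β => hfin.subset fun _ h => h.1
  have hlam : ∀ β ∈ I, ∀ β' ∈ I, ∀ x ∈ F β, x ∈ F β' → ∀ y ∈ F β, y ∉ F β' → F β' ⊆ F β := by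
    intro β hβ β' hβ' x hx hx' y hy hy' y' hy2
    by_contra hy2'
    have c : Conn G (insert β' (insert y' (insert r (insert y {β})))) :=
      ((((Conn.singleton β).insert rfl hy.2).insert (.inl rfl) (G.adj_symm (hFA β hβ y hy))).insert
        (.inl rfl) (hFA β' hβ' y' hy2)).insert (.inl rfl) (G.adj_symm hy2.2)
    obtain ⟨z, hz, hβz, hβz'⟩ := hP _ (by
      rintro u (rfl | rfl | rfl | rfl | rfl)
      exacts [hβ'.1, hy2.1, hr, hy.1, hβ.1]) c β (by simp) β' (by simp)
      (by rintro rfl; exact hy' hy) (fun h => hβ'.2.2 (hFA β hβ β' ⟨hβ'.1, h⟩)) x hx.1 hx.2 hx'.2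
    rcases hz with rfl | rfl | rfl | rfl | rfl
    · exact G.loopless.irrefl _ hβz'
    · exact hy2' ⟨hy2.1, hβz⟩
    · exact hβ.2.2 (G.adj_symm hβz)
    · exact hy' ⟨hy.1, hβz'⟩
    · exact G.loopless.irrefl _ hβz
  obtain ⟨β, hβ, hmax⟩ := Set.exists_max_image I (fun β => (F β).ncard)
    (hfin.subset fun _ h => h.1) ⟨v₀, hv, hvr, hrv⟩
  obtain ⟨y, hy⟩ := hFne β hβ
  by_cases hall : ∃ a ∈ U, G.Adj r a ∧ a ∉ F β
  · obtain ⟨a, ha, hra, haF⟩ := hall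
    have hnr : ∀ u ∈ I, ¬ G.Adj u r := fun u hu h => hu.2.2 (G.adj_symm h)
    refine exists_real_of_split (D := F β ∪ {u | u ∈ I ∧ F u ⊆ F β}) (B := F β)
      (F := {r} ∪ {z | z ∈ U ∧ G.Adj r z ∧ z ∉ F β ∧ ∃ y ∈ F β, G.Adj y z}) (β := y) (δ := β)
      (x := r) (y := a)
      hU ih ?_ hr ?_ hy Set.subset_union_left (.inr ⟨hβ, subset_rfl⟩) ?_ (.inl rfl) ?_ ha ?_ ?_ ?_
    · rintro u (hu | hu)
      exacts [hu.1, hu.1.1]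
    · rintro (h | h)
      · exact hnr β hβ h.2
      · exact h.1.2.1 rfl
    · rintro rfl
      exact G.loopless.irrefl _ hy.2
    · rintro z (rfl | ⟨hz, hrz, hzF, -⟩)
      · refine ⟨hr, ?_⟩
        rintro (h | h)
        · exact hnr β hβ h.2
        · exact h.1.2.1 rfl
      · refine ⟨hz, ?_⟩
        rintro (h | h)
        · exact hzF h
        · exact h.1.2.2 hrz
    · rintro (h | h)
      · exact haF h
      · exact h.1.2.2 hra
    · rintro rfl
      exact G.loopless.irrefl _ hra
    · rintro u hu v ⟨hv, hvD⟩
      have hvF : v ∉ F β := fun h => hvD (.inl h)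
      rcases hu with hu | ⟨hu, hu'⟩
      · by_cases hvr : v = r
        · subst hvr
          simp only [hu, true_and, Set.mem_union, Set.mem_singleton_iff, true_or, iff_true]
          exact G.adj_symm (hFA β hβ u hu)
        by_cases hrv : G.Adj r v
        · constructor
          · exact fun h => ⟨rfl, hu, .inr ⟨hv, hrv, hvF, u, hu, h⟩⟩
          · rintro ⟨-, -, h | ⟨-, -, -, y', hy', hyv⟩⟩
            · exact absurd h hvr
            have c : Conn G (insert β (insert u (insert r {v}))) :=
              (((Conn.singleton v).insert rfl (G.adj_symm hrv)).insert (.inl rfl)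
                (hFA β hβ u hu)).insert (.inl rfl) (G.adj_symm hu.2)
            obtain ⟨z, hz, hβz, hvz⟩ := hP _ (by
              rintro w (rfl | rfl | rfl | rfl)
              exacts [hβ.1, hu.1, hr, hv]) c β (by simp) v (by simp)
              (by rintro rfl; exact hβ.2.2 hrv) (fun h => hvF ⟨hv, h⟩) y' hy'.1 hy'.2
              (G.adj_symm hyv)
            rcases hz with rfl | rfl | rfl | rfl
            · exact absurd hβz (G.loopless.irrefl _)
            · exact G.adj_symm hvz
            · exact absurd hβz (hnr β hβ)
            · exact absurd hvz (G.loopless.irrefl _)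
        · have hvI : v ∈ I := ⟨hv, hvr, hrv⟩
          constructor
          · intro huv
            have hsub : ¬ F v ⊆ F β := fun h => hvD (.inr ⟨hvI, h⟩)
            obtain ⟨y', hy', hy2⟩ := Set.not_subset.1 hsub
            have hss := hlam v hvI β hβ u ⟨hu.1, G.adj_symm huv⟩ hu y' hy' hy2
            have := Set.ncard_lt_ncard (hss.ssubset_of_not_subset hsub) (hFfin v)
            exact absurd (hmax v hvI) (by simpa using this)
          · rintro ⟨-, -, h | h⟩
            · exact absurd h hvr
            · exact absurd h.2.1 hrv
      · constructor
        · exact fun h => absurd (hu' ⟨hv, h⟩) hvF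
        · exact fun h => absurd (hFA β hβ u h.2.1) hu.2.2
  · push Not at hall
    obtain ⟨x, hx⟩ := ih (U \ {β}) (by
      refine (Set.ssubset_iff_of_subset Set.sdiff_subset).2 ⟨β, hβ.1, by simp⟩)
      (hU.remove hr hβ.1 hβ.2.1.symm fun u hu _ h => hFA β hβ u ⟨hu, h⟩) r ⟨hr, hβ.2.1.symm⟩
      ⟨y, ⟨hy.1, by rintro rfl; exact G.loopless.irrefl _ hy.2⟩,
        by rintro rfl; exact hβ.2.2 (G.adj_symm hy.2)⟩
    refine ⟨att x leaf, real_att.2 ⟨(U \ {β}) \ {r}, {β}, {β}, ?_, ?_, ?_, ?_, ⟨β, rfl, rfl⟩⟩⟩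
    rotate_left 3
    · convert hx using 1
      ext u
      have := hβ.2.2
      clear hx ih hmax hlam
      grind
    · ext u
      have := hβ.1
      have := hβ.2.1
      clear hx ih hmax hlam
      grind
    · simp
    · rintro u hu v rfl
      have h1 := hall u hu.1.1
      have h2 := hFA v hβ u
      have := G.adj_comm u v
      clear hx ih hmax hlam
      grind

theorem exists_real_of_pp {U : Set V} (hfin : U.Finite) (hP : PP G U) (hU : Conn G U) :
    Good G U := by
  induction hn : U.ncard using Nat.strong_induction_on generalizing U with
  | _ n ihn =>
  have ih : ∀ U' ⊂ U, Conn G U' → Good G U' := fun U' h hU' =>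
    ihn U'.ncard (hn ▸ Set.ncard_lt_ncard h hfin) (hfin.subset h.1) (hP.mono h.1) hU' rfl
  clear ihn hn
  intro r hr hne
  by_cases h1 : ∃ v ∈ U, v ≠ r ∧ ¬ G.Adj r v
  · obtain ⟨v, hv, hvr, hrv⟩ := h1
    exact exists_real_of_not_adj hfin hP hU ih hr hv hvr hrv
  by_cases h2 : ∃ v ∈ U, v ≠ r ∧ ∃ w ∈ U, w ≠ v ∧ ¬ G.Adj v w
  · obtain ⟨v, hv, hvr, w, hw, hwv, hvw⟩ := h2
    obtain ⟨x, hx⟩ := exists_real_of_not_adj hfin hP hU ih hv hw hwv hvw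
    obtain ⟨y, hy, -⟩ := exists_real_root (a := leaf) (S₁ := {v}) (A := {v}) ⟨v, rfl, rfl⟩ hx
      (by simp) (by
        rintro u rfl w hw
        have := hw.1
        simp [this]) (v := r) ⟨hr, hvr.symm⟩
    refine ⟨y, ?_⟩
    have : {v} ∪ U \ {v} = U := by
      rw [Set.union_sdiff_cancel]; simpa using hv
    rwa [this] at hy
  · push Not at h1 h2
    obtain ⟨v, hv, hvr⟩ := hne
    have hvr : v ≠ r := hvr
    by_cases h3 : ((U \ {v}) \ {r}).Nonempty
    · obtain ⟨x, hx⟩ := ih (U \ {v})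
        ((Set.ssubset_iff_of_subset Set.sdiff_subset).2 ⟨v, hv, by simp⟩)
        (hU.remove hr hv hvr.symm fun u hu hur _ => h1 u hu hur) r ⟨hr, hvr.symm⟩ h3
      refine ⟨op true leaf x, real_op.2 ⟨{v}, {v}, _, _, ?_, ?_, ?_, ?_, ⟨v, rfl, rfl⟩, hx⟩⟩
      · clear hx ih; grind
      · ext u
        have := h1 v hv hvr
        clear hx ih; grind
      · simp
      · rintro u rfl w hw
        have e1 := h1 w hw.1.1 hw.2
        have e2 := h2 u hv hvr w hw.1.1 hw.1.2
        have := hw.1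
        simp_all
    · refine ⟨leaf, v, ?_, ?_⟩
      · rw [Set.not_nonempty_iff_eq_empty] at h3
        ext u
        have := Set.ext_iff.1 h3 u
        clear ih; grind
      · rw [Set.not_nonempty_iff_eq_empty] at h3
        ext u
        have := Set.ext_iff.1 h3 u
        have := h1 v hv hvr
        have := G.loopless.irrefl r
        clear ih; grind

variable {V : Type} {G : SimpleGraph V}

theorem induce_connected_iff {W : Set V} :
    (G.induce W).Connected ↔ W.Nonempty ∧ Conn G W := by
  constructor
  · intro h
    obtain ⟨w⟩ := h.nonempty
    refine ⟨⟨w, w.2⟩, fun C hC ⟨c, hc⟩ hcl => hC.antisymm fun v hv => ?_⟩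
    obtain ⟨p⟩ := h.preconnected ⟨c, hC hc⟩ ⟨v, hv⟩
    have key : ∀ {a b : W}, (G.induce W).Walk a b → a.1 ∈ C → b.1 ∈ C := by
      intro a b p
      induction p with
      | nil => exact id
      | cons h p ih => exact fun ha => ih (hcl _ ha _ (Subtype.prop _) h)
    exact key p hc
  · rintro ⟨⟨w, hw⟩, h⟩
    have key : {v | ∃ hv : v ∈ W, (G.induce W).Reachable ⟨w, hw⟩ ⟨v, hv⟩} = W := by
      refine h _ (fun v hv => hv.1) ⟨w, hw, .refl _⟩ ?_
      rintro u ⟨hu, hr⟩ v hv huv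
      exact ⟨hv, hr.trans (SimpleGraph.Adj.reachable (by exact huv))⟩
    refine (SimpleGraph.connected_iff_exists_forall_reachable _).2 ⟨⟨w, hw⟩, fun ⟨v, hv⟩ => ?_⟩
    exact ((Set.ext_iff.1 key v).2 hv).2

theorem connected_iff : G.Connected ↔ Nonempty V ∧ Conn G Set.univ := by
  rw [Set.nonempty_iff_univ_nonempty, ← induce_connected_iff]
  exact (SimpleGraph.induceUnivIso G).connected_iff.symm

theorem pp_of_distanceHereditary (h : DistanceHereditary G) : PP G Set.univ := by
  intro W _ hW p hp q hq hpq hn w _ hpw hqw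
  have hc := induce_connected_iff.2 ⟨⟨p, hp⟩, hW⟩
  have hd := h W hc ⟨p, hp⟩ ⟨q, hq⟩
  have h2 : G.dist p q ≤ 2 :=
    SimpleGraph.dist_le (.cons hpw (.cons (G.adj_symm hqw) .nil))
  obtain ⟨P, hP⟩ := hc.exists_walk_length_eq_dist ⟨p, hp⟩ ⟨q, hq⟩
  rw [hd] at hP
  rw [← hP] at h2
  match P, h2 with
  | .nil, _ => exact absurd rfl hpq
  | .cons h .nil, _ => exact absurd h hn
  | .cons (v := z) h (.cons h' .nil), _ => exact ⟨z, z.2, h, G.adj_symm h'⟩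
  | .cons _ (.cons _ (.cons _ _)), h2 => simp at h2

/-- There is a walk of length at most `n` whose vertices after the first one are in `W`. -/
def Wk (G : SimpleGraph V) (W : Set V) : ℕ → V → V → Prop
  | 0, u, v => u = v
  | n + 1, u, v => u = v ∨ ∃ z ∈ W, G.Adj u z ∧ Wk G W n z v

theorem Wk.succ {W : Set V} {n : ℕ} {u v : V} (h : Wk G W n u v) : Wk G W (n + 1) u v := by
  induction n generalizing u with
  | zero => exact .inl h
  | succ n ih =>
    rcases h with h | ⟨z, hz, huz, h⟩
    · exact .inl h
    · exact .inr ⟨z, hz, huz, ih h⟩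

theorem Wk.of_insert (hP : PP G Set.univ) {W : Set V} (hW : Conn G W) {w : V} {n : ℕ} {u v : V}
    (hu : u ∈ W) (hv : v ∈ W) (h : Wk G (insert w W) n u v) : Wk G W n u v := by
  induction n using Nat.strong_induction_on generalizing u with
  | _ n ih =>
  match n, h with
  | 0, h => exact h
  | n + 1, .inl h => exact .inl h
  | n + 1, .inr ⟨z, hz, huz, h⟩ =>
    by_cases hzW : z ∈ W
    · exact .inr ⟨z, hzW, huz, ih n (by omega) hzW h⟩
    obtain rfl : z = w := hz.resolve_right hzW
    match n, h with
    | 0, h => exact absurd (h ▸ hv) hzW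
    | n + 1, .inl h => exact absurd (h ▸ hv) hzW
    | n + 1, .inr ⟨y, hy, hzy, h⟩ =>
      have hyW : y ∈ W := hy.resolve_left fun e => G.loopless.irrefl _ (e ▸ hzy)
      have hw := ih n (by omega) hyW h
      by_cases huy : u = y
      · exact huy ▸ hw.succ.succ
      by_cases hadj : G.Adj u y
      · exact .inr ⟨y, hyW, hadj, hw.succ⟩
      obtain ⟨x, hx, hux, hyx⟩ := hP W (Set.subset_univ _) hW u hu y hyW huy hadj z trivial huz
        (G.adj_symm hzy)
      exact .inr ⟨x, hx, hux, .inr ⟨y, hyW, G.adj_symm hyx, hw⟩⟩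

theorem Wk.of_univ [Finite V] (hG : Conn G Set.univ) (hP : PP G Set.univ) {W : Set V}
    (hW : Conn G W) {n : ℕ} {u v : V} (hu : u ∈ W) (hv : v ∈ W) (h : Wk G Set.univ n u v) :
    Wk G W n u v := by
  induction hk : Wᶜ.ncard generalizing W with
  | zero =>
    rw [Set.ncard_eq_zero, Set.compl_empty_iff] at hk
    rwa [hk]
  | succ k ih =>
    obtain ⟨w, hw⟩ : Wᶜ.Nonempty := by
      rw [← Set.ncard_pos]; omega
    obtain ⟨a, ha, w, -, hw, haw⟩ := hG.exists_adj (Set.subset_univ W) ⟨u, hu⟩ trivial hw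
    refine Wk.of_insert (w := w) hP hW hu hv
      (ih (hW.insert ha haw) (.inr hu) (.inr hv) ?_)
    have : (insert w W)ᶜ = Wᶜ \ {w} := by
      ext x; simp [not_or, and_comm]
    rw [this, Set.ncard_sdiff_singleton_of_mem hw, hk]
    rfl

theorem Wk.of_walk {u v : V} (p : G.Walk u v) : Wk G Set.univ p.length u v := by
  induction p with
  | nil => rfl
  | cons h p ih => exact .inr ⟨_, trivial, h, ih⟩

theorem Wk.exists_walk {W : Set V} {n : ℕ} {u v : V} (hu : u ∈ W) (hv : v ∈ W)
    (h : Wk G W n u v) : ∃ p : (G.induce W).Walk ⟨u, hu⟩ ⟨v, hv⟩, p.length ≤ n := by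
  induction n generalizing u with
  | zero =>
    cases h
    exact ⟨.nil, le_rfl⟩
  | succ n ih =>
    rcases h with rfl | ⟨z, hz, huz, h⟩
    · exact ⟨.nil, by simp⟩
    · obtain ⟨p, hp⟩ := ih hz h
      have huz' : (G.induce W).Adj ⟨u, hu⟩ ⟨z, hz⟩ := huz
      exact ⟨.cons huz' p, Nat.succ_le_succ hp⟩

theorem distanceHereditary_of_pp [Finite V] (hG : Conn G Set.univ) (hP : PP G Set.univ) :
    DistanceHereditary G := by
  intro W hW u v
  obtain ⟨-, hC⟩ := induce_connected_iff.1 hW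
  have hG' : G.Connected := connected_iff.2 ⟨⟨u.1⟩, hG⟩
  apply le_antisymm
  · obtain ⟨p, hp⟩ := hG'.exists_walk_length_eq_dist u.1 v.1
    obtain ⟨q, hq⟩ := ((Wk.of_walk p).of_univ hG hP hC u.2 v.2).exists_walk u.2 v.2
    exact (SimpleGraph.dist_le q).trans (hq.trans hp.le)
  · obtain ⟨p, hp⟩ := hW.exists_walk_length_eq_dist u v
    rw [← hp, ← SimpleGraph.Walk.length_map (SimpleGraph.Embedding.induce W).toHom p]
    exact SimpleGraph.dist_le _

/-- The connected distance-hereditary graphs are those in which the complement of a vertex is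
described by a term. -/
theorem connected_distanceHereditary_iff [Finite V] [Nontrivial V] (r : V) :
    G.Connected ∧ DistanceHereditary G ↔ ∃ x, Real G x {r}ᶜ {u | G.Adj r u} := by
  constructor
  · rintro ⟨h1, h2⟩
    obtain ⟨v, hv⟩ := exists_ne r
    have := exists_real_of_pp Set.finite_univ (pp_of_distanceHereditary h2) (connected_iff.1 h1).2
      r trivial ⟨v, trivial, hv⟩
    simpa [Set.compl_eq_univ_sdiff] using this
  · rintro ⟨x, hx⟩
    have e : ({r}ᶜ ∪ {r} : Set V) = Set.univ := Set.compl_union_self _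
    have h1 := hx.conn (r := r) fun _ _ => Iff.rfl
    have h2 := hx.pp (r := r) (by simp) fun _ _ => Iff.rfl
    rw [e] at h1 h2
    exact ⟨connected_iff.2 ⟨⟨r⟩, h1⟩, distanceHereditary_of_pp h1 h2⟩

variable {V W : Type} {G : SimpleGraph V} {H : SimpleGraph W}

theorem real_jn {f : Bool} {a b : R} {S A : Set V} : Real G (jn f a b) S A ↔
    ∃ S₁ A₁ S₂ A₂, S = S₁ ∪ S₂ ∧ A = A₁ ∪ {u | f = true ∧ u ∈ A₂} ∧ Disjoint S₁ S₂ ∧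
      Cross G true S₁ A₁ S₂ A₂ ∧ Real G a S₁ A₁ ∧ Real G b S₂ A₂ := by
  cases f
  · rw [jn, real_att]
    simp only [Bool.false_eq_true, false_and, Set.ofPred_false, Set.union_empty]
    constructor
    · rintro ⟨S₁, S₂, B, h⟩
      exact ⟨S₁, A, S₂, B, h.1, rfl, h.2⟩
    · rintro ⟨S₁, A₁, S₂, A₂, h1, rfl, h⟩
      exact ⟨S₁, S₂, A₂, h1, h⟩
  · rw [jn, real_op]
    simp

/-- `G` is obtained by joining the marked graphs described by `a` and `b`. -/
def Glues (G : SimpleGraph V) (a b : R) : Prop :=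
  ∃ S A T B, S ∪ T = Set.univ ∧ Disjoint S T ∧ Cross G true S A T B ∧ Real G a S A ∧ Real G b T B

theorem Glues.symm {a b : R} (h : Glues G a b) : Glues G b a := by
  obtain ⟨S, A, T, B, h1, h2, h3, h4, h5⟩ := h
  exact ⟨T, B, S, A, Set.union_comm S T ▸ h1, h2.symm, h3.symm, h5, h4⟩

theorem Glues.of_jn {f : Bool} {a b c : R} (h : Glues G (jn f a b) c) : Glues G a (op f b c) := by
  obtain ⟨S, A, T, C, hu, hd, hc, h1, h2⟩ := h
  obtain ⟨S₁, A₁, S₂, A₂, rfl, rfl, hd', hc', k1, k2⟩ := real_jn.1 h1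
  have s1 := k1.subset
  have s2 := k2.subset
  have s3 := h2.subset
  rw [Set.disjoint_union_left] at hd
  have d := fun u (h : u ∈ S₁) => Set.disjoint_left.1 hd' h
  refine ⟨S₁, A₁, S₂ ∪ T, A₂ ∪ C, by rw [← Set.union_assoc, hu], ?_, ?_, k1,
    real_op.2 ⟨S₂, A₂, T, C, rfl, rfl, hd.2, ?_, k2, h2⟩⟩
  · rw [Set.disjoint_union_right]; exact ⟨hd', hd.1⟩
  · rintro u hu v (hv | hv)
    · have := hc' u hu v hv
      have := Set.disjoint_left.1 hd.2 hv
      have := @s3 v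
      clear h1 h2 k1 k2 hc hc'
      grind
    · have := hc u (.inl hu) v hv
      have := Set.disjoint_right.1 hd.2 hv
      clear h1 h2 k1 k2 hc hc'
      grind
  · intro u hu v hv
    have := hc u (.inr hu) v hv
    have := @s1 u
    clear h1 h2 k1 k2 hc hc'
    grind

theorem Glues.to_jn {f : Bool} {a b c : R} (h : Glues G a (op f b c)) : Glues G (jn f a b) c := by
  obtain ⟨S₁, A₁, T', C', hu, hd, hc, k1, h1⟩ := h
  obtain ⟨S₂, A₂, T, C, rfl, rfl, hd', hc', k2, h2⟩ := real_op.1 h1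
  have s1 := k1.subset
  have s2 := k2.subset
  have s3 := h2.subset
  rw [Set.disjoint_union_right] at hd
  have d := fun u (h : u ∈ S₁) => Set.disjoint_left.1 hd.1 h
  have d' := fun u (h : u ∈ S₂) => Set.disjoint_left.1 hd' h
  refine ⟨S₁ ∪ S₂, A₁ ∪ {u | f = true ∧ u ∈ A₂}, T, C, by rw [Set.union_assoc, hu], ?_, ?_,
    real_jn.2 ⟨S₁, A₁, S₂, A₂, rfl, rfl, hd.1, ?_, k1, k2⟩, h2⟩
  · rw [Set.disjoint_union_left]; exact ⟨hd.2, hd'⟩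
  · rintro u (hu | hu) v hv
    · have := hc u hu v (.inr hv)
      have := @s2 v
      have := @s2 u
      clear h1 h2 k1 k2 hc hc'
      grind
    · have := hc' u hu v hv
      have := @s1 u
      clear h1 h2 k1 k2 hc hc'
      grind
  · intro u hu v hv
    have := hc u hu v (.inl hv)
    have := @s3 v
    clear h1 h2 k1 k2 hc hc'
    grind

theorem R.Rel.glues {p q : R × R} (h : Rel p q) : Glues G p.1 p.2 ↔ Glues G q.1 q.2 := by
  induction h with
  | refl => rfl
  | symm _ ih => exact ih.symm
  | trans _ _ ih ih' => exact ih.trans ih'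
  | swap a b => exact ⟨Glues.symm, Glues.symm⟩
  | jn f a b c => exact ⟨Glues.of_jn, Glues.to_jn⟩

theorem Glues.nonempty_iso {a b : R} (h : Glues G a b) (h' : Glues H a b) : Nonempty (G ≃g H) := by
  obtain ⟨S, A, T, B, h1, h2, h3, h4, h5⟩ := h
  obtain ⟨S', A', T', B', h1', h2', h3', h4', h5'⟩ := h'
  obtain ⟨f, hf⟩ := h4.exists_mIso h4'
  obtain ⟨g, hg⟩ := h5.exists_mIso h5'
  obtain ⟨e, he, -⟩ := hf.glue hg h2 h2' h3 h3' h4.subset h5.subset h4'.subset h5'.subset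
  rw [h1, h1'] at he
  have hb := Set.bijOn_univ.1 he.bij
  exact ⟨⟨Equiv.ofBijective e hb, he.adj _ trivial _ trivial⟩⟩

/-- The normal form of the graph `G` is `N`. -/
def Has (G : SimpleGraph V) (N : NF) : Prop :=
  ∃ r x, Real G x {r}ᶜ {u | G.Adj r u} ∧ cen leaf x = N

theorem cross_root {r : V} : Cross G true {r} {r} {r}ᶜ {u | G.Adj r u} := by
  rintro u rfl v _
  simp

theorem glues_root {x : R} {r : V} (h : Real G x {r}ᶜ {u | G.Adj r u}) : Glues G leaf x :=
  ⟨{r}, {r}, _, _, by simp, by simp, cross_root, ⟨r, rfl, rfl⟩, h⟩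

theorem Glues.has {a b : R} (h : Glues G a b) : Has G (cen a b) := by
  obtain ⟨S, A, T, B, h1, h2, h3, h4, h5⟩ := h
  obtain ⟨r, hr⟩ := h5.nonempty
  obtain ⟨y, hy, hrel⟩ := exists_real_root h4 h5 h2 h3 (h5.subset hr)
  rw [h1] at hy
  refine ⟨r, y, ?_, hrel.cen_eq.symm⟩
  simpa [Set.compl_eq_univ_sdiff] using hy

theorem Has.unique {N N' : NF} (h : Has G N) (h' : Has G N') : N = N' := by
  obtain ⟨r, x, hx, rfl⟩ := h
  obtain ⟨s, y, hy, rfl⟩ := h'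
  by_cases hrs : s = r
  · subst hrs
    rw [hx.unique hy]
  · obtain ⟨z, hz, hrel⟩ := exists_real_root (a := leaf) (S₁ := {r}) (A := {r}) ⟨r, rfl, rfl⟩ hx
      (by simp) cross_root (v := s) hrs
    have e : z = y := by
      refine Real.unique (G := G) (S := {s}ᶜ) (A := {u | G.Adj s u}) ?_ hy
      simpa [Set.compl_eq_univ_sdiff] using hz
    rw [← e]
    exact hrel.cen_eq

theorem Has.map {N : NF} (h : Has G N) (e : G ≃g H) : Has H N := by
  obtain ⟨r, x, hx, hN⟩ := h
  refine ⟨e r, x, ?_, hN⟩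
  have h2 := hx.map (H := H) (f := e) (A' := {u | H.Adj (e r) u}) e.injective.injOn
    (fun _ _ _ _ => e.map_adj_iff) (by
      ext u
      obtain ⟨v, rfl⟩ := e.surjective u
      simp [e.map_adj_iff])
  convert h2 using 1
  ext u
  obtain ⟨v, rfl⟩ := e.surjective u
  simp

theorem Has.nonempty_iso {N : NF} (h : Has G N) (h' : Has H N) : Nonempty (G ≃g H) := by
  obtain ⟨r, x, hx, rfl⟩ := h
  obtain ⟨s, y, hy, hN⟩ := h'
  exact (glues_root hx).nonempty_iso ((rel_of_cen_eq hN).glues.1 (glues_root hy))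

theorem Has.valid [Finite V] {N : NF} (h : Has G N) : N.Valid (Nat.card V) := by
  obtain ⟨r, x, hx, rfl⟩ := h
  have h1 := valid_cen leaf x
  have h2 := Set.ncard_add_ncard_compl {r}
  rw [hx.ncard, Set.ncard_singleton] at h2
  rwa [size_leaf, h2] at h1

theorem NF.Valid.exists_has {n : ℕ} (hn : 2 ≤ n) {N : NF} (hN : N.Valid n) :
    ∃ G : SimpleGraph (Fin n), Has G N := by
  obtain ⟨a, b, hab, rfl⟩ := exists_cen_eq hn hN
  obtain ⟨V, G, A, h1⟩ := exists_real a
  obtain ⟨W, H, B, h2⟩ := exists_real b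
  have h : Has (glueG true G H A B) (cen a b) :=
    Glues.has ⟨_, _, _, _, univ_sum.symm, disjoint_inl_inr, cross_glueG _ _ _ _ _, h1.inl true B,
      h2.inr true A⟩
  have f1 : Finite V := Set.finite_univ_iff.1 h1.finite
  have f2 : Finite W := Set.finite_univ_iff.1 h2.finite
  have hcard : Nat.card (V ⊕ W) = n := by
    rw [Nat.card_sum, ← Set.ncard_univ, ← Set.ncard_univ, h1.ncard, h2.ncard, hab]
  let e := Finite.equivFinOfCardEq hcard
  exact ⟨_, h.map (SimpleGraph.Iso.map e (glueG true G H A B))⟩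

theorem exists_has_iff [Finite V] [Nontrivial V] :
    (∃ N, Has G N) ↔ G.Connected ∧ DistanceHereditary G := by
  constructor
  · rintro ⟨N, r, x, hx, -⟩
    exact (connected_distanceHereditary_iff r).2 ⟨x, hx⟩
  · intro h
    obtain ⟨r⟩ : Nonempty V := inferInstance
    obtain ⟨x, hx⟩ := (connected_distanceHereditary_iff r).1 h
    exact ⟨_, r, x, hx, rfl⟩

theorem numConnDH_eq {n : ℕ} (hn : 2 ≤ n) : numConnDH n = Nat.card {N : NF // N.Valid n} := by
  have : Nontrivial (Fin n) := Fin.nontrivial_iff_two_le.2 hn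
  have hH : ∀ G : {G : SimpleGraph (Fin n) // G.Connected ∧ DistanceHereditary G},
    ∃ N : NF, Has G.1 N := fun G => exists_has_iff.2 G.2
  choose F hF using hH
  have hV : ∀ G, (F G).Valid n := fun G => by simpa using (hF G).valid
  refine Nat.card_congr (Equiv.ofBijective
    (Quot.lift (fun G => ⟨F G, hV G⟩) ?_) ⟨?_, ?_⟩)
  · rintro G G' ⟨e⟩
    exact Subtype.ext (((hF G).map e).unique (hF G'))
  · rintro ⟨G⟩ ⟨G'⟩ h
    refine Quot.sound (Has.nonempty_iso (hF G) (N := F G) ?_)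
    have : F G = F G' := congrArg Subtype.val h
    exact this ▸ hF G'
  · rintro ⟨N, hN⟩
    obtain ⟨G, hG⟩ := hN.exists_has hn
    exact ⟨Quot.mk _ ⟨G, exists_has_iff.1 ⟨N, hG⟩⟩, Subtype.ext ((hF _).unique hG)⟩

theorem numConnDH_one : numConnDH 1 = 1 := by
  have h1 : (⊥ : SimpleGraph (Fin 1)).Connected := SimpleGraph.Connected.mk
    (fun u v => by rw [Subsingleton.elim u v])
  have : ∀ G : SimpleGraph (Fin 1), G = ⊥ := fun G => by
    ext u v
    simp [Subsingleton.elim u v]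
  refine Nat.card_eq_one_iff_unique.2 ⟨⟨?_⟩, ⟨Quot.mk _ ⟨⊥, h1, fun S _ u v => ?_⟩⟩⟩
  · rintro ⟨G, hG⟩ ⟨G', hG'⟩
    obtain rfl := this G
    obtain rfl := this G'
    rfl
  · have : u = v := Subtype.ext (Subsingleton.elim _ _)
    rw [this]
    simp

section Generic

variable {ι α β γ : Type*}

theorem finite_biUnion_image2 (s : Finset ι) (A : ι → Set α) (B : ι → Set β) (g : α → β → γ)
    (hA : ∀ i ∈ s, (A i).Finite) (hB : ∀ i ∈ s, (B i).Finite) :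
    {c | ∃ i ∈ s, ∃ a ∈ A i, ∃ b ∈ B i, g a b = c}.Finite := by
  refine (s.finite_toSet.biUnion fun i hi => (hA i hi).image2 g (hB i hi)).subset ?_
  rintro c ⟨i, hi, a, ha, b, hb, rfl⟩
  exact Set.mem_biUnion hi ⟨a, ha, b, hb, rfl⟩

theorem ncard_biUnion_image2 (s : Finset ι) (A : ι → Set α) (B : ι → Set β) (g : α → β → γ)
    (hA : ∀ i ∈ s, (A i).Finite) (hB : ∀ i ∈ s, (B i).Finite)
    (hinj : ∀ i ∈ s, ∀ j ∈ s, ∀ a ∈ A i, ∀ b ∈ B i, ∀ a' ∈ A j, ∀ b' ∈ B j,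
      g a b = g a' b' → i = j ∧ a = a' ∧ b = b') :
    {c | ∃ i ∈ s, ∃ a ∈ A i, ∃ b ∈ B i, g a b = c}.ncard =
      ∑ i ∈ s, (A i).ncard * (B i).ncard := by
  classical
  induction s using Finset.induction_on with
  | empty => simp
  | insert i s hi ih =>
    have hA' := fun j hj => hA j (Finset.mem_insert_of_mem hj)
    have hB' := fun j hj => hB j (Finset.mem_insert_of_mem hj)
    have hi' := Finset.mem_insert_self i s
    rw [Finset.sum_insert hi, ← ih hA' hB' fun j hj k hk =>
      hinj j (Finset.mem_insert_of_mem hj) k (Finset.mem_insert_of_mem hk)]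
    have e : {c | ∃ j ∈ insert i s, ∃ a ∈ A j, ∃ b ∈ B j, g a b = c} =
        (fun p : α × β => g p.1 p.2) '' (A i ×ˢ B i) ∪
          {c | ∃ j ∈ s, ∃ a ∈ A j, ∃ b ∈ B j, g a b = c} := by
      ext c
      constructor
      · rintro ⟨j, hj, a, ha, b, hb, rfl⟩
        rcases Finset.mem_insert.1 hj with rfl | hj
        · exact .inl ⟨(a, b), ⟨ha, hb⟩, rfl⟩
        · exact .inr ⟨j, hj, a, ha, b, hb, rfl⟩
      · rintro (⟨⟨a, b⟩, ⟨ha, hb⟩, rfl⟩ | ⟨j, hj, h⟩)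
        · exact ⟨i, hi', a, ha, b, hb, rfl⟩
        · exact ⟨j, Finset.mem_insert_of_mem hj, h⟩
    rw [e, Set.ncard_union_eq ?_ (((hA i hi').prod (hB i hi')).image _)
      (finite_biUnion_image2 s A B g hA' hB'), Set.InjOn.ncard_image, Set.ncard_prod]
    · rintro ⟨a, b⟩ ⟨ha, hb⟩ ⟨a', b'⟩ ⟨ha', hb'⟩ h
      have := hinj i hi' i hi' a ha b hb a' ha' b' hb' h
      exact Prod.ext this.2.1 this.2.2
    · rw [Set.disjoint_left]
      rintro _ ⟨⟨a, b⟩, ⟨ha, hb⟩, rfl⟩ ⟨j, hj, a', ha', b', hb', h⟩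
      have := hinj j (Finset.mem_insert_of_mem hj) i hi' a' ha' b' hb' a ha b hb h
      exact hi (this.1 ▸ hj)

/-- The multisets of cardinality `j` with elements in `Y`. -/
def multisetsOf (Y : Set α) (j : ℕ) : Set (Multiset α) := {M | (∀ x ∈ M, x ∈ Y) ∧ M.card = j}

theorem multisetsOf_eq_range (Y : Set α) (j : ℕ) :
    multisetsOf Y j = Set.range (fun m : Sym Y j => (m : Multiset Y).map Subtype.val) := by
  ext M
  constructor
  · rintro ⟨h, rfl⟩
    exact ⟨⟨M.attach.map fun x => ⟨x.1, h x.1 x.2⟩, by simp⟩, by simp⟩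
  · rintro ⟨m, rfl⟩
    refine ⟨fun x hx => ?_, by simp⟩
    obtain ⟨y, -, rfl⟩ := Multiset.mem_map.1 hx
    exact y.2

theorem finite_multisetsOf {Y : Set α} (hY : Y.Finite) (j : ℕ) : (multisetsOf Y j).Finite := by
  classical
  have := hY.fintype
  rw [multisetsOf_eq_range]
  exact Set.finite_range _

theorem ncard_multisetsOf {Y : Set α} (hY : Y.Finite) (j : ℕ) :
    (multisetsOf Y j).ncard = Nat.multichoose Y.ncard j := by
  classical
  have := hY.fintype
  rw [multisetsOf_eq_range, ← Nat.card_coe_set_eq, Nat.card_range_of_injective,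
    Nat.card_eq_fintype_card, Sym.card_sym_eq_multichoose, ← Nat.card_eq_fintype_card,
    Nat.card_coe_set_eq]
  intro m m' h
  exact Sym.coe_injective (Multiset.map_injective Subtype.val_injective h)

end Generic

theorem finite_size_le (n : ℕ) : {x : R | size x ≤ n}.Finite := by
  induction n with
  | zero =>
    refine Set.finite_empty.subset fun x hx => ?_
    have := size_pos x
    simp only [Set.mem_ofPred_eq] at hx
    omega
  | succ n ih =>
    refine (((Set.finite_singleton leaf).union (ih.image2 (op false) ih)).union
      ((ih.image2 (op true) ih).union (ih.image2 att ih))).subset fun x hx => ?_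
    induction x using induction with
    | hl => exact .inl (.inl rfl)
    | ho f a b _ _ =>
      have h1 := size_pos a
      have h2 := size_pos b
      simp only [Set.mem_ofPred_eq, size_op] at hx
      have ha : size a ≤ n := by omega
      have hb : size b ≤ n := by omega
      cases f
      · exact .inl (.inr ⟨a, ha, b, hb, rfl⟩)
      · exact .inr (.inl ⟨a, ha, b, hb, rfl⟩)
    | ha a b _ _ =>
      have h1 := size_pos a
      have h2 := size_pos b
      simp only [Set.mem_ofPred_eq, size_att] at hx
      have ha : size a ≤ n := by omega
      have hb : size b ≤ n := by omega
      exact .inr (.inr ⟨a, ha, b, hb, rfl⟩)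

/-- The elements of `R` of size `n` with the property `P`. -/
def sized (P : R → Prop) (n : ℕ) : Set R := {x | P x ∧ size x = n}

theorem finite_sized (P : R → Prop) (n : ℕ) : (sized P n).Finite :=
  (finite_size_le n).subset fun _ h => h.2.le

/-- The multisets of elements of `R` of size at most `h` with the property `P`, with total size
`n`. -/
def bags (P : R → Prop) (h n : ℕ) : Set (Multiset R) :=
  {M | (∀ x ∈ M, P x ∧ size x ≤ h) ∧ (M.map size).sum = n}

/-- The number of multisets of total size `n` with elements of size at most `h`, if there are
`y k` elements of size `k`. -/
def bagCount (y : ℕ → ℕ) : ℕ → ℕ → ℕ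
  | 0, n => if n = 0 then 1 else 0
  | h + 1, n => ∑ j ∈ (Finset.range (n + 1)).filter (fun j => j * (h + 1) ≤ n),
      Nat.multichoose (y (h + 1)) j * bagCount y h (n - j * (h + 1))

theorem bags_zero (P : R → Prop) (n : ℕ) : bags P 0 n = if n = 0 then {0} else ∅ := by
  have key : ∀ M ∈ bags P 0 n, M = 0 := fun M hM => Multiset.eq_zero_of_forall_notMem fun x hx => by
    have := size_pos x
    have := (hM.1 x hx).2
    omega
  split_ifs with h
  · subst h
    ext M
    constructor
    · exact key M
    · rintro rfl
      exact ⟨by simp, by simp⟩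
  · refine Set.eq_empty_of_forall_notMem fun M hM => h ?_
    have := key M hM
    subst this
    exact hM.2.symm

theorem bags_succ (P : R → Prop) (h n : ℕ) : bags P (h + 1) n =
    {M | ∃ j ∈ (Finset.range (n + 1)).filter (fun j => j * (h + 1) ≤ n),
      ∃ A ∈ multisetsOf (sized P (h + 1)) j, ∃ B ∈ bags P h (n - j * (h + 1)), A + B = M} := by
  classical
  ext M
  constructor
  · rintro ⟨hM, rfl⟩
    have e := Multiset.filter_add_not (fun x => size x = h + 1) M
    set A := M.filter (fun x => size x = h + 1) with hA
    set B := M.filter (fun x => ¬ size x = h + 1) with hB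
    have hs : (A.map size).sum = A.card * (h + 1) := by
      rw [Multiset.map_congr rfl (fun x hx => (Multiset.mem_filter.1 hx).2), Multiset.map_const',
        Multiset.sum_replicate, smul_eq_mul]
    have hs' : (M.map size).sum = A.card * (h + 1) + (B.map size).sum := by
      rw [← e, Multiset.map_add, Multiset.sum_add, hs]
    refine ⟨A.card, ?_, A, ⟨fun x hx => ?_, rfl⟩, B, ⟨fun x hx => ?_, ?_⟩, e⟩
    · rw [Finset.mem_filter, Finset.mem_range]
      have := Nat.le_mul_of_pos_right A.card (show 0 < h + 1 by omega)
      constructor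
      · exact Nat.lt_succ_of_le (by omega)
      · omega
    · obtain ⟨h1, h2⟩ := Multiset.mem_filter.1 hx
      exact ⟨(hM x h1).1, h2⟩
    · obtain ⟨h1, h2⟩ := Multiset.mem_filter.1 hx
      have := hM x h1
      exact ⟨this.1, by omega⟩
    · omega
  · rintro ⟨j, hj, A, ⟨hA, rfl⟩, B, ⟨hB, hB'⟩, rfl⟩
    have hj := (Finset.mem_filter.1 hj).2
    have hs : (A.map size).sum = A.card * (h + 1) := by
      rw [Multiset.map_congr rfl (fun x hx => (hA x hx).2)]
      simp
    refine ⟨fun x hx => ?_, ?_⟩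
    · rcases Multiset.mem_add.1 hx with hx | hx
      · exact ⟨(hA x hx).1, (hA x hx).2.le⟩
      · exact ⟨(hB x hx).1, (hB x hx).2.trans (Nat.le_succ h)⟩
    · rw [Multiset.map_add, Multiset.sum_add, hs, hB']
      omega

theorem finite_bags (P : R → Prop) (h n : ℕ) : (bags P h n).Finite := by
  induction h generalizing n with
  | zero =>
    rw [bags_zero]
    split_ifs
    · exact Set.finite_singleton _
    · exact Set.finite_empty
  | succ h ih =>
    rw [bags_succ]
    exact finite_biUnion_image2 _ _ _ _ (fun _ _ => finite_multisetsOf (finite_sized P _) _)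
      fun _ _ => ih _

theorem ncard_bags (P : R → Prop) (h n : ℕ) :
    (bags P h n).ncard = bagCount (fun k => (sized P k).ncard) h n := by
  classical
  induction h generalizing n with
  | zero =>
    rw [bags_zero, bagCount]
    split_ifs <;> simp
  | succ h ih =>
    rw [bags_succ, bagCount, ncard_biUnion_image2 _ _ _ _
      (fun _ _ => finite_multisetsOf (finite_sized P _) _) fun _ _ => finite_bags P h _]
    · exact Finset.sum_congr rfl fun j _ => by rw [ncard_multisetsOf (finite_sized P _), ih]
    · rintro i - j - A ⟨hA, rfl⟩ B ⟨hB, -⟩ A' ⟨hA', rfl⟩ B' ⟨hB', -⟩ e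
      have key : ∀ {A B : Multiset R}, (∀ x ∈ A, x ∈ sized P (h + 1)) →
          (∀ x ∈ B, P x ∧ size x ≤ h) → (A + B).filter (fun x => size x = h + 1) = A := by
        intro A B hA hB
        rw [Multiset.filter_add, Multiset.filter_eq_self.2 fun x hx => (hA x hx).2,
          Multiset.filter_eq_nil.2, add_zero]
        intro x hx
        have := (hB x hx).2
        omega
      have e1 := key hA hB
      rw [e, key hA' hB'] at e1
      subst e1
      exact ⟨rfl, rfl, add_left_cancel e⟩

theorem bagCount_congr {y y' : ℕ → ℕ} {h : ℕ} (hy : ∀ k ≤ h, 1 ≤ k → y k = y' k) (n : ℕ) :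
    bagCount y h n = bagCount y' h n := by
  induction h generalizing n with
  | zero => rfl
  | succ h ih =>
    rw [bagCount, bagCount]
    refine Finset.sum_congr rfl fun j _ => ?_
    rw [hy (h + 1) le_rfl (Nat.succ_pos h), ih fun k hk => hy k (hk.trans (Nat.le_succ h))]

/-- The number of elements of `R` of size `n`. -/
noncomputable def numAll (n : ℕ) : ℕ := (sized (fun _ => True) n).ncard

/-- The number of disjoint unions, respectively joins, of size `n`. -/
noncomputable def numOp (f : Bool) (n : ℕ) : ℕ := (sized (IsOp f) n).ncard

/-- The number of elements of the form `att a b` of size `n`. -/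
noncomputable def numAtt (n : ℕ) : ℕ := (sized IsAtt n).ncard

theorem ncard_sized_not (P : R → Prop) (n : ℕ) :
    (sized (fun x => ¬ P x) n).ncard = numAll n - (sized P n).ncard := by
  have e : sized (fun _ => True) n = sized P n ∪ sized (fun x => ¬ P x) n := by
    ext x
    constructor
    · rintro ⟨-, h⟩
      by_cases hP : P x
      · exact .inl ⟨hP, h⟩
      · exact .inr ⟨hP, h⟩
    · rintro (h | h)
      · exact ⟨trivial, h.2⟩
      · exact ⟨trivial, h.2⟩
  have hd : Disjoint (sized P n) (sized (fun x => ¬ P x) n) :=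
    Set.disjoint_left.2 fun x h h' => h'.1 h.1
  rw [numAll, e, Set.ncard_union_eq hd (finite_sized _ _) (finite_sized _ _), Nat.add_sub_cancel_left]

theorem numOp_eq (f : Bool) {n : ℕ} (hn : 1 ≤ n) :
    numOp f n = bagCount (fun k => numAll k - numOp f k) (n - 1) n := by
  have e : bags (fun x => ¬ IsOp f x) (n - 1) n = fac f '' sized (IsOp f) n := by
    ext M
    constructor
    · rintro ⟨hM, hs⟩
      have h0 : M ≠ 0 := by
        rintro rfl
        simp at hs
        omega
      obtain ⟨x, rfl⟩ := exists_fac_eq h0 fun y hy => (hM y hy).1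
      rw [sum_size_fac] at hs
      refine ⟨x, ⟨?_, hs⟩, rfl⟩
      by_contra h
      have := (hM x (by rw [fac_of_not_isOp h]; exact Multiset.mem_singleton_self x)).2
      omega
    · rintro ⟨x, ⟨hx, rfl⟩, rfl⟩
      refine ⟨fun y hy => ⟨not_isOp_of_mem_fac hy, ?_⟩, sum_size_fac f x⟩
      have := size_lt_of_mem_fac hx hy
      omega
  have := ncard_bags (fun x => ¬ IsOp f x) (n - 1) n
  rw [e, Set.InjOn.ncard_image (fac_injective f).injOn] at this
  rw [numOp, this]
  exact bagCount_congr (fun k _ _ => ncard_sized_not _ _) n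

theorem numAtt_eq (n : ℕ) :
    numAtt n = ∑ i ∈ Finset.Ico 1 n, (numAll i - numAtt i) * numAll (n - i) := by
  have e : sized IsAtt n = {c | ∃ i ∈ Finset.Ico 1 n, ∃ a ∈ sized (fun x => ¬ IsAtt x) i,
      ∃ b ∈ sized (fun _ => True) (n - i), att a b = c} := by
    ext x
    constructor
    · rintro ⟨hx, rfl⟩
      obtain ⟨w, hw, -⟩ := hx.exists_att_hd
      have h1 := congrArg size hw
      rw [size_att] at h1
      have h2 := size_pos w
      have h3 := size_pos (hd x)
      exact ⟨size (hd x), Finset.mem_Ico.2 ⟨h3, by omega⟩, hd x, ⟨not_isAtt_hd x, rfl⟩, w,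
        ⟨trivial, by omega⟩, hw.symm⟩
    · rintro ⟨i, hi, a, ⟨-, rfl⟩, b, ⟨-, hb⟩, rfl⟩
      have := Finset.mem_Ico.1 hi
      exact ⟨kind_att a b, by rw [size_att]; omega⟩
  rw [numAtt, e, ncard_biUnion_image2 _ _ _ _ (fun _ _ => finite_sized _ _)
    fun _ _ => finite_sized _ _]
  · exact Finset.sum_congr rfl fun i _ => by rw [ncard_sized_not]; rfl
  · rintro i - j - a ⟨ha, rfl⟩ b - a' ⟨ha', rfl⟩ b' - h
    have h1 := congrArg hd h
    rw [hd_att, hd_att, hd_of_not_isAtt ha, hd_of_not_isAtt ha'] at h1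
    subst h1
    have h2 := congrArg tl h
    rw [tl_att, tl_att] at h2
    exact ⟨rfl, rfl, fac_injective false (add_left_cancel h2)⟩

theorem numAll_one : numAll 1 = 1 := by
  rw [numAll, Set.ncard_eq_one]
  refine ⟨leaf, Set.eq_singleton_iff_unique_mem.2 ⟨⟨trivial, size_leaf⟩, ?_⟩⟩
  rintro x ⟨-, hx⟩
  induction x using induction with
  | hl => rfl
  | ho f a b _ _ =>
    have := size_pos a
    have := size_pos b
    rw [size_op] at hx
    omega
  | ha a b _ _ =>
    have := size_pos a
    have := size_pos b
    rw [size_att] at hx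
    omega

theorem numAll_eq {n : ℕ} (hn : 2 ≤ n) :
    numAll n = numOp false n + numOp true n + numAtt n := by
  have e : sized (fun _ => True) n =
      (sized (IsOp false) n ∪ sized (IsOp true) n) ∪ sized IsAtt n := by
    ext x
    constructor
    · rintro ⟨-, h⟩
      induction x using induction with
      | hl =>
        rw [size_leaf] at h
        omega
      | ho f a b _ _ =>
        cases f
        · exact .inl (.inl ⟨kind_op _ a b, h⟩)
        · exact .inl (.inr ⟨kind_op _ a b, h⟩)
      | ha a b _ _ => exact .inr ⟨kind_att a b, h⟩
    · rintro ((h | h) | h) <;> exact ⟨trivial, h.2⟩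
  have h1 : Disjoint (sized (IsOp false) n) (sized (IsOp true) n) :=
    Set.disjoint_left.2 fun x h h' => by simpa using h.1.symm.trans h'.1
  have h2 : Disjoint (sized (IsOp false) n ∪ sized (IsOp true) n) (sized IsAtt n) := by
    refine Set.disjoint_left.2 fun x h h' => ?_
    rcases h with h | h
    · simpa using h.1.symm.trans h'.1
    · simpa using h.1.symm.trans h'.1
  rw [numAll, e, Set.ncard_union_eq h2 ((finite_sized _ _).union (finite_sized _ _))
    (finite_sized _ _), Set.ncard_union_eq h1 (finite_sized _ _) (finite_sized _ _)]
  rfl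

/-- The pairs of halves of the graphs with `2 * m` vertices whose centroid is an edge. -/
def edgePairs (m : ℕ) : Set (Sym2 R) :=
  {p | ∃ a b, p = s(a, b) ∧ size a = m ∧ size b = m ∧ ¬ (IsOp true a ∧ IsOp true b) ∧
    ¬ (IsOp false a ∧ IsAtt b) ∧ ¬ (IsAtt a ∧ IsOp false b)}

theorem edgePairs_eq (m : ℕ) : (edgePairs m).Finite ∧ (edgePairs m).ncard =
    (numAll m + 1).choose 2 - ((numOp true m + 1).choose 2 + numOp false m * numAtt m) := by
  classical
  set S := (finite_sized (fun _ => True) m).toFinset with hS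
  set T := (finite_sized (IsOp true) m).toFinset with hT
  set U := (finite_sized (IsOp false) m).toFinset with hU
  set W := (finite_sized IsAtt m).toFinset with hW
  have hS' : ∀ x, x ∈ S ↔ size x = m := fun x => by simp [hS, sized]
  have hT' : ∀ x, x ∈ T ↔ IsOp true x ∧ size x = m := fun x => by simp [hT, sized]
  have hU' : ∀ x, x ∈ U ↔ IsOp false x ∧ size x = m := fun x => by simp [hU, sized]
  have hW' : ∀ x, x ∈ W ↔ IsAtt x ∧ size x = m := fun x => by simp [hW, sized]
  set B := (U ×ˢ W).image fun p => s(p.1, p.2) with hB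
  have hB' : ∀ a b, s(a, b) ∈ B ↔ (a ∈ U ∧ b ∈ W) ∨ (b ∈ U ∧ a ∈ W) := fun a b => by
    rw [hB, Finset.mem_image]
    constructor
    · rintro ⟨⟨u, w⟩, h, h'⟩
      rw [Finset.mem_product] at h
      rcases Sym2.eq_iff.1 h' with ⟨rfl, rfl⟩ | ⟨rfl, rfl⟩
      · exact .inl h
      · exact .inr h
    · rintro (h | h)
      · exact ⟨(a, b), Finset.mem_product.2 h, rfl⟩
      · exact ⟨(b, a), Finset.mem_product.2 h, Sym2.eq_swap⟩
  have e : edgePairs m = ↑(S.sym2 \ (T.sym2 ∪ B)) := by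
    ext p
    induction p using Sym2.ind with
    | _ a b =>
      rw [Finset.mem_coe, Finset.mem_sdiff, Finset.mem_union, Finset.mk_mem_sym2_iff,
        Finset.mk_mem_sym2_iff, hB', hS', hS', hT', hT', hU', hU', hW', hW']
      constructor
      · rintro ⟨a', b', h, h1, h2, h3, h4, h5⟩
        rcases Sym2.eq_iff.1 h with ⟨rfl, rfl⟩ | ⟨rfl, rfl⟩ <;> tauto
      · intro h
        exact ⟨a, b, rfl, by tauto⟩
  have hBS : T.sym2 ∪ B ⊆ S.sym2 := by
    intro p
    induction p using Sym2.ind with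
    | _ a b =>
      rw [Finset.mem_union, Finset.mk_mem_sym2_iff, Finset.mk_mem_sym2_iff, hB', hS', hS', hT',
        hT', hU', hU', hW', hW']
      tauto
  have hd : Disjoint T.sym2 B := by
    rw [Finset.disjoint_left]
    intro p
    induction p using Sym2.ind with
    | _ a b =>
      rw [Finset.mk_mem_sym2_iff, hB', hT', hT', hU', hU', hW', hW']
      rintro ⟨ha, hb⟩ (h | h)
      · simpa using ha.1.symm.trans h.1.1
      · simpa using ha.1.symm.trans h.2.1
  have hc : B.card = U.card * W.card := by
    rw [hB, Finset.card_image_of_injOn, Finset.card_product]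
    rintro ⟨a, b⟩ h ⟨a', b'⟩ h' he
    rw [Finset.mem_coe, Finset.mem_product, hU', hW'] at h h'
    rcases Sym2.eq_iff.1 he with ⟨h1, h2⟩ | ⟨h1, h2⟩
    · exact Prod.ext h1 h2
    · replace h1 : a = b' := h1
      have h3 : IsOp false b' := h1 ▸ h.1.1
      simpa using h3.symm.trans h'.2.1
  refine ⟨e ▸ Finset.finite_toSet _, ?_⟩
  rw [e, Set.ncard_coe_finset, Finset.card_sdiff_of_subset hBS, Finset.card_union_of_disjoint hd,
    hc, Finset.card_sym2, Finset.card_sym2, numAll, numOp, numOp, numAtt,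
    Set.ncard_eq_toFinset_card _ (finite_sized _ m), Set.ncard_eq_toFinset_card _ (finite_sized _ m),
    Set.ncard_eq_toFinset_card _ (finite_sized _ m), Set.ncard_eq_toFinset_card _ (finite_sized _ m)]

theorem ncard_stars (h n : ℕ) :
    let s := {N | ∃ i ∈ Finset.Icc 1 h, ∃ c ∈ sized (fun x => ¬ IsAtt x) i,
      ∃ M ∈ bags (fun x => ¬ IsOp false x) h (n - i), NF.star c M = N}
    s.Finite ∧ s.ncard = ∑ i ∈ Finset.Icc 1 h, (numAll i - numAtt i) *
      bagCount (fun k => numAll k - numOp false k) h (n - i) := by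
  refine ⟨finite_biUnion_image2 _ _ _ _ (fun _ _ => finite_sized _ _) fun _ _ => finite_bags _ _ _,
    ?_⟩
  rw [ncard_biUnion_image2 _ _ _ _ (fun _ _ => finite_sized _ _) fun _ _ => finite_bags _ _ _]
  · refine Finset.sum_congr rfl fun i _ => ?_
    rw [ncard_sized_not, ncard_bags, numAtt]
    congr 1
    exact bagCount_congr (fun k _ _ => ncard_sized_not _ _) _
  · rintro i - j - c ⟨-, rfl⟩ M - c' ⟨-, rfl⟩ M' - he
    obtain ⟨rfl, rfl⟩ := NF.star.inj he
    exact ⟨rfl, rfl, rfl⟩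

theorem card_valid {n : ℕ} (hn : 1 ≤ n) : Nat.card {N : NF // N.Valid n} =
    (if 2 ∣ n then (edgePairs (n / 2)).ncard else 0) +
      bagCount (fun k => numAll k - numOp true k) ((n - 1) / 2) n +
      ∑ i ∈ Finset.Icc 1 ((n - 1) / 2), (numAll i - numAtt i) *
        bagCount (fun k => numAll k - numOp false k) ((n - 1) / 2) (n - i) := by
  set h := (n - 1) / 2 with hh
  have hlt : ∀ k, 2 * k < n ↔ k ≤ h := fun k => by omega
  obtain ⟨hsf, hsc⟩ := ncard_stars h n
  have hcc : (bags (fun x => ¬ IsOp true x) h n).ncard =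
      bagCount (fun k => numAll k - numOp true k) h n :=
    (ncard_bags _ _ _).trans (bagCount_congr (fun k _ _ => ncard_sized_not _ _) _)
  rw [← hsc, ← hcc]
  set E : Set (Sym2 R) := if 2 ∣ n then edgePairs (n / 2) else ∅ with hE
  have hEf : E.Finite := by
    rw [hE]
    split_ifs
    · exact (edgePairs_eq _).1
    · exact Set.finite_empty
  have hEc : (if 2 ∣ n then (edgePairs (n / 2)).ncard else 0) = E.ncard := by
    rw [hE]
    split_ifs
    · rfl
    · exact Set.ncard_empty _ |>.symm
  rw [hEc]
  set Z := {N | ∃ i ∈ Finset.Icc 1 h, ∃ c ∈ sized (fun x => ¬ IsAtt x) i,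
      ∃ M ∈ bags (fun x => ¬ IsOp false x) h (n - i), NF.star c M = N} with hZ
  have e : {N : NF | N.Valid n} =
      (NF.edge '' E ∪ NF.clique '' bags (fun x => ¬ IsOp true x) h n) ∪ Z := by
    ext N
    constructor
    · rintro (⟨a, b, h1, h2, h3, h4, h5⟩ | ⟨M, h1, h2⟩ | ⟨c, M, h1, h2, h3, h4⟩)
      · refine .inl (.inl ⟨_, ?_, rfl⟩)
        rw [hE, if_pos (by omega)]
        exact ⟨a, b, rfl, by omega, by omega, h3, h4, h5⟩
      · exact .inl (.inr ⟨M, ⟨fun x hx => ⟨(h1 x hx).1, (hlt _).1 (h1 x hx).2⟩, h2⟩, rfl⟩)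
      · exact .inr ⟨size c, Finset.mem_Icc.2 ⟨size_pos c, (hlt _).1 h2⟩, c, ⟨h1, rfl⟩, M,
          ⟨fun x hx => ⟨(h3 x hx).1, (hlt _).1 (h3 x hx).2⟩, by omega⟩, rfl⟩
    · rintro ((⟨p, hp, rfl⟩ | ⟨M, hM, rfl⟩) | ⟨i, hi, c, ⟨hc, rfl⟩, M, hM, rfl⟩)
      · rw [hE] at hp
        by_cases h2 : 2 ∣ n
        · rw [if_pos h2] at hp
          obtain ⟨a, b, rfl, h3, h4, h5, h6, h7⟩ := hp
          exact .edge a b (by omega) (by omega) h5 h6 h7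
        · rw [if_neg h2] at hp
          exact absurd hp (Set.notMem_empty p)
      · exact .clique M (fun x hx => ⟨(hM.1 x hx).1, (hlt _).2 (hM.1 x hx).2⟩) hM.2
      · have hi := Finset.mem_Icc.1 hi
        have := hM.2
        exact .star c M hc ((hlt _).2 hi.2)
          (fun x hx => ⟨(hM.1 x hx).1, (hlt _).2 (hM.1 x hx).2⟩) (by omega)
  have hi1 : Function.Injective NF.edge := fun _ _ h => NF.edge.inj h
  have hi2 : Function.Injective NF.clique := fun _ _ h => NF.clique.inj h
  have hd1 : Disjoint (NF.edge '' E) (NF.clique '' bags (fun x => ¬ IsOp true x) h n) := by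
    rw [Set.disjoint_left]
    rintro _ ⟨p, -, rfl⟩ ⟨M, -, he⟩
    exact NF.noConfusion he
  have hd2 : Disjoint (NF.edge '' E ∪ NF.clique '' bags (fun x => ¬ IsOp true x) h n) Z := by
    rw [Set.disjoint_left]
    rintro _ (⟨p, -, rfl⟩ | ⟨M, -, rfl⟩) ⟨i, -, c, -, M', -, he⟩
    · exact NF.noConfusion he
    · exact NF.noConfusion he
  have hfb := finite_bags (fun x => ¬ IsOp true x) h n
  have := Nat.card_coe_set_eq {N : NF | N.Valid n}
  rw [e, Set.ncard_union_eq hd2 ((hEf.image _).union (hfb.image _)) hsf,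
    Set.ncard_union_eq hd1 (hEf.image _) (hfb.image _), Set.InjOn.ncard_image hi1.injOn,
    Set.InjOn.ncard_image hi2.injOn, ← e] at this
  exact this

/-- A version of `bagCount` suited to evaluation. -/
def bagEval (y : ℕ → ℕ) : ℕ → ℕ → ℕ
  | 0, n => if n = 0 then 1 else 0
  | h + 1, n => ∑ j ∈ (Finset.range (n + 1)).filter (fun j => j * (h + 1) ≤ n),
      (y (h + 1) + j - 1).descFactorial j / j.factorial * bagEval y h (n - j * (h + 1))

theorem bagCount_eq_bagEval (y : ℕ → ℕ) (h n : ℕ) : bagCount y h n = bagEval y h n := by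
  induction h generalizing n with
  | zero => rfl
  | succ h ih =>
    rw [bagCount, bagEval]
    exact Finset.sum_congr rfl fun j _ => by
      rw [ih, Nat.multichoose_eq, Nat.choose_eq_descFactorial_div_factorial]

/-- The values of `numAll`. -/
def tabAll (k : ℕ) : ℕ := [0, 1, 3, 11, 51, 253, 1373, 7759, 45557, 274349].getD k 0

/-- The values of `numOp`. -/
def tabOp (k : ℕ) : ℕ := [0, 0, 1, 3, 14, 67, 367, 2065, 12150, 73177].getD k 0

/-- The values of `numAtt`. -/
def tabAtt (k : ℕ) : ℕ := [0, 0, 1, 5, 23, 119, 639, 3629, 21257, 127995].getD k 0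

theorem tab_spec : ∀ n ∈ Finset.Icc 1 9,
    bagEval (fun k => tabAll k - tabOp k) (n - 1) n = tabOp n ∧
    ∑ i ∈ Finset.Ico 1 n, (tabAll i - tabAtt i) * tabAll (n - i) = tabAtt n ∧
    (2 ≤ n → tabOp n + tabOp n + tabAtt n = tabAll n) := by
  decide +kernel

theorem values_eq_tab {n : ℕ} (hn : 1 ≤ n) (hn' : n ≤ 9) :
    numAll n = tabAll n ∧ (∀ f, numOp f n = tabOp n) ∧ numAtt n = tabAtt n := by
  induction n using Nat.strong_induction_on with
  | _ n ih =>
    obtain ⟨h1, h2, h3⟩ := tab_spec n (Finset.mem_Icc.2 ⟨hn, hn'⟩)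
    have ho : ∀ f, numOp f n = tabOp n := fun f => by
      rw [numOp_eq f hn, ← h1, ← bagCount_eq_bagEval]
      refine bagCount_congr (fun k hk hk1 => ?_) n
      obtain ⟨e1, e2, -⟩ := ih k (by omega) hk1 (by omega)
      simp only [e1, e2]
    have hx : numAtt n = tabAtt n := by
      rw [numAtt_eq, ← h2]
      refine Finset.sum_congr rfl fun i hi => ?_
      rw [Finset.mem_Ico] at hi
      obtain ⟨e1, -, e3⟩ := ih i hi.2 hi.1 (by omega)
      rw [e1, e3, (ih (n - i) (by omega) (by omega) (by omega)).1]
    refine ⟨?_, ho, hx⟩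
    by_cases h : 2 ≤ n
    · rw [numAll_eq h, ho, ho, hx, h3 h]
    · obtain rfl : n = 1 := by omega
      exact numAll_one

/-- The number of valid normal forms, computed from the tables. -/
def total (n : ℕ) : ℕ :=
  (if 2 ∣ n then (tabAll (n / 2) + 1).descFactorial 2 / 2 -
      ((tabOp (n / 2) + 1).descFactorial 2 / 2 + tabOp (n / 2) * tabAtt (n / 2)) else 0) +
    bagEval (fun k => tabAll k - tabOp k) ((n - 1) / 2) n +
    ∑ i ∈ Finset.Icc 1 ((n - 1) / 2), (tabAll i - tabAtt i) *
      bagEval (fun k => tabAll k - tabOp k) ((n - 1) / 2) (n - i)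

theorem numConnDH_eq_total {n : ℕ} (hn : 2 ≤ n) (hn' : n ≤ 18) : numConnDH n = total n := by
  have hb : ∀ f m, bagCount (fun k => numAll k - numOp f k) ((n - 1) / 2) m =
      bagEval (fun k => tabAll k - tabOp k) ((n - 1) / 2) m := fun f m => by
    rw [← bagCount_eq_bagEval]
    refine bagCount_congr (fun k hk hk1 => ?_) m
    obtain ⟨e1, e2, -⟩ := values_eq_tab hk1 (by omega)
    simp only [e1, e2]
  obtain ⟨e1, e2, e3⟩ := values_eq_tab (n := n / 2) (by omega) (by omega)
  rw [numConnDH_eq hn, card_valid (by omega), (edgePairs_eq _).2, hb, e1, e2, e2, e3, total,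
    Nat.choose_eq_descFactorial_div_factorial, Nat.choose_eq_descFactorial_div_factorial,
    Nat.factorial_two]
  congr 1
  refine Finset.sum_congr rfl fun i hi => ?_
  rw [Finset.mem_Icc] at hi
  obtain ⟨e1, -, e3⟩ := values_eq_tab hi.1 (by omega)
  rw [e1, e3, hb]

end DHCount

theorem numConnDH_values :
    numConnDH 1 = 1 ∧ numConnDH 2 = 1 ∧ numConnDH 3 = 2 ∧ numConnDH 4 = 6 ∧
    numConnDH 5 = 18 ∧ numConnDH 6 = 73 ∧ numConnDH 7 = 308 ∧ numConnDH 8 = 1484 ∧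
    numConnDH 9 = 7492 ∧ numConnDH 10 = 40010 ∧ numConnDH 11 = 220676 ∧
    numConnDH 12 = 1253940 ∧ numConnDH 13 = 7282316 ∧ numConnDH 14 = 43096792 ∧
    numConnDH 15 = 259019070 ∧ numConnDH 16 = 1577653196 ∧
    numConnDH 17 = 9720170360 ∧ numConnDH 18 = 60492629435 := by
  refine ⟨DHCount.numConnDH_one, ?_⟩
  iterate 17 rw [DHCount.numConnDH_eq_total (by norm_num) (by norm_num)]
  decide +kernel
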